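/- Let A : ℝ → ℝ be Lipschitz with constant L and let p ∈ (1,∞). Assume b ∈ BMO(ℝ) with ‖b‖_BMO = 1, and that there exist ε > 0 and a sequence of bounded intervals I_j = (x_j − r_j, x_j + r_j), j ≥ 1, such that M(b, I_j) > ε for every j. Then there exist functions f_j ∈ L^p(ℝ) and positive constants A₁ > 4, C̃₀, C̃₁, C̃₂ (independent of j and k) such that for every j: ‖f_j‖_{L^p(ℝ)} ≤ C̃₀, and for every integer k ≥ ⌊log₂ A₁⌋: (a) ∫_{I_j^k} |[b,C_Γ]f_j(y)|^p dy ≥ C̃₁ ε^p (|I_j|/|2^k I_j|)^{p−1}, where I_j^k := (x_j + 2^k r_j, x_j + 2^{k+1} r_j); and (b) ∫_{2^{k+1}I_j ∖ 2^k I_j} |[b,C_Γ]f_j(y)|^p dy ≤ C̃₂ (|I_j|/|2^k I_j|)^{p−1}, where 2^k I_j := (x_j − 2^k r_j, x_j + 2^k r_j). -/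

import Mathlib

open MeasureTheory Filter Set
open scoped ENNReal

/-- The Cauchy kernel `K(x,y) = 1/(y - x + i(A(y) - A(x)))` associated to `A`. -/
noncomputable def cauchyKernel (A : ℝ → ℝ) (x y : ℝ) : ℂ :=
  ((y : ℂ) - (x : ℂ) + Complex.I * ((A y : ℂ) - (A x : ℂ)))⁻¹

/-- `cauchyPV A f x v` : the principal value `C_Γ f (x)` exists and equals `v`. -/
def cauchyPV (A : ℝ → ℝ) (f : ℝ → ℂ) (x : ℝ) (v : ℂ) : Prop :=
  Filter.Tendsto (fun δ : ℝ => ∫ y in {y : ℝ | δ < |y - x|}, cauchyKernel A x y * f y)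
    (nhdsWithin 0 (Set.Ioi 0)) (nhds v)

/-- `g` agrees a.e. with the commutator `[b, C_Γ] f = b • C_Γ f - C_Γ (b f)`. -/
def IsCommutatorFn (A b : ℝ → ℝ) (f g : ℝ → ℂ) : Prop :=
  ∀ᵐ x : ℝ, ∃ u w : ℂ,
    cauchyPV A f x u ∧ cauchyPV A (fun y => (b y : ℂ) * f y) x w ∧
    g x = (b x : ℂ) * u - w

/-- Average of `b` over the interval `I(x,r) = (x - r, x + r)`. -/
noncomputable def intervalAvg (b : ℝ → ℝ) (x r : ℝ) : ℝ :=
  (2 * r)⁻¹ * ∫ y in Set.Ioo (x - r) (x + r), b y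

/-- Mean oscillation `M(b, I(x,r))`. -/
noncomputable def meanOsc (b : ℝ → ℝ) (x r : ℝ) : ℝ :=
  (2 * r)⁻¹ * ∫ y in Set.Ioo (x - r) (x + r), |b y - intervalAvg b x r|

def IsBMOWith (b : ℝ → ℝ) (N : ℝ) : Prop :=
  MeasureTheory.LocallyIntegrable b volume ∧ ∀ x r : ℝ, 0 < r → meanOsc b x r ≤ N

/-- `b ∈ BMO(ℝ)`. -/
def IsBMO (b : ℝ → ℝ) : Prop := ∃ N : ℝ, IsBMOWith b N

/-- `‖b‖_BMO`, the supremum of the mean oscillations of `b` over all bounded intervals. -/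
noncomputable def bmoNorm (b : ℝ → ℝ) : ℝ := sInf {N : ℝ | IsBMOWith b N}

/-- The point of the graph of `A` above `x`. -/
noncomputable def graphPt (A : ℝ → ℝ) (x : ℝ) : ℂ := (x : ℂ) + Complex.I * (A x : ℂ)

section Kernel

variable {A : ℝ → ℝ} {L : ℝ}

lemma graphPt_sub_re (x y : ℝ) : (graphPt A y - graphPt A x).re = y - x := by
  simp [graphPt]

lemma graphPt_sub_im (x y : ℝ) : (graphPt A y - graphPt A x).im = A y - A x := by
  simp [graphPt]

lemma cauchyKernel_eq (x y : ℝ) : cauchyKernel A x y = (graphPt A y - graphPt A x)⁻¹ := by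
  unfold cauchyKernel graphPt
  congr 1
  ring

lemma cauchyKernel_antisymm (x y : ℝ) : cauchyKernel A y x = -cauchyKernel A x y := by
  rw [cauchyKernel_eq, cauchyKernel_eq, ← inv_neg, neg_sub]

lemma abs_sub_le_norm_graphPt_sub (x y : ℝ) : |y - x| ≤ ‖graphPt A y - graphPt A x‖ := by
  rw [← graphPt_sub_re (A := A) x y]
  exact Complex.abs_re_le_norm _

lemma norm_graphPt_sub_le (hA : ∀ x₁ x₂ : ℝ, |A x₁ - A x₂| ≤ L * |x₁ - x₂|) (x y : ℝ) :
    ‖graphPt A y - graphPt A x‖ ≤ (1 + L) * |y - x| := by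
  have h := Complex.norm_le_abs_re_add_abs_im (graphPt A y - graphPt A x)
  rw [graphPt_sub_re, graphPt_sub_im] at h
  linarith [hA y x]

lemma graphPt_sub_ne_zero {x y : ℝ} (h : y ≠ x) : graphPt A y - graphPt A x ≠ 0 := by
  rw [← norm_pos_iff]
  exact (abs_pos.2 (sub_ne_zero.2 h)).trans_le (abs_sub_le_norm_graphPt_sub x y)

lemma norm_cauchyKernel_le (x y : ℝ) : ‖cauchyKernel A x y‖ ≤ |y - x|⁻¹ := by
  rcases eq_or_ne y x with rfl | h
  · simp [cauchyKernel_eq]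
  · rw [cauchyKernel_eq, norm_inv]
    exact inv_anti₀ (abs_pos.2 (sub_ne_zero.2 h)) (abs_sub_le_norm_graphPt_sub x y)

lemma le_norm_cauchyKernel (hA : ∀ x₁ x₂ : ℝ, |A x₁ - A x₂| ≤ L * |x₁ - x₂|) (x y : ℝ) :
    ((1 + L) * |y - x|)⁻¹ ≤ ‖cauchyKernel A x y‖ := by
  rcases eq_or_ne y x with rfl | h
  · simp
  · rw [cauchyKernel_eq, norm_inv]
    exact inv_anti₀ (norm_pos_iff.2 (graphPt_sub_ne_zero h)) (norm_graphPt_sub_le hA x y)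

lemma norm_cauchyKernel_sub_le (hA : ∀ x₁ x₂ : ℝ, |A x₁ - A x₂| ≤ L * |x₁ - x₂|) (hL : 0 < L)
    {x y y' : ℝ} (h : y ≠ x) (h' : y' ≠ x) :
    ‖cauchyKernel A x y - cauchyKernel A x y'‖ ≤
      (1 + L) * |y - y'| / (|y - x| * |y' - x|) := by
  rw [cauchyKernel_eq, cauchyKernel_eq,
    inv_sub_inv (graphPt_sub_ne_zero h) (graphPt_sub_ne_zero h'), norm_div, norm_mul]
  have e : graphPt A y' - graphPt A x - (graphPt A y - graphPt A x) =
    graphPt A y' - graphPt A y := by ring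
  rw [e]
  have h1 := norm_graphPt_sub_le hA y y'
  rw [abs_sub_comm y' y] at h1
  have := abs_pos.2 (sub_ne_zero.2 h)
  have := abs_pos.2 (sub_ne_zero.2 h')
  exact div_le_div₀ (by positivity) h1 (by positivity)
    (mul_le_mul (abs_sub_le_norm_graphPt_sub x y) (abs_sub_le_norm_graphPt_sub x y')
      (by positivity) (by positivity))

lemma continuous_of_lipBound (hA : ∀ x₁ x₂ : ℝ, |A x₁ - A x₂| ≤ L * |x₁ - x₂|) :
    Continuous A :=
  (LipschitzWith.of_dist_le' (K := L) fun x y => by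
    simpa [Real.dist_eq] using hA x y).continuous

lemma measurable_cauchyKernel (hA : Measurable A) :
    Measurable fun q : ℝ × ℝ => cauchyKernel A q.1 q.2 := by
  unfold cauchyKernel
  fun_prop

/-- The Cauchy kernel cut off to `|y - x| > δ`. -/
noncomputable def truncKernel (A : ℝ → ℝ) (δ x y : ℝ) : ℂ :=
  if δ < |y - x| then cauchyKernel A x y else 0

lemma measurable_truncKernel (hA : Measurable A) (δ : ℝ) :
    Measurable fun q : ℝ × ℝ => truncKernel A δ q.1 q.2 := by
  unfold truncKernel
  exact Measurable.ite (measurableSet_lt measurable_const (by fun_prop))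
    (measurable_cauchyKernel hA) measurable_const

lemma measurable_truncKernel_right (hA : Measurable A) (δ x : ℝ) :
    Measurable (truncKernel A δ x) :=
  (measurable_truncKernel hA δ).comp (measurable_const.prodMk measurable_id)

lemma norm_truncKernel_le {δ : ℝ} (hδ : 0 < δ) (x y : ℝ) : ‖truncKernel A δ x y‖ ≤ δ⁻¹ := by
  unfold truncKernel
  split_ifs with h
  · exact (norm_cauchyKernel_le x y).trans (inv_anti₀ hδ h.le)
  · simpa using hδ.le

lemma truncKernel_antisymm (δ x y : ℝ) : truncKernel A δ y x = -truncKernel A δ x y := by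
  unfold truncKernel
  rw [abs_sub_comm, cauchyKernel_antisymm x y]
  split_ifs <;> simp

/-- The truncated Cauchy integral. -/
noncomputable def truncCauchy (A : ℝ → ℝ) (δ : ℝ) (F : ℝ → ℂ) (x : ℝ) : ℂ :=
  ∫ y, truncKernel A δ x y * F y

lemma truncCauchy_eq (δ : ℝ) (F : ℝ → ℂ) (x : ℝ) :
    truncCauchy A δ F x = ∫ y in {y : ℝ | δ < |y - x|}, cauchyKernel A x y * F y := by
  have hm : MeasurableSet {y : ℝ | δ < |y - x|} :=
    measurableSet_lt measurable_const (by fun_prop)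
  rw [← integral_indicator hm]
  unfold truncCauchy truncKernel
  congr 1
  ext y
  by_cases h : δ < |y - x| <;> simp [h]

lemma integrable_truncKernel_mul (hA : Measurable A) {δ : ℝ} (hδ : 0 < δ) {F : ℝ → ℂ}
    {μ : Measure ℝ} (hF : Integrable F μ) (x : ℝ) :
    Integrable (fun y => truncKernel A δ x y * F y) μ :=
  hF.bdd_mul (c := δ⁻¹) (measurable_truncKernel_right hA δ x).aestronglyMeasurable
    (Eventually.of_forall fun y => norm_truncKernel_le hδ x y)

end Kernel

section Entropy

lemma intervalIntegrable_div_of_bdd {E : ℝ → ℝ} (hE : Measurable E) {Λ ℓ : ℝ}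
    (hE0 : ∀ h ∈ Ioc 0 ℓ, 0 ≤ E h) (hEΛ : ∀ h ∈ Ioc 0 ℓ, E h ≤ Λ) {c d : ℝ} (hc : 0 < c)
    (hcd : c ≤ d) (hd : d ≤ ℓ) : IntervalIntegrable (fun u => E u / u) volume c d := by
  rw [intervalIntegrable_iff_integrableOn_Ioc_of_le hcd]
  refine Measure.integrableOn_of_bounded (M := Λ / c) (by simp)
    (hE.div measurable_id).aestronglyMeasurable ?_
  refine (ae_restrict_iff' measurableSet_Ioc).2 (Eventually.of_forall fun u hu => ?_)
  have hu' : u ∈ Ioc 0 ℓ := ⟨hc.trans hu.1, hu.2.trans hd⟩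
  rw [Real.norm_of_nonneg (div_nonneg (hE0 u hu') hu'.1.le)]
  exact div_le_div₀ ((hE0 u hu').trans (hEΛ u hu')) (hEΛ u hu') hc hu.1.le

lemma integral_scaled_sub_le {E : ℝ → ℝ} (hE : Measurable E) {Λ ℓ δ θ : ℝ}
    (hE0 : ∀ h ∈ Ioc 0 ℓ, 0 ≤ E h) (hEΛ : ∀ h ∈ Ioc 0 ℓ, E h ≤ Λ) (hδ : 0 < δ) (hδℓ : δ ≤ ℓ)
    (hθ : θ ∈ Ioo 0 1) :
    IntervalIntegrable (fun h => E (θ * h) / h) volume δ ℓ ∧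
    (∫ h in δ..ℓ, E (θ * h) / h) - ∫ h in δ..ℓ, E h / h ≤ Λ * Real.log (1 / θ) := by
  obtain ⟨hθ0, hθ1⟩ := hθ
  have hinv_int := fun {c d : ℝ} (hc : 0 < c) (hcd : c ≤ d) (hd : d ≤ ℓ) =>
    intervalIntegrable_div_of_bdd hE hE0 hEΛ hc hcd hd
  have hθδ : θ * δ ≤ δ := by nlinarith
  have hθℓ : θ * ℓ ≤ ℓ := by nlinarith
  have hθδℓ : θ * δ ≤ θ * ℓ := by nlinarith
  have hp : 0 < θ * δ := by positivity
  have hp' : 0 < θ * ℓ := mul_pos hθ0 (hδ.trans_le hδℓ)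
  have e : (fun h => E (θ * h) / h) = fun h => θ * (E (θ * h) / (θ * h)) := by
    ext h
    rcases eq_or_ne h 0 with rfl | hh
    · simp
    · field_simp
  have i0 : IntervalIntegrable (fun h => E (θ * h) / h) volume δ ℓ := by
    rw [e]
    have := ((hinv_int hp hθδℓ hθℓ).comp_mul_left (c := θ)).const_mul θ
    simpa [mul_div_cancel_left₀ _ hθ0.ne'] using this
  refine ⟨i0, ?_⟩
  have h1 : ∫ h in δ..ℓ, E (θ * h) / h = ∫ u in (θ * δ)..(θ * ℓ), E u / u := by
    rw [e, intervalIntegral.integral_const_mul,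
      intervalIntegral.mul_integral_comp_mul_left (f := fun u => E u / u)]
  have h2 := intervalIntegral.integral_add_adjacent_intervals
    (hinv_int hp hθδℓ hθℓ) (hinv_int hp' hθℓ le_rfl)
  have h3 := intervalIntegral.integral_add_adjacent_intervals
    (hinv_int hp hθδ hδℓ) (hinv_int hδ hδℓ le_rfl)
  have h4 : 0 ≤ ∫ u in (θ * ℓ)..ℓ, E u / u :=
    intervalIntegral.integral_nonneg hθℓ fun u hu =>
      div_nonneg (hE0 u ⟨hp'.trans_le hu.1, hu.2⟩) (hp'.trans_le hu.1).le
  have h5 : ∫ u in (θ * δ)..δ, E u / u ≤ ∫ u in (θ * δ)..δ, Λ * (1 / u) := by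
    refine intervalIntegral.integral_mono_on hθδ (hinv_int hp hθδ hδℓ) ?_ fun u hu => ?_
    · refine (ContinuousOn.intervalIntegrable ?_)
      rw [uIcc_of_le hθδ]
      exact continuousOn_const.mul (continuousOn_const.div continuousOn_id
        fun u hu => (hp.trans_le hu.1).ne')
    · rw [mul_one_div]
      exact div_le_div_of_nonneg_right (hEΛ u ⟨hp.trans_le hu.1, hu.2.trans hδℓ⟩)
        (hp.trans_le hu.1).le
  rw [intervalIntegral.integral_const_mul, integral_one_div_of_pos hp hδ] at h5
  have h6 : δ / (θ * δ) = 1 / θ := by field_simp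
  rw [h6] at h5
  linarith

lemma integral_entropy_le {E : ℝ → ℝ} (hE : Measurable E) {Λ ℓ δ θ : ℝ}
    (hE0 : ∀ h ∈ Ioc 0 ℓ, 0 ≤ E h) (hEΛ : ∀ h ∈ Ioc 0 ℓ, E h ≤ Λ) (hδ : 0 < δ) (hδℓ : δ ≤ ℓ)
    (hθ : θ ∈ Ioo 0 1) :
    IntervalIntegrable (fun h => (θ * E (θ * h) + (1 - θ) * E ((1 - θ) * h) - E h) / h)
      volume δ ℓ ∧
    ∫ h in δ..ℓ, (θ * E (θ * h) + (1 - θ) * E ((1 - θ) * h) - E h) / h ≤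
      Λ * (θ * Real.log (1 / θ) + (1 - θ) * Real.log (1 / (1 - θ))) := by
  have hθ' : 1 - θ ∈ Ioo (0 : ℝ) 1 := ⟨by linarith [hθ.2], by linarith [hθ.1]⟩
  obtain ⟨i1, h1⟩ := integral_scaled_sub_le hE hE0 hEΛ hδ hδℓ hθ
  obtain ⟨i2, h2⟩ := integral_scaled_sub_le hE hE0 hEΛ hδ hδℓ hθ'
  have i3 := intervalIntegrable_div_of_bdd hE hE0 hEΛ hδ hδℓ le_rfl
  have e : (fun h => (θ * E (θ * h) + (1 - θ) * E ((1 - θ) * h) - E h) / h) =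
      fun h => (θ * (E (θ * h) / h) + (1 - θ) * (E ((1 - θ) * h) / h)) - E h / h := by
    ext h; ring
  rw [e]
  refine ⟨((i1.const_mul θ).add (i2.const_mul (1 - θ))).sub i3, ?_⟩
  rw [intervalIntegral.integral_sub ((i1.const_mul θ).add (i2.const_mul (1 - θ))) i3,
    intervalIntegral.integral_add (i1.const_mul θ) (i2.const_mul (1 - θ)),
    intervalIntegral.integral_const_mul, intervalIntegral.integral_const_mul]
  have := mul_le_mul_of_nonneg_left h1 hθ.1.le
  have := mul_le_mul_of_nonneg_left h2 hθ'.1.le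
  linarith

lemma log_one_div_le {θ : ℝ} (hθ : θ ∈ Ioo (0 : ℝ) 1) :
    Real.log (1 / θ) ≤ (1 - θ) / √θ := by
  have hs : 0 < √θ := Real.sqrt_pos.2 hθ.1
  have hs1 : √θ < 1 := by
    rw [Real.sqrt_lt' one_pos]; simpa using hθ.2
  have h2 : √θ * √θ = θ := Real.mul_self_sqrt hθ.1.le
  have key : ∀ t : ℝ, 1 ≤ t → 2 * Real.log t ≤ t - t⁻¹ := by
    intro t ht
    have hmono : MonotoneOn (fun t : ℝ => t - t⁻¹ - 2 * Real.log t) (Ici 1) := by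
      refine monotoneOn_of_deriv_nonneg (convex_Ici 1) ?_ ?_ ?_
      · refine ((continuousOn_id.sub (continuousOn_id.inv₀ ?_)).sub
          (continuousOn_const.mul (Real.continuousOn_log.mono ?_)))
        · intro x hx; exact (zero_lt_one.trans_le hx).ne'
        · intro x hx; exact (zero_lt_one.trans_le hx).ne'
      · intro x hx
        rw [interior_Ici] at hx
        have hx0 : x ≠ 0 := (zero_lt_one.trans hx).ne'
        exact (((hasDerivAt_id x).sub (hasDerivAt_inv hx0)).sub
          ((Real.hasDerivAt_log hx0).const_mul 2)).differentiableAt.differentiableWithinAt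
      · intro x hx
        rw [interior_Ici] at hx
        have hx0 : x ≠ 0 := (zero_lt_one.trans hx).ne'
        have := (((hasDerivAt_id x).sub (hasDerivAt_inv hx0)).sub
          ((Real.hasDerivAt_log hx0).const_mul 2)).deriv
        have e : deriv (fun t : ℝ => t - t⁻¹ - 2 * Real.log t) x = (1 - x⁻¹) ^ 2 := by
          refine Eq.trans this ?_
          field_simp
          ring
        rw [e]
        positivity
    have := hmono (self_mem_Ici) ht ht
    simp at this
    linarith
  have h := key (√θ)⁻¹ (one_le_inv₀ hs |>.2 hs1.le)
  have e : Real.log (1 / θ) = 2 * Real.log (√θ)⁻¹ := by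
    rw [Real.log_inv, Real.log_sqrt hθ.1.le, one_div, Real.log_inv]; ring
  rw [e]
  refine h.trans (le_of_eq ?_)
  field_simp
  nlinarith

end Entropy

section Chord

/-- The slope of the chord of the graph of `B` over `[x, x + h]`. -/
noncomputable def chordSlope (B : ℝ → ℝ) (x h : ℝ) : ℝ := (B (x + h) - B x) / h

/-- The `L²` energy of the chord slopes at scale `h`. -/
noncomputable def chordEnergy (B : ℝ → ℝ) (h : ℝ) : ℝ := ∫ x, chordSlope B x h ^ 2

variable {B : ℝ → ℝ} {L a b : ℝ}

lemma chordSlope_sq_le (hB : ∀ x₁ x₂ : ℝ, |B x₁ - B x₂| ≤ L * |x₁ - x₂|)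
    (ha : ∀ x ≤ a, B x = B a) (hb : ∀ x, b ≤ x → B x = B b) {h : ℝ} (hh : 0 < h) (x : ℝ) :
    chordSlope B x h ^ 2 ≤ (Icc (a - h) b).indicator (fun _ => L ^ 2) x := by
  by_cases hx : x ∈ Icc (a - h) b
  · rw [indicator_of_mem hx, chordSlope, div_pow, div_le_iff₀ (by positivity), ← mul_pow]
    have := hB (x + h) x
    rw [add_sub_cancel_left, abs_of_pos hh] at this
    exact sq_le_sq' (by linarith [(abs_le.1 this).1]) (abs_le.1 this).2
  · rw [indicator_of_notMem hx]
    have : B (x + h) = B x := by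
      by_cases h1 : a - h ≤ x
      · have h2 : b < x := by by_contra! h2; exact hx ⟨h1, h2⟩
        rw [hb x h2.le, hb (x + h) (by linarith)]
      · push Not at h1
        rw [ha x (by linarith), ha (x + h) (by linarith)]
    simp [chordSlope, this]

lemma measurable_chordSlope (hB : Continuous B) :
    Measurable fun q : ℝ × ℝ => chordSlope B q.1 q.2 := by
  unfold chordSlope
  have := hB.measurable
  fun_prop

lemma integrable_chordSlope_sq (hB : ∀ x₁ x₂ : ℝ, |B x₁ - B x₂| ≤ L * |x₁ - x₂|)
    (ha : ∀ x ≤ a, B x = B a) (hb : ∀ x, b ≤ x → B x = B b) {h : ℝ} (hh : 0 < h) :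
    Integrable fun x => chordSlope B x h ^ 2 := by
  refine Integrable.mono' (g := (Icc (a - h) b).indicator fun _ => L ^ 2) ?_ ?_ ?_
  · exact (integrable_indicator_iff measurableSet_Icc).2
      (integrableOn_const (by simp))
  · exact (((measurable_chordSlope (continuous_of_lipBound hB)).comp
      (measurable_id.prodMk measurable_const)).pow_const 2).aestronglyMeasurable
  · exact Eventually.of_forall fun x => by
      rw [Real.norm_of_nonneg (sq_nonneg _)]
      exact chordSlope_sq_le hB ha hb hh x

lemma chordEnergy_le (hB : ∀ x₁ x₂ : ℝ, |B x₁ - B x₂| ≤ L * |x₁ - x₂|)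
    (ha : ∀ x ≤ a, B x = B a) (hb : ∀ x, b ≤ x → B x = B b) (hab : a ≤ b) {h : ℝ}
    (hh : 0 < h) : chordEnergy B h ≤ L ^ 2 * (b - a + h) := by
  unfold chordEnergy
  refine (integral_mono (integrable_chordSlope_sq hB ha hb hh) ?_
    (chordSlope_sq_le hB ha hb hh)).trans (le_of_eq ?_)
  · exact (integrable_indicator_iff measurableSet_Icc).2 (integrableOn_const (by simp))
  · rw [integral_indicator measurableSet_Icc, setIntegral_const, Measure.real, Real.volume_Icc,
      ENNReal.toReal_ofReal (by linarith), smul_eq_mul]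
    ring

lemma chordEnergy_nonneg (h : ℝ) : 0 ≤ chordEnergy B h :=
  integral_nonneg fun _ => sq_nonneg _

lemma measurable_chordEnergy (hB : Continuous B) : Measurable (chordEnergy B) := by
  unfold chordEnergy
  have h : StronglyMeasurable fun q : ℝ × ℝ => chordSlope B q.2 q.1 ^ 2 :=
    (((measurable_chordSlope hB).comp measurable_swap).pow_const 2).stronglyMeasurable
  exact h.integral_prod_right.measurable

lemma chordSlope_convex {θ h x : ℝ} (hh : h ≠ 0) (hθ : θ ∈ Ioo (0 : ℝ) 1) :
    θ * (1 - θ) * (chordSlope B x (θ * h) - chordSlope B (x + θ * h) ((1 - θ) * h)) ^ 2 =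
    θ * chordSlope B x (θ * h) ^ 2 + (1 - θ) * chordSlope B (x + θ * h) ((1 - θ) * h) ^ 2
      - chordSlope B x h ^ 2 := by
  have h1 : θ ≠ 0 := hθ.1.ne'
  have h2 : 1 - θ ≠ 0 := by linarith [hθ.2]
  have key : chordSlope B x h =
      θ * chordSlope B x (θ * h) + (1 - θ) * chordSlope B (x + θ * h) ((1 - θ) * h) := by
    unfold chordSlope
    have : x + θ * h + (1 - θ) * h = x + h := by ring
    rw [this]
    field_simp
    ring
  rw [key]
  ring

lemma integral_chord_defect (hB : ∀ x₁ x₂ : ℝ, |B x₁ - B x₂| ≤ L * |x₁ - x₂|)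
    (ha : ∀ x ≤ a, B x = B a) (hb : ∀ x, b ≤ x → B x = B b) {θ h : ℝ} (hh : 0 < h)
    (hθ : θ ∈ Ioo (0 : ℝ) 1) :
    Integrable (fun x =>
      θ * (1 - θ) * (chordSlope B x (θ * h) - chordSlope B (x + θ * h) ((1 - θ) * h)) ^ 2) ∧
    ∫ x, θ * (1 - θ) *
        (chordSlope B x (θ * h) - chordSlope B (x + θ * h) ((1 - θ) * h)) ^ 2 =
      θ * chordEnergy B (θ * h) + (1 - θ) * chordEnergy B ((1 - θ) * h) - chordEnergy B h := by
  have hθ2 : 0 < 1 - θ := by linarith [hθ.2]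
  have i1 := integrable_chordSlope_sq hB ha hb (mul_pos hθ.1 hh)
  have i2 := (integrable_chordSlope_sq hB ha hb (mul_pos hθ2 hh)).comp_add_right (θ * h)
  have i3 := integrable_chordSlope_sq hB ha hb hh
  simp_rw [chordSlope_convex hh.ne' hθ]
  have i4 : Integrable fun x => θ * chordSlope B x (θ * h) ^ 2 +
      (1 - θ) * chordSlope B (x + θ * h) ((1 - θ) * h) ^ 2 :=
    (i1.const_mul _).add (i2.const_mul _)
  refine ⟨i4.sub i3, ?_⟩
  rw [integral_sub i4 i3,
    integral_add (i1.const_mul _) (i2.const_mul _), integral_const_mul, integral_const_mul,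
    integral_add_right_eq_self (fun x => chordSlope B x ((1 - θ) * h) ^ 2)]
  rfl

/-- The curvature-type quantity of a triple of abscissae. -/
noncomputable def curvQ (B : ℝ → ℝ) (x y w : ℝ) : ℝ :=
  ((y - x) * (B w - B x) - (w - x) * (B y - B x)) ^ 2 /
    ((y - x) ^ 2 * (w - x) ^ 2 * (w - y) ^ 2)

lemma curvQ_eq_chord {θ h x : ℝ} (hh : h ≠ 0) (hθ : θ ∈ Ioo (0 : ℝ) 1) :
    curvQ B x (x + h * θ) (x + h) =
      (chordSlope B x (θ * h) - chordSlope B (x + θ * h) ((1 - θ) * h)) ^ 2 / h ^ 2 := by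
  have h1 : θ ≠ 0 := hθ.1.ne'
  have h2 : 1 - θ ≠ 0 := by linarith [hθ.2]
  unfold curvQ chordSlope
  have e1 : x + θ * h + (1 - θ) * h = x + h := by ring
  have e2 : x + h - (x + h * θ) = (1 - θ) * h := by ring
  have e3 : x + θ * h = x + h * θ := by ring
  rw [e1, e2, e3]
  simp only [add_sub_cancel_left]
  generalize B (x + h) = p
  generalize B (x + h * θ) = q
  generalize B x = r
  field_simp
  ring

lemma measurable_curvQ (hB : Continuous B) :
    Measurable fun q : ℝ × ℝ × ℝ => curvQ B q.1 q.2.1 q.2.2 := by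
  unfold curvQ
  have := hB.measurable
  fun_prop

lemma entropy_weight_le {θ : ℝ} (hθ : θ ∈ Ioo (0 : ℝ) 1) :
    (θ * Real.log (1 / θ) + (1 - θ) * Real.log (1 / (1 - θ))) / (θ * (1 - θ)) ≤
      1 / √θ + 1 / √(1 - θ) := by
  have hθ' : 1 - θ ∈ Ioo (0 : ℝ) 1 := ⟨by linarith [hθ.2], by linarith [hθ.1]⟩
  have h1 := log_one_div_le hθ
  have h2 := log_one_div_le hθ'
  have p1 := hθ.1
  have p2 := hθ'.1
  rw [sub_sub_cancel] at h2
  rw [div_le_iff₀ (by positivity)]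
  have e : (1 / √θ + 1 / √(1 - θ)) * (θ * (1 - θ)) =
    θ * ((1 - θ) / √θ) + (1 - θ) * (θ / √(1 - θ)) := by ring
  rw [e]
  gcongr

lemma integral_inv_sqrt : ∫ θ in (0 : ℝ)..1, 1 / √θ = 2 ∧
    IntervalIntegrable (fun θ : ℝ => 1 / √θ) volume 0 1 := by
  have e : (fun θ : ℝ => 1 / √θ) =ᵐ[volume.restrict (uIoc 0 1)] fun θ => θ ^ (-(1 / 2) : ℝ) := by
    rw [uIoc_of_le zero_le_one]
    filter_upwards [self_mem_ae_restrict (measurableSet_Ioc)] with θ hθ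
    rw [Real.rpow_neg hθ.1.le, Real.sqrt_eq_rpow, one_div]
  constructor
  · rw [intervalIntegral.integral_congr_ae_restrict e, integral_rpow (by left; norm_num)]
    norm_num
  · exact (intervalIntegral.intervalIntegrable_rpow' (by norm_num)).congr_ae e.symm

lemma lintegral_inv_sqrt_le {Λ : ℝ} (hΛ : 0 ≤ Λ) :
    ∫⁻ θ in Ioo (0 : ℝ) 1, ENNReal.ofReal (Λ * (1 / √θ + 1 / √(1 - θ))) =
      ENNReal.ofReal (4 * Λ) := by
  obtain ⟨h1, i1⟩ := integral_inv_sqrt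
  have i2 : IntervalIntegrable (fun θ : ℝ => 1 / √(1 - θ)) volume 0 1 := by
    simpa using (i1.comp_sub_left 1).symm
  have h2 : ∫ θ in (0 : ℝ)..1, 1 / √(1 - θ) = 2 := by
    rw [intervalIntegral.integral_comp_sub_left (fun θ => 1 / √θ) 1]
    simpa using h1
  have i3 := (i1.add i2).const_mul Λ
  rw [intervalIntegrable_iff_integrableOn_Ioo_of_le zero_le_one] at i3
  rw [← ofReal_integral_eq_lintegral_ofReal i3
    (Eventually.of_forall fun θ => by positivity), ← integral_Ioc_eq_integral_Ioo,
    ← intervalIntegral.integral_of_le zero_le_one, intervalIntegral.integral_const_mul,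
    intervalIntegral.integral_add i1 i2, h1, h2]
  congr 1
  ring

end Chord

section Curvature

variable {B : ℝ → ℝ} {L a b : ℝ}

lemma lintegral_Ioo_rescale {f : ℝ → ℝ≥0∞} {x h : ℝ} (hh : 0 < h) :
    ∫⁻ y in Ioo x (x + h), f y = ∫⁻ θ in Ioo (0 : ℝ) 1, ENNReal.ofReal h * f (x + h * θ) := by
  have e : Ioo x (x + h) = (fun θ => x + h * θ) '' Ioo (0 : ℝ) 1 := by
    ext y
    simp only [mem_Ioo, mem_image]
    constructor
    · rintro ⟨h1, h2⟩
      refine ⟨(y - x) / h, ⟨div_pos (by linarith) hh, (div_lt_one hh).2 (by linarith)⟩, ?_⟩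
      field_simp; ring
    · rintro ⟨θ, ⟨h1, h2⟩, rfl⟩
      constructor <;> nlinarith
  rw [e, lintegral_image_eq_lintegral_abs_deriv_mul (f' := fun _ => h) measurableSet_Ioo
    (fun θ _ => ?_) ?_, abs_of_pos hh]
  · intro s _ t _ hst
    simpa [hh.ne'] using hst
  · simpa using (((hasDerivAt_id θ).const_mul h).const_add x).hasDerivWithinAt

lemma lintegral_curvQ_slice_le (hB : ∀ x₁ x₂ : ℝ, |B x₁ - B x₂| ≤ L * |x₁ - x₂|)
    (ha : ∀ x ≤ a, B x = B a) (hb : ∀ x, b ≤ x → B x = B b) (hab : a ≤ b) {δ θ : ℝ}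
    (hδ : 0 < δ) (hθ : θ ∈ Ioo (0 : ℝ) 1) :
    ∫⁻ h in Ioo δ (b - a), ∫⁻ x, ENNReal.ofReal (h * curvQ B x (x + h * θ) (x + h)) ≤
      ENNReal.ofReal (2 * L ^ 2 * (b - a) * (1 / √θ + 1 / √(1 - θ))) := by
  rcases le_or_gt (b - a) δ with hδℓ | hδℓ
  · rw [Ioo_eq_empty (not_lt.2 hδℓ)]; simp
  set ℓ := b - a
  have hθ2 : 0 < 1 - θ := by linarith [hθ.2]
  have hθ1 := hθ.1
  obtain ⟨i, hi⟩ := integral_entropy_le (measurable_chordEnergy (continuous_of_lipBound hB))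
    (Λ := 2 * L ^ 2 * ℓ) (ℓ := ℓ) (δ := δ) (θ := θ) (fun h _ => chordEnergy_nonneg h)
    (fun h hh => (chordEnergy_le hB ha hb hab hh.1).trans (by nlinarith [hh.2, sq_nonneg L]))
    hδ hδℓ.le hθ
  have key : ∀ h ∈ Ioo δ ℓ, ∫⁻ x, ENNReal.ofReal (h * curvQ B x (x + h * θ) (x + h)) =
      ENNReal.ofReal ((θ * (1 - θ))⁻¹ * ((θ * chordEnergy B (θ * h) +
        (1 - θ) * chordEnergy B ((1 - θ) * h) - chordEnergy B h) / h)) := by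
    intro h hh
    have hh0 : 0 < h := hδ.trans hh.1
    obtain ⟨j, hj⟩ := integral_chord_defect hB ha hb hh0 hθ
    rw [← hj, ← integral_div, ← integral_const_mul,
      ofReal_integral_eq_lintegral_ofReal ((j.div_const h).const_mul _)
        (Eventually.of_forall fun x => by positivity)]
    refine lintegral_congr fun x => ?_
    rw [curvQ_eq_chord hh0.ne' hθ]
    congr 1
    field_simp
  rw [setLIntegral_congr_fun measurableSet_Ioo key]
  have i' := i.const_mul (θ * (1 - θ))⁻¹
  rw [intervalIntegrable_iff_integrableOn_Ioo_of_le hδℓ.le] at i'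
  rw [← ofReal_integral_eq_lintegral_ofReal i' ?_, ← integral_Ioc_eq_integral_Ioo,
    ← intervalIntegral.integral_of_le hδℓ.le, intervalIntegral.integral_const_mul]
  · refine ENNReal.ofReal_le_ofReal ?_
    have h1 := entropy_weight_le hθ
    calc _ ≤ (θ * (1 - θ))⁻¹ * (2 * L ^ 2 * ℓ *
          (θ * Real.log (1 / θ) + (1 - θ) * Real.log (1 / (1 - θ)))) := by gcongr
      _ = 2 * L ^ 2 * ℓ * ((θ * Real.log (1 / θ) + (1 - θ) * Real.log (1 / (1 - θ))) /
          (θ * (1 - θ))) := by ring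
      _ ≤ _ := by gcongr
  · filter_upwards [self_mem_ae_restrict measurableSet_Ioo] with h hh
    have hh0 : 0 < h := hδ.trans hh.1
    obtain ⟨j, hj⟩ := integral_chord_defect hB ha hb hh0 hθ
    have : 0 ≤ θ * chordEnergy B (θ * h) +
        (1 - θ) * chordEnergy B ((1 - θ) * h) - chordEnergy B h := by
      rw [← hj]
      exact integral_nonneg fun x => by positivity
    show 0 ≤ (θ * (1 - θ))⁻¹ * _
    positivity

lemma lintegral_curvQ_ordered_le (hB : ∀ x₁ x₂ : ℝ, |B x₁ - B x₂| ≤ L * |x₁ - x₂|)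
    (ha : ∀ x ≤ a, B x = B a) (hb : ∀ x, b ≤ x → B x = B b) (hab : a ≤ b) {δ : ℝ}
    (hδ : 0 < δ) :
    ∫⁻ x in Ioo a b, ∫⁻ w in Ioo (x + δ) b, ∫⁻ y in Ioo x w, ENNReal.ofReal (curvQ B x y w) ≤
      ENNReal.ofReal (8 * L ^ 2 * (b - a)) := by
  have hm := measurable_curvQ (continuous_of_lipBound hB)
  set G : ℝ → ℝ → ℝ → ℝ≥0∞ := fun x h θ => ENNReal.ofReal (h * curvQ B x (x + h * θ) (x + h))
  have hG : Measurable fun q : ℝ × ℝ × ℝ => G q.1 q.2.1 q.2.2 := by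
    have e : Measurable fun q : ℝ × ℝ × ℝ => (q.1, q.1 + q.2.1 * q.2.2, q.1 + q.2.1) := by
      fun_prop
    have h1 := hm.comp e
    exact ((measurable_fst.comp measurable_snd).mul h1).ennreal_ofReal
  calc _ ≤ ∫⁻ x, ∫⁻ h in Ioo δ (b - a), ∫⁻ θ in Ioo (0 : ℝ) 1, G x h θ := by
        refine (setLIntegral_mono' measurableSet_Ioo fun x hx => ?_).trans
          (setLIntegral_le_lintegral _ _)
        rw [← lintegral_indicator measurableSet_Ioo, ← lintegral_add_left_eq_self _ x,
          ← lintegral_indicator measurableSet_Ioo]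
        refine lintegral_mono fun h => ?_
        by_cases hh : x + h ∈ Ioo (x + δ) b
        · have hh' : h ∈ Ioo δ (b - a) := ⟨by linarith [hh.1], by linarith [hh.2, hx.1]⟩
          have h0 : 0 < h := hδ.trans hh'.1
          simp only [indicator_of_mem hh, indicator_of_mem hh']
          rw [lintegral_Ioo_rescale h0]
          refine le_of_eq (lintegral_congr fun θ => ?_)
          rw [← ENNReal.ofReal_mul h0.le]
        · simp only [indicator_of_notMem hh, zero_le]
    _ = ∫⁻ θ in Ioo (0 : ℝ) 1, ∫⁻ h in Ioo δ (b - a), ∫⁻ x, G x h θ := by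
        have m1 : Measurable fun q : (ℝ × ℝ) × ℝ => G q.1.1 q.1.2 q.2 :=
          hG.comp (g := fun q : ℝ × ℝ × ℝ => G q.1 q.2.1 q.2.2)
            (f := fun q : (ℝ × ℝ) × ℝ => (q.1.1, q.1.2, q.2)) (by fun_prop)
        have m2 : Measurable fun q : (ℝ × ℝ) × ℝ => G q.2 q.1.1 q.1.2 :=
          hG.comp (g := fun q : ℝ × ℝ × ℝ => G q.1 q.2.1 q.2.2)
            (f := fun q : (ℝ × ℝ) × ℝ => (q.2, q.1.1, q.1.2)) (by fun_prop)
        have m3 : Measurable fun q : ℝ × ℝ => ∫⁻ x, G x q.1 q.2 := m2.lintegral_prod_right'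
        rw [lintegral_lintegral_swap (Measurable.aemeasurable (m1.lintegral_prod_right'))]
        have : ∀ h, ∫⁻ x, ∫⁻ θ in Ioo (0 : ℝ) 1, G x h θ =
            ∫⁻ θ in Ioo (0 : ℝ) 1, ∫⁻ x, G x h θ := fun h =>
          lintegral_lintegral_swap (Measurable.aemeasurable
            (hG.comp (g := fun q : ℝ × ℝ × ℝ => G q.1 q.2.1 q.2.2)
              (f := fun q : ℝ × ℝ => (q.1, h, q.2)) (by fun_prop)))
        simp_rw [this]
        rw [lintegral_lintegral_swap m3.aemeasurable]
    _ ≤ ∫⁻ θ in Ioo (0 : ℝ) 1,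
          ENNReal.ofReal (2 * L ^ 2 * (b - a) * (1 / √θ + 1 / √(1 - θ))) :=
        setLIntegral_mono' measurableSet_Ioo fun θ hθ =>
          lintegral_curvQ_slice_le hB ha hb hab hδ hθ
    _ = _ := by
        rw [lintegral_inv_sqrt_le (by have := sub_nonneg.2 hab; positivity)]
        congr 1
        ring

/-- The curvature bound for a Lipschitz graph over an interval. -/
lemma lintegral_curvQ_le {A : ℝ → ℝ} (hA : ∀ x₁ x₂ : ℝ, |A x₁ - A x₂| ≤ L * |x₁ - x₂|)
    (hab : a ≤ b) {δ : ℝ} (hδ : 0 < δ) :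
    ∫⁻ x in Ioo a b, ∫⁻ w in Ioo (x + δ) b, ∫⁻ y in Ioo x w, ENNReal.ofReal (curvQ A x y w) ≤
      ENNReal.ofReal (8 * L ^ 2 * (b - a)) := by
  rcases lt_or_eq_of_le hab with hab' | rfl
  swap
  · simp
  have hL : 0 ≤ L := by
    have := (abs_nonneg _).trans (hA b a)
    rw [abs_of_pos (sub_pos.2 hab')] at this
    exact nonneg_of_mul_nonneg_left this (sub_pos.2 hab')
  set B : ℝ → ℝ := fun x => A (max a (min b x))
  have hB : ∀ x₁ x₂ : ℝ, |B x₁ - B x₂| ≤ L * |x₁ - x₂| := fun x y => by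
    refine (hA _ _).trans (mul_le_mul_of_nonneg_left ?_ hL)
    refine (abs_max_sub_max_le_max _ _ _ _).trans ?_
    simp only [sub_self, abs_zero]
    refine max_le (abs_nonneg _) ?_
    refine (abs_min_sub_min_le_max _ _ _ _).trans ?_
    simp
  have hBA : ∀ x ∈ Icc a b, B x = A x := fun x hx => by
    simp only [B]
    rw [min_eq_right hx.2, max_eq_right hx.1]
  refine le_trans (le_of_eq ?_) (lintegral_curvQ_ordered_le hB (a := a) (b := b) ?_ ?_ hab hδ)
  · refine setLIntegral_congr_fun measurableSet_Ioo fun x hx => ?_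
    refine setLIntegral_congr_fun measurableSet_Ioo fun w hw => ?_
    refine setLIntegral_congr_fun measurableSet_Ioo fun y hy => ?_
    simp only [curvQ]
    rw [hBA x ⟨hx.1.le, hx.2.le⟩, hBA w ⟨by linarith [hx.1, hw.1], hw.2.le⟩,
      hBA y ⟨by linarith [hx.1, hy.1], by linarith [hy.2, hw.2]⟩]
  · intro x hx
    simp [B, hx, hab]
  · intro x hx
    simp [B, hx]

end Curvature

section Symmetrisation

variable {μ : Measure ℝ} [IsFiniteMeasure μ] {k k₁ k₂ : ℝ → ℝ → ℝ} {M : ℝ}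

lemma measurePreserving_rotate (μ : Measure ℝ) [IsFiniteMeasure μ] :
    MeasurePreserving (fun q : ℝ × ℝ × ℝ => (q.2.2, q.1, q.2.1)) (μ.prod (μ.prod μ))
      (μ.prod (μ.prod μ)) :=
  (Measure.measurePreserving_swap (μ := μ.prod μ) (ν := μ)).comp
    (measurePreserving_prodAssoc μ μ μ).symm

lemma measurePreserving_swap_right (μ : Measure ℝ) [IsFiniteMeasure μ] :
    MeasurePreserving (fun q : ℝ × ℝ × ℝ => (q.1, q.2.2, q.2.1)) (μ.prod (μ.prod μ))
      (μ.prod (μ.prod μ)) :=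
  (MeasurePreserving.id μ).prod (Measure.measurePreserving_swap (μ := μ) (ν := μ))

lemma measurePreserving_swap_left (μ : Measure ℝ) [IsFiniteMeasure μ] :
    MeasurePreserving (fun q : ℝ × ℝ × ℝ => (q.2.1, q.1, q.2.2)) (μ.prod (μ.prod μ))
      (μ.prod (μ.prod μ)) :=
  (measurePreserving_swap_right μ).comp ((measurePreserving_rotate μ).comp
    (measurePreserving_rotate μ))

lemma integrable_of_measurable_of_bound {α : Type*} [MeasurableSpace α] {ν : Measure α}
    [IsFiniteMeasure ν] {F : α → ℝ} (hF : Measurable F) {C : ℝ} (hC : ∀ q, |F q| ≤ C) :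
    Integrable F ν :=
  Integrable.of_bound hF.aestronglyMeasurable C (Eventually.of_forall hC)

lemma integral_triple_mul {h u v : ℝ → ℝ} (hk : Measurable fun q : ℝ × ℝ => k q.1 q.2)
    (hkM : ∀ x y, |k x y| ≤ M) (hh : Measurable h) (hu : Measurable u) (hv : Measurable v)
    (hh1 : ∀ x, |h x| ≤ 1) (hu1 : ∀ x, |u x| ≤ 1) (hv1 : ∀ x, |v x| ≤ 1) :
    Integrable (fun q : ℝ × ℝ × ℝ => h q.1 * ((k q.1 q.2.1 * u q.2.1) *
      (k q.1 q.2.2 * v q.2.2))) (μ.prod (μ.prod μ)) ∧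
    ∫ q, h q.1 * ((k q.1 q.2.1 * u q.2.1) * (k q.1 q.2.2 * v q.2.2)) ∂(μ.prod (μ.prod μ)) =
      ∫ x, h x * ((∫ y, k x y * u y ∂μ) * ∫ y, k x y * v y ∂μ) ∂μ := by
  have hM : 0 ≤ M := (abs_nonneg _).trans (hkM 0 0)
  have hi : Integrable (fun q : ℝ × ℝ × ℝ => h q.1 * ((k q.1 q.2.1 * u q.2.1) *
      (k q.1 q.2.2 * v q.2.2))) (μ.prod (μ.prod μ)) := by
    refine integrable_of_measurable_of_bound (C := 1 * ((M * 1) * (M * 1))) (by fun_prop)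
      fun q => ?_
    rw [abs_mul, abs_mul, abs_mul, abs_mul]
    gcongr <;> first | exact hh1 _ | exact hkM _ _ | exact hu1 _ | exact hv1 _
  refine ⟨hi, ?_⟩
  rw [integral_prod _ hi]
  refine integral_congr_ae (Eventually.of_forall fun x => ?_)
  simp only
  rw [integral_const_mul, ← integral_prod_mul]

/-- The symmetrisation of `k(x,y) k(x,w)` over the three choices of the base point. -/
def symKernel (k : ℝ → ℝ → ℝ) (q : ℝ × ℝ × ℝ) : ℝ :=
  k q.1 q.2.1 * k q.1 q.2.2 + k q.2.1 q.1 * k q.2.1 q.2.2 + k q.2.2 q.1 * k q.2.2 q.2.1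

lemma measurable_symKernel (hk : Measurable fun q : ℝ × ℝ => k q.1 q.2) :
    Measurable (symKernel k) := by
  have h : ∀ {u v : ℝ × ℝ × ℝ → ℝ}, Measurable u → Measurable v →
      Measurable fun q => k (u q) (v q) := fun hu hv => hk.comp (hu.prodMk hv)
  have m0 : Measurable fun q : ℝ × ℝ × ℝ => q.1 := measurable_fst
  have m1 : Measurable fun q : ℝ × ℝ × ℝ => q.2.1 := measurable_fst.comp measurable_snd
  have m2 : Measurable fun q : ℝ × ℝ × ℝ => q.2.2 := measurable_snd.comp measurable_snd
  exact (((h m0 m1).mul (h m0 m2)).add ((h m1 m0).mul (h m1 m2))).add ((h m2 m0).mul (h m2 m1))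

lemma integral_symKernel_mul {f : ℝ → ℝ} (hk : Measurable fun q : ℝ × ℝ => k q.1 q.2)
    (hkM : ∀ x y, |k x y| ≤ M) (hf : Measurable f) (hf1 : ∀ x, |f x| ≤ 1) :
    Integrable (fun q : ℝ × ℝ × ℝ => f q.2.1 * f q.2.2 * symKernel k q) (μ.prod (μ.prod μ)) ∧
    ∫ q, f q.2.1 * f q.2.2 * symKernel k q ∂(μ.prod (μ.prod μ)) =
      ∫ x, (∫ y, k x y * f y ∂μ) ^ 2 ∂μ +
        2 * ∫ x, f x * ((∫ y, k x y ∂μ) * ∫ y, k x y * f y ∂μ) ∂μ := by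
  have one : Measurable fun _ : ℝ => (1 : ℝ) := measurable_const
  have one1 : ∀ x : ℝ, |(fun _ : ℝ => (1 : ℝ)) x| ≤ 1 := fun x => by simp
  obtain ⟨i1, e1⟩ := integral_triple_mul (μ := μ) hk hkM one hf hf one1 hf1 hf1
  obtain ⟨i2, e2⟩ := integral_triple_mul (μ := μ) hk hkM hf one hf hf1 one1 hf1
  have s1 := (measurePreserving_swap_left μ)
  have s2 := (measurePreserving_rotate μ)
  have j1 := s1.integrable_comp_of_integrable i2
  have j2 := s2.integrable_comp_of_integrable i2
  have t1 : ∫ q, f q.2.1 * ((k q.2.1 q.1 * 1) * (k q.2.1 q.2.2 * f q.2.2)) ∂(μ.prod (μ.prod μ)) =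
      ∫ q, f q.1 * ((k q.1 q.2.1 * 1) * (k q.1 q.2.2 * f q.2.2)) ∂(μ.prod (μ.prod μ)) := by
    conv_rhs => rw [← s1.map_eq]
    rw [integral_map s1.measurable.aemeasurable]
    rw [s1.map_eq]; exact i2.aestronglyMeasurable
  have t2 : ∫ q, f q.2.2 * ((k q.2.2 q.1 * 1) * (k q.2.2 q.2.1 * f q.2.1)) ∂(μ.prod (μ.prod μ)) =
      ∫ q, f q.1 * ((k q.1 q.2.1 * 1) * (k q.1 q.2.2 * f q.2.2)) ∂(μ.prod (μ.prod μ)) := by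
    conv_rhs => rw [← s2.map_eq]
    rw [integral_map s2.measurable.aemeasurable]
    rw [s2.map_eq]; exact i2.aestronglyMeasurable
  have split : (fun q : ℝ × ℝ × ℝ => f q.2.1 * f q.2.2 * symKernel k q) = fun q =>
      (1 * ((k q.1 q.2.1 * f q.2.1) * (k q.1 q.2.2 * f q.2.2)) +
        f q.2.1 * ((k q.2.1 q.1 * 1) * (k q.2.1 q.2.2 * f q.2.2))) +
        f q.2.2 * ((k q.2.2 q.1 * 1) * (k q.2.2 q.2.1 * f q.2.1)) := by
    ext q; simp only [symKernel]; ring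
  rw [split]
  refine ⟨(i1.add j1).add j2, ?_⟩
  have a1 := integral_add (i1.add j1) j2
  have a2 := integral_add i1 j1
  simp only [Pi.add_apply, Function.comp_def] at a1 a2
  rw [a1, a2, e1, t1, t2, e2]
  simp only [mul_one, one_mul, sq]
  ring

lemma measurable_kernel_integral {f : ℝ → ℝ} (hk : Measurable fun q : ℝ × ℝ => k q.1 q.2)
    (hf : Measurable f) : Measurable fun x => ∫ y, k x y * f y ∂μ := by
  have : StronglyMeasurable fun q : ℝ × ℝ => k q.1 q.2 * f q.2 :=
    (hk.mul (hf.comp measurable_snd)).stronglyMeasurable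
  exact this.integral_prod_right'.measurable

lemma integrable_sq_kernel {f : ℝ → ℝ} (hk : Measurable fun q : ℝ × ℝ => k q.1 q.2)
    (hkM : ∀ x y, |k x y| ≤ M) (hf : Measurable f) (hf1 : ∀ x, |f x| ≤ 1) :
    Integrable (fun x => (∫ y, k x y * f y ∂μ) ^ 2) μ := by
  have hm := measurable_kernel_integral (μ := μ) hk hf
  refine integrable_of_measurable_of_bound (C := (M * μ.real univ) ^ 2) (by fun_prop) fun x => ?_
  rw [abs_pow]
  refine pow_le_pow_left₀ (abs_nonneg _) ?_ 2
  refine norm_integral_le_of_norm_le_const (μ := μ) (f := fun y => k x y * f y) (Eventually.of_forall fun y => ?_)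
  rw [Real.norm_eq_abs, abs_mul]
  nlinarith [hkM x y, hf1 y, abs_nonneg (k x y), abs_nonneg (f y)]

/-- An `L²` bound on bounded functions for a pair of antisymmetric kernels in terms of the total
mass of their symmetrisation. -/
lemma integral_sq_le_of_symKernel {f : ℝ → ℝ} (hk₁ : Measurable fun q : ℝ × ℝ => k₁ q.1 q.2)
    (hk₂ : Measurable fun q : ℝ × ℝ => k₂ q.1 q.2)
    (hkM₁ : ∀ x y, |k₁ x y| ≤ M) (hkM₂ : ∀ x y, |k₂ x y| ≤ M)
    (hf : Measurable f) (hf1 : ∀ x, |f x| ≤ 1) :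
    ∫ x, ((∫ y, k₁ x y * f y ∂μ) ^ 2 + (∫ y, k₂ x y * f y ∂μ) ^ 2) ∂μ ≤
      4 * ∫ q, |symKernel k₁ q + symKernel k₂ q| ∂(μ.prod (μ.prod μ)) := by
  have one : Measurable fun _ : ℝ => (1 : ℝ) := measurable_const
  have one1 : ∀ x : ℝ, |(fun _ : ℝ => (1 : ℝ)) x| ≤ 1 := fun x => by simp
  set ν := μ.prod (μ.prod μ)
  set J := ∫ q, |symKernel k₁ q + symKernel k₂ q| ∂ν
  set U := fun x => (∫ y, k₁ x y * f y ∂μ) ^ 2 + (∫ y, k₂ x y * f y ∂μ) ^ 2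
  set V := fun x => (∫ y, k₁ x y ∂μ) ^ 2 + (∫ y, k₂ x y ∂μ) ^ 2
  have gen : ∀ g : ℝ → ℝ, Measurable g → (∀ x, |g x| ≤ 1) →
      ∫ q, g q.2.1 * g q.2.2 * symKernel k₁ q ∂ν + ∫ q, g q.2.1 * g q.2.2 * symKernel k₂ q ∂ν
        ≤ J := by
    intro g hg hg1
    obtain ⟨i1, -⟩ := integral_symKernel_mul (μ := μ) hk₁ hkM₁ hg hg1
    obtain ⟨i2, -⟩ := integral_symKernel_mul (μ := μ) hk₂ hkM₂ hg hg1
    obtain ⟨o1, -⟩ := integral_symKernel_mul (μ := μ) hk₁ hkM₁ one one1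
    obtain ⟨o2, -⟩ := integral_symKernel_mul (μ := μ) hk₂ hkM₂ one one1
    rw [← integral_add i1 i2]
    refine integral_mono (i1.add i2) ?_ fun q => ?_
    · simpa using (o1.add o2).abs
    · simp only [← mul_add]
      refine (le_abs_self _).trans ?_
      rw [abs_mul, abs_mul]
      have := mul_le_one₀ (hg1 q.2.1) (abs_nonneg _) (hg1 q.2.2)
      exact mul_le_of_le_one_left (abs_nonneg _) this
  have u1 := integrable_sq_kernel (μ := μ) hk₁ hkM₁ hf hf1
  have u2 := integrable_sq_kernel (μ := μ) hk₂ hkM₂ hf hf1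
  have v1 := integrable_sq_kernel (μ := μ) hk₁ hkM₁ one one1
  have v2 := integrable_sq_kernel (μ := μ) hk₂ hkM₂ one one1
  simp only [mul_one] at v1 v2
  obtain ⟨-, e1⟩ := integral_symKernel_mul (μ := μ) hk₁ hkM₁ hf hf1
  obtain ⟨-, e2⟩ := integral_symKernel_mul (μ := μ) hk₂ hkM₂ hf hf1
  obtain ⟨-, o1⟩ := integral_symKernel_mul (μ := μ) hk₁ hkM₁ one one1
  obtain ⟨-, o2⟩ := integral_symKernel_mul (μ := μ) hk₂ hkM₂ one one1
  have hV : 3 * ∫ x, V x ∂μ ≤ J := by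
    have := gen _ one one1
    rw [o1, o2] at this
    simp only [mul_one, one_mul, ← sq] at this
    rw [integral_add v1 v2]
    linarith
  have hU := gen f hf hf1
  rw [e1, e2] at hU
  have cross : ∀ k : ℝ → ℝ → ℝ, (Measurable fun q : ℝ × ℝ => k q.1 q.2) →
      (∀ x y, |k x y| ≤ M) →
      -(∫ x, (∫ y, k x y * f y ∂μ) ^ 2 ∂μ) / 4 - ∫ x, (∫ y, k x y ∂μ) ^ 2 ∂μ ≤
      ∫ x, f x * ((∫ y, k x y ∂μ) * ∫ y, k x y * f y ∂μ) ∂μ := by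
    intro k hk hkM
    have w1 := integrable_sq_kernel (μ := μ) hk hkM hf hf1
    have w2 := integrable_sq_kernel (μ := μ) hk hkM one one1
    simp only [mul_one] at w2
    have m1 := measurable_kernel_integral (μ := μ) hk hf
    have m2 := measurable_kernel_integral (μ := μ) hk one
    simp only [mul_one] at m2
    have a := integral_add (w1.div_const 4) w2
    rw [integral_div] at a
    rw [neg_div, ← neg_add', ← a, ← integral_neg]
    have key : ∀ x, |f x * ((∫ y, k x y ∂μ) * ∫ y, k x y * f y ∂μ)| ≤
        (∫ y, k x y * f y ∂μ) ^ 2 / 4 + (∫ y, k x y ∂μ) ^ 2 := fun x => by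
      generalize (∫ y, k x y ∂μ) = s
      generalize (∫ y, k x y * f y ∂μ) = t
      rw [abs_mul, abs_mul]
      refine (mul_le_of_le_one_left (by positivity) (hf1 x)).trans ?_
      rw [← sq_abs s, ← sq_abs t]
      nlinarith [sq_nonneg (|t| / 2 - |s|)]
    refine integral_mono ((w1.div_const 4).add w2).neg (((w1.div_const 4).add w2).mono'
      (by fun_prop) (Eventually.of_forall key)) fun x => ?_
    exact (abs_le.1 (key x)).1
  rw [integral_add u1 u2]
  rw [integral_add v1 v2] at hV
  have c1 := cross k₁ hk₁ hkM₁
  have c2 := cross k₂ hk₂ hkM₂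
  have hJ : 0 ≤ J := integral_nonneg fun q => abs_nonneg _
  linarith

end Symmetrisation

lemma lintegral_inv_sq_le {δ : ℝ} (hδ : 0 < δ) (c : ℝ) :
    ∫⁻ y in {y : ℝ | δ < |y - c|}, ENNReal.ofReal (1 / (y - c) ^ 2) ≤ ENNReal.ofReal (2 / δ) := by
  have half : ∫⁻ t in Ioi δ, ENNReal.ofReal (1 / t ^ 2) = ENNReal.ofReal (1 / δ) := by
    have e : ∀ t ∈ Ioi δ, ENNReal.ofReal (1 / t ^ 2) = ENNReal.ofReal (t ^ (-2 : ℝ)) := by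
      intro t ht
      rw [Real.rpow_neg (hδ.trans ht).le, one_div]
      norm_cast
    rw [setLIntegral_congr_fun measurableSet_Ioi e,
      ← ofReal_integral_eq_lintegral_ofReal (integrableOn_Ioi_rpow_of_lt (by norm_num) hδ),
      integral_Ioi_rpow_of_lt (by norm_num) hδ]
    · congr 1
      norm_num
      rw [Real.rpow_neg hδ.le, Real.rpow_one]
    · refine (ae_restrict_iff' measurableSet_Ioi).2 (Eventually.of_forall fun t ht => ?_)
      exact Real.rpow_nonneg (hδ.trans ht).le _
  have sub : {y : ℝ | δ < |y - c|} ⊆ (fun t => t + c) '' Ioi δ ∪ (fun t => -t + c) '' Ioi δ := by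
    intro y hy
    rcases lt_abs.1 (show δ < |y - c| from hy) with h | h
    · exact Or.inl ⟨y - c, h, by simp⟩
    · exact Or.inr ⟨c - y, by simpa using h, by simp⟩
  refine (lintegral_mono_set sub).trans ((lintegral_union_le _ _ _).trans ?_)
  rw [lintegral_image_eq_lintegral_abs_deriv_mul (f' := fun _ => 1) measurableSet_Ioi
      (fun t _ => ((hasDerivAt_id' t).add_const c).hasDerivWithinAt) (by intro s _ t _ h; simpa using h),
    lintegral_image_eq_lintegral_abs_deriv_mul (f' := fun _ => -1) measurableSet_Ioi
      (fun t _ => ((hasDerivAt_neg' t).add_const c).hasDerivWithinAt)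
      (by intro s _ t _ h; simpa using h)]
  simp only [abs_one, abs_neg, ENNReal.ofReal_one, one_mul, add_sub_cancel_right, neg_sq]
  rw [half, ← ENNReal.ofReal_add (by positivity) (by positivity)]
  apply ENNReal.ofReal_le_ofReal
  apply le_of_eq; ring

lemma sum_kernel_eq {a b c d : ℝ} (ha : a ≠ 0) (hc : c ≠ 0) (hac : c - a ≠ 0) :
    (a / (a ^ 2 + b ^ 2) * (c / (c ^ 2 + d ^ 2)) + b / (a ^ 2 + b ^ 2) * (d / (c ^ 2 + d ^ 2))) -
    (a / (a ^ 2 + b ^ 2) * ((c - a) / ((c - a) ^ 2 + (d - b) ^ 2)) +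
      b / (a ^ 2 + b ^ 2) * ((d - b) / ((c - a) ^ 2 + (d - b) ^ 2))) +
    (c / (c ^ 2 + d ^ 2) * ((c - a) / ((c - a) ^ 2 + (d - b) ^ 2)) +
      d / (c ^ 2 + d ^ 2) * ((d - b) / ((c - a) ^ 2 + (d - b) ^ 2))) =
    2 * ((a * d - c * b) ^ 2 / ((a ^ 2 + b ^ 2) * (c ^ 2 + d ^ 2) *
      ((c - a) ^ 2 + (d - b) ^ 2))) := by
  field_simp
  ring

section

variable {A : ℝ → ℝ} {L δ : ℝ}

lemma cauchyKernel_re (x y : ℝ) :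
    (cauchyKernel A x y).re = (y - x) / ((y - x) ^ 2 + (A y - A x) ^ 2) := by
  rw [cauchyKernel_eq, Complex.inv_re, Complex.normSq_apply, graphPt_sub_re, graphPt_sub_im,
    ← sq, ← sq]

lemma cauchyKernel_im (x y : ℝ) :
    (cauchyKernel A x y).im = -((A y - A x) / ((y - x) ^ 2 + (A y - A x) ^ 2)) := by
  rw [cauchyKernel_eq, Complex.inv_im, Complex.normSq_apply, graphPt_sub_re, graphPt_sub_im,
    ← sq, ← sq, neg_div]

/-- The symmetrisation of the truncated Cauchy kernel. -/
noncomputable def symCauchy (A : ℝ → ℝ) (δ : ℝ) (q : ℝ × ℝ × ℝ) : ℝ :=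
  symKernel (fun x y => (truncKernel A δ x y).re) q +
    symKernel (fun x y => (truncKernel A δ x y).im) q

lemma abs_re_mul_add_im_mul_le (u v : ℂ) : |u.re * v.re + u.im * v.im| ≤ ‖u‖ * ‖v‖ := by
  have h := Complex.abs_re_le_norm ((starRingEnd ℂ) u * v)
  rw [norm_mul, RCLike.norm_conj] at h
  simpa using h

lemma symCauchy_eq (q : ℝ × ℝ × ℝ) : symCauchy A δ q =
    ((truncKernel A δ q.1 q.2.1).re * (truncKernel A δ q.1 q.2.2).re +
      (truncKernel A δ q.1 q.2.1).im * (truncKernel A δ q.1 q.2.2).im) +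
    ((truncKernel A δ q.2.1 q.1).re * (truncKernel A δ q.2.1 q.2.2).re +
      (truncKernel A δ q.2.1 q.1).im * (truncKernel A δ q.2.1 q.2.2).im) +
    ((truncKernel A δ q.2.2 q.1).re * (truncKernel A δ q.2.2 q.2.1).re +
      (truncKernel A δ q.2.2 q.1).im * (truncKernel A δ q.2.2 q.2.1).im) := by
  simp only [symCauchy, symKernel]
  ring

lemma abs_symCauchy_le_curvQ (hδ : 0 < δ) {x y w : ℝ} (h1 : δ < |y - x|) (h2 : δ < |w - x|)
    (h3 : δ < |w - y|) : |symCauchy A δ (x, y, w)| ≤ 2 * curvQ A x y w := by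
  have n1 : y - x ≠ 0 := by rintro h; rw [h, abs_zero] at h1; linarith
  have n2 : w - x ≠ 0 := by rintro h; rw [h, abs_zero] at h2; linarith
  have n3 : w - y ≠ 0 := by rintro h; rw [h, abs_zero] at h3; linarith
  have key := sum_kernel_eq (a := y - x) (b := A y - A x) (c := w - x) (d := A w - A x) n1 n2
    (by rwa [sub_sub_sub_cancel_right])
  simp only [sub_sub_sub_cancel_right] at key
  have e : symCauchy A δ (x, y, w) = 2 * (((y - x) * (A w - A x) - (w - x) * (A y - A x)) ^ 2 /
      (((y - x) ^ 2 + (A y - A x) ^ 2) * ((w - x) ^ 2 + (A w - A x) ^ 2) *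
      ((w - y) ^ 2 + (A w - A y) ^ 2))) := by
    rw [← key, symCauchy_eq]
    simp only [truncKernel_antisymm δ x y, truncKernel_antisymm δ x w, truncKernel_antisymm δ y w]
    simp only [truncKernel, h1, h2, h3, if_true, Complex.neg_re, Complex.neg_im, cauchyKernel_re,
      cauchyKernel_im]
    ring
  rw [e, abs_of_nonneg (by positivity), curvQ]
  gcongr <;> nlinarith [sq_nonneg (A y - A x), sq_nonneg (A w - A x), sq_nonneg (A w - A y)]

/-- The contribution to the symmetrised kernel of ordered triples. -/
noncomputable def orderedPart (A : ℝ → ℝ) (δ : ℝ) (q : ℝ × ℝ × ℝ) : ℝ≥0∞ :=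
  if q.1 < q.2.1 ∧ q.2.1 < q.2.2 ∧ q.1 + δ < q.2.2 then
    ENNReal.ofReal (2 * curvQ A q.1 q.2.1 q.2.2) else 0

/-- The contribution to the symmetrised kernel of triples with a close pair. -/
noncomputable def closePart (δ : ℝ) (q : ℝ × ℝ × ℝ) : ℝ≥0∞ :=
  if δ < |q.2.1 - q.1| ∧ |q.2.2 - q.2.1| ≤ δ then
    ENNReal.ofReal (2 * (1 / (q.2.1 - q.1) ^ 2)) else 0

/-- The permutations of the coordinates of `ℝ × ℝ × ℝ`. -/
def permTriple : Fin 6 → ℝ × ℝ × ℝ → ℝ × ℝ × ℝ :=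
  ![fun q => (q.1, q.2.1, q.2.2), fun q => (q.1, q.2.2, q.2.1), fun q => (q.2.1, q.1, q.2.2),
    fun q => (q.2.1, q.2.2, q.1), fun q => (q.2.2, q.1, q.2.1), fun q => (q.2.2, q.2.1, q.1)]

lemma measurePreserving_permTriple (μ : Measure ℝ) [IsFiniteMeasure μ] (i : Fin 6) :
    MeasurePreserving (permTriple i) (μ.prod (μ.prod μ)) (μ.prod (μ.prod μ)) := by
  have r := measurePreserving_rotate μ
  have s := measurePreserving_swap_right μ
  fin_cases i
  · exact MeasurePreserving.id _
  · exact s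
  · exact measurePreserving_swap_left μ
  · exact r.comp r
  · exact r
  · exact s.comp r

lemma norm_mul_le_of_close (hδ : 0 < δ) {x y w : ℝ} (h1 : δ < |y - x|) (h2 : δ < |w - x|)
    (h3 : |w - y| ≤ δ) : ‖truncKernel A δ x y‖ * ‖truncKernel A δ x w‖ ≤
      2 * (1 / (y - x) ^ 2) := by
  simp only [truncKernel, h1, h2, if_true]
  have p1 := hδ.trans h1
  have p2 := hδ.trans h2
  have h4 : |y - x| / 2 ≤ |w - x| := by
    have := abs_sub_abs_le_abs_sub (y - x) (w - x)
    rw [sub_sub_sub_cancel_right, abs_sub_comm y w] at this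
    linarith
  calc _ ≤ |y - x|⁻¹ * (|y - x| / 2)⁻¹ := by
        gcongr
        · exact norm_cauchyKernel_le x y
        · exact (norm_cauchyKernel_le x w).trans (inv_anti₀ (by positivity) h4)
    _ = 2 * (1 / |y - x| ^ 2) := by field_simp
    _ = _ := by rw [sq_abs]

lemma curvQ_swap_right (B : ℝ → ℝ) (x y w : ℝ) : curvQ B x w y = curvQ B x y w := by
  unfold curvQ
  congr 1 <;> ring

lemma curvQ_swap_left (B : ℝ → ℝ) (x y w : ℝ) : curvQ B y x w = curvQ B x y w := by
  unfold curvQ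
  congr 1 <;> ring

lemma symCauchy_le_sum (hδ : 0 < δ) (q : ℝ × ℝ × ℝ) :
    ENNReal.ofReal |symCauchy A δ q| ≤
      ∑ i, (orderedPart A δ (permTriple i q) + closePart δ (permTriple i q)) := by
  obtain ⟨x, y, w⟩ := q
  have of_term : ∀ i : Fin 6, ENNReal.ofReal |symCauchy A δ (x, y, w)| ≤
      orderedPart A δ (permTriple i (x, y, w)) + closePart δ (permTriple i (x, y, w)) →
      ENNReal.ofReal |symCauchy A δ (x, y, w)| ≤
      ∑ i, (orderedPart A δ (permTriple i (x, y, w)) + closePart δ (permTriple i (x, y, w))) :=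
    fun i hi => hi.trans (Finset.single_le_sum (f := fun i => orderedPart A δ
      (permTriple i (x, y, w)) + closePart δ (permTriple i (x, y, w))) (fun _ _ => zero_le)
      (Finset.mem_univ i))
  by_cases h1 : δ < |y - x| <;> by_cases h2 : δ < |w - x| <;> by_cases h3 : δ < |w - y|
  · have hc := ENNReal.ofReal_le_ofReal (abs_symCauchy_le_curvQ (A := A) hδ h1 h2 h3)
    have ord : ∀ (i : Fin 6) (x' y' w' : ℝ), permTriple i (x, y, w) = (x', y', w') →
        curvQ A x' y' w' = curvQ A x y w → x' < y' → y' < w' → δ < |w' - x'| →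
        ENNReal.ofReal |symCauchy A δ (x, y, w)| ≤
        orderedPart A δ (permTriple i (x, y, w)) + closePart δ (permTriple i (x, y, w)) := by
      intro i x' y' w' hp hq l1 l2 l3
      refine hc.trans (le_add_right (le_of_eq ?_))
      rw [hp, orderedPart, if_pos, hq]
      rw [abs_of_pos (by linarith)] at l3
      exact ⟨l1, l2, by simp only; linarith⟩
    have ne1 : x ≠ y := by rintro rfl; simp at h1; linarith
    have ne2 : x ≠ w := by rintro rfl; simp at h2; linarith
    have ne3 : y ≠ w := by rintro rfl; simp at h3; linarith
    rcases lt_or_gt_of_ne ne1 with l1 | l1 <;> rcases lt_or_gt_of_ne ne2 with l2 | l2 <;>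
      rcases lt_or_gt_of_ne ne3 with l3 | l3
    · exact of_term 0 (ord 0 _ _ _ rfl rfl l1 l3 h2)
    · exact of_term 1 (ord 1 _ _ _ rfl (curvQ_swap_right ..) l2 l3 h1)
    · linarith
    · exact of_term 4 (ord 4 _ _ _ rfl (by rw [curvQ_swap_left, curvQ_swap_right]) l2 l1
        (by rwa [abs_sub_comm]))
    · exact of_term 2 (ord 2 _ _ _ rfl (curvQ_swap_left ..) l1 l2 h3)
    · linarith
    · exact of_term 3 (ord 3 _ _ _ rfl (by rw [curvQ_swap_right, curvQ_swap_left]) l3 l2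
        (by rwa [abs_sub_comm]))
    · exact of_term 5 (ord 5 _ _ _ rfl (by rw [curvQ_swap_right, curvQ_swap_left,
        curvQ_swap_right]) l3 l1 (by rwa [abs_sub_comm]))
  all_goals rw [symCauchy_eq]
  all_goals rw [symCauchy_eq] at of_term
  · refine of_term 0 (le_add_left ?_)
    have z1 : truncKernel A δ y w = 0 := if_neg h3
    have z2 : truncKernel A δ w y = 0 := by rw [truncKernel_antisymm, z1, neg_zero]
    simp only [z1, z2, Complex.zero_re, Complex.zero_im, mul_zero, add_zero]
    refine (ENNReal.ofReal_le_ofReal ((abs_re_mul_add_im_mul_le _ _).trans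
      (norm_mul_le_of_close hδ h1 h2 (not_lt.1 h3)))).trans (le_of_eq ?_)
    simp [permTriple, closePart, h1, not_lt.1 h3]
  · refine of_term 2 (le_add_left ?_)
    have z1 : truncKernel A δ x w = 0 := if_neg h2
    have z2 : truncKernel A δ w x = 0 := by rw [truncKernel_antisymm, z1, neg_zero]
    simp only [z1, z2, Complex.zero_re, Complex.zero_im, mul_zero, zero_mul, add_zero, zero_add]
    rw [abs_sub_comm] at h1
    refine (ENNReal.ofReal_le_ofReal ((abs_re_mul_add_im_mul_le _ _).trans
      (norm_mul_le_of_close hδ h1 h3 (not_lt.1 h2)))).trans (le_of_eq ?_)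
    simp [permTriple, closePart, h1, not_lt.1 h2]
  · have z1 : truncKernel A δ x w = 0 := if_neg h2
    have z2 : truncKernel A δ y w = 0 := if_neg h3
    have z3 : truncKernel A δ w x = 0 := by rw [truncKernel_antisymm, z1, neg_zero]
    simp [z1, z2, z3]
  · refine of_term 4 (le_add_left ?_)
    have z1 : truncKernel A δ x y = 0 := if_neg h1
    have z2 : truncKernel A δ y x = 0 := by rw [truncKernel_antisymm, z1, neg_zero]
    simp only [z1, z2, Complex.zero_re, Complex.zero_im, zero_mul, add_zero, zero_add]
    rw [abs_sub_comm] at h2 h3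
    rw [abs_sub_comm] at h1
    refine (ENNReal.ofReal_le_ofReal ((abs_re_mul_add_im_mul_le _ _).trans
      (norm_mul_le_of_close hδ h2 h3 (by rw [abs_sub_comm]; exact not_lt.1 h1)))).trans
      (le_of_eq ?_)
    rw [abs_sub_comm] at h1
    simp [permTriple, closePart, h2, not_lt.1 h1]
  · have z1 : truncKernel A δ x y = 0 := if_neg h1
    have z2 : truncKernel A δ w y = 0 := by rw [truncKernel_antisymm, truncKernel, if_neg h3, neg_zero]
    have z3 : truncKernel A δ y x = 0 := by rw [truncKernel_antisymm, z1, neg_zero]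
    simp [z1, z2, z3]
  · have z1 : truncKernel A δ x y = 0 := if_neg h1
    have z2 : truncKernel A δ w x = 0 := by rw [truncKernel_antisymm, truncKernel, if_neg h2, neg_zero]
    have z3 : truncKernel A δ y x = 0 := by rw [truncKernel_antisymm, z1, neg_zero]
    simp [z1, z2, z3]
  · have z1 : truncKernel A δ x y = 0 := if_neg h1
    have z2 : truncKernel A δ w x = 0 := by rw [truncKernel_antisymm, truncKernel, if_neg h2, neg_zero]
    have z3 : truncKernel A δ y x = 0 := by rw [truncKernel_antisymm, z1, neg_zero]
    simp [z1, z2, z3]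

end

section

variable {A : ℝ → ℝ} {L δ a b : ℝ}

lemma measurable_orderedPart (hA : Continuous A) : Measurable (orderedPart A δ) := by
  unfold orderedPart
  have m : Measurable fun q : ℝ × ℝ × ℝ => curvQ A q.1 q.2.1 q.2.2 := measurable_curvQ hA
  have m1 : MeasurableSet {q : ℝ × ℝ × ℝ | q.1 < q.2.1} :=
    measurableSet_lt (by fun_prop) (by fun_prop)
  have m2 : MeasurableSet {q : ℝ × ℝ × ℝ | q.2.1 < q.2.2} :=
    measurableSet_lt (by fun_prop) (by fun_prop)
  have m3 : MeasurableSet {q : ℝ × ℝ × ℝ | q.1 + δ < q.2.2} :=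
    measurableSet_lt (by fun_prop) (by fun_prop)
  exact Measurable.ite (m1.inter (m2.inter m3)) (by fun_prop) measurable_const

lemma measurable_closePart : Measurable (closePart δ) := by
  unfold closePart
  have m1 : MeasurableSet {q : ℝ × ℝ × ℝ | δ < |q.2.1 - q.1|} :=
    measurableSet_lt (by fun_prop) (by fun_prop)
  have m2 : MeasurableSet {q : ℝ × ℝ × ℝ | |q.2.2 - q.2.1| ≤ δ} :=
    measurableSet_le (by fun_prop) (by fun_prop)
  exact Measurable.ite (m1.inter m2) (by fun_prop) measurable_const

lemma lintegral_orderedPart_le (hA : ∀ x₁ x₂ : ℝ, |A x₁ - A x₂| ≤ L * |x₁ - x₂|)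
    (hδ : 0 < δ) (hab : a ≤ b) :
    ∫⁻ q, orderedPart A δ q ∂((volume.restrict (Ioo a b)).prod
      ((volume.restrict (Ioo a b)).prod (volume.restrict (Ioo a b)))) ≤
      ENNReal.ofReal (16 * L ^ 2 * (b - a)) := by
  have hc := continuous_of_lipBound hA
  rw [← (measurePreserving_swap_right (volume.restrict (Ioo a b))).lintegral_comp
    (measurable_orderedPart hc)]
  have ms : Measurable fun q : ℝ × ℝ × ℝ => orderedPart A δ (q.1, q.2.2, q.2.1) :=
    (measurable_orderedPart hc).comp (by fun_prop)
  rw [lintegral_prod _ ms.aemeasurable]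
  have e : ENNReal.ofReal (16 * L ^ 2 * (b - a)) = 2 * ENNReal.ofReal (8 * L ^ 2 * (b - a)) := by
    rw [← ENNReal.ofReal_ofNat 2, ← ENNReal.ofReal_mul (by norm_num)]
    congr 1; ring
  rw [e]
  refine le_trans ?_ (mul_le_mul_right (lintegral_curvQ_le hA hab hδ) 2)
  rw [← lintegral_const_mul' _ _ (by norm_num)]
  refine setLIntegral_mono' measurableSet_Ioo fun x hx => ?_
  rw [← lintegral_const_mul' _ _ (by norm_num)]
  have mx : Measurable fun q : ℝ × ℝ => orderedPart A δ (x, q.2, q.1) :=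
    (measurable_orderedPart hc).comp (by fun_prop)
  rw [lintegral_prod _ mx.aemeasurable, ← lintegral_indicator measurableSet_Ioo,
    ← lintegral_indicator measurableSet_Ioo]
  refine lintegral_mono fun w => ?_
  by_cases hw : w ∈ Ioo a b
  swap
  · simp [hw]
  rw [indicator_of_mem hw]
  by_cases hw' : w ∈ Ioo (x + δ) b
  · rw [indicator_of_mem hw', ← lintegral_const_mul' _ _ (by norm_num),
      ← lintegral_indicator measurableSet_Ioo, ← lintegral_indicator measurableSet_Ioo]
    refine lintegral_mono fun y => ?_
    simp only [indicator_apply, orderedPart]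
    by_cases h1 : y ∈ Ioo a b
    · rw [if_pos h1]
      by_cases h2 : x < y ∧ y < w ∧ x + δ < w
      · rw [if_pos h2, if_pos ⟨h2.1, h2.2.1⟩, ENNReal.ofReal_mul (by norm_num),
          ENNReal.ofReal_ofNat]
      · rw [if_neg h2]; exact zero_le
    · rw [if_neg h1]; exact zero_le
  · have : ∀ y, orderedPart A δ (x, y, w) = 0 := fun y => by
      unfold orderedPart
      exact if_neg fun h => hw' ⟨h.2.2, hw.2⟩
    simp [this]

lemma lintegral_closePart_le (hδ : 0 < δ) :
    ∫⁻ q, closePart δ q ∂((volume.restrict (Ioo a b)).prod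
      ((volume.restrict (Ioo a b)).prod (volume.restrict (Ioo a b)))) ≤
      ENNReal.ofReal (8 * (b - a)) := by
  rw [lintegral_prod _ measurable_closePart.aemeasurable]
  have inner : ∀ x, ∫⁻ q, closePart δ (x, q) ∂((volume.restrict (Ioo a b)).prod
      (volume.restrict (Ioo a b))) ≤ ENNReal.ofReal 8 := by
    intro x
    have mx : Measurable fun q : ℝ × ℝ => closePart δ (x, q) :=
      measurable_closePart.comp (by fun_prop)
    rw [lintegral_prod _ mx.aemeasurable]
    have hw : ∀ y, ∫⁻ w in Ioo a b, closePart δ (x, y, w) ≤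
        {y : ℝ | δ < |y - x|}.indicator
          (fun y => ENNReal.ofReal (4 * δ) * ENNReal.ofReal (1 / (y - x) ^ 2)) y := by
      intro y
      by_cases h : δ < |y - x|
      · rw [indicator_of_mem (show y ∈ {y : ℝ | δ < |y - x|} from h)]
        calc _ ≤ ∫⁻ w in Icc (y - δ) (y + δ), ENNReal.ofReal (2 * (1 / (y - x) ^ 2)) := by
              rw [← lintegral_indicator measurableSet_Ioo, ← lintegral_indicator measurableSet_Icc]
              refine lintegral_mono fun w => ?_
              simp only [indicator_apply, closePart, h, true_and]
              split_ifs with h1 h2 h3 <;> try exact zero_le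
              · exact le_rfl
              · rw [abs_le] at h2
                exact absurd ⟨by linarith [h2.1], by linarith [h2.2]⟩ h3
          _ = _ := by
              rw [setLIntegral_const, Real.volume_Icc, ← ENNReal.ofReal_mul (by positivity),
                ← ENNReal.ofReal_mul (by positivity)]
              congr 1; ring
      · simp [closePart, h]
    refine (lintegral_mono' Measure.restrict_le_self hw).trans ?_
    rw [lintegral_indicator (measurableSet_lt measurable_const (by fun_prop)),
      lintegral_const_mul' _ _ ENNReal.ofReal_ne_top]
    refine (mul_le_mul_right (lintegral_inv_sq_le hδ x) _).trans (le_of_eq ?_)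
    rw [← ENNReal.ofReal_mul (by positivity)]
    congr 1
    field_simp
    norm_num
  refine (lintegral_mono inner).trans (le_of_eq ?_)
  rw [setLIntegral_const, Real.volume_Ioo, ← ENNReal.ofReal_mul (by norm_num)]

/-- The truncated Cauchy integrals are bounded from `L^∞` to `L²` on every interval, uniformly in
the truncation. -/
lemma lintegral_truncCauchy_sq_le (hA : ∀ x₁ x₂ : ℝ, |A x₁ - A x₂| ≤ L * |x₁ - x₂|)
    (hδ : 0 < δ) (hab : a ≤ b) {f : ℝ → ℝ} (hf : Measurable f) (hf1 : ∀ x, |f x| ≤ 1) :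
    ∫⁻ x in Ioo a b, ENNReal.ofReal (‖∫ y in Ioo a b, truncKernel A δ x y * (f y : ℂ)‖ ^ 2) ≤
      ENNReal.ofReal ((400 * L ^ 2 + 200) * (b - a)) := by
  have hc := continuous_of_lipBound hA
  set μ := volume.restrict (Ioo a b)
  have mk := measurable_truncKernel hc.measurable δ
  have mr : Measurable fun q : ℝ × ℝ => (truncKernel A δ q.1 q.2).re := Complex.measurable_re.comp mk
  have mi : Measurable fun q : ℝ × ℝ => (truncKernel A δ q.1 q.2).im := Complex.measurable_im.comp mk
  have br : ∀ x y, |(truncKernel A δ x y).re| ≤ δ⁻¹ := fun x y =>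
    (Complex.abs_re_le_norm _).trans (norm_truncKernel_le hδ x y)
  have bi : ∀ x y, |(truncKernel A δ x y).im| ≤ δ⁻¹ := fun x y =>
    (Complex.abs_im_le_norm _).trans (norm_truncKernel_le hδ x y)
  have key := integral_sq_le_of_symKernel (μ := μ) mr mi br bi hf hf1
  have hJ : ∫ q, |symCauchy A δ q| ∂(μ.prod (μ.prod μ)) ≤ 6 * (16 * L ^ 2 + 8) * (b - a) := by
    have hs : Measurable (symCauchy A δ) := (measurable_symKernel mr).add (measurable_symKernel mi)
    rw [integral_eq_lintegral_of_nonneg_ae (Eventually.of_forall fun q => abs_nonneg _)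
      (by fun_prop)]
    refine ENNReal.toReal_le_of_le_ofReal (by have := sub_nonneg.2 hab; positivity) ?_
    refine (lintegral_mono (symCauchy_le_sum hδ)).trans ?_
    have m1 := measurable_orderedPart (δ := δ) hc
    have m2 := measurable_closePart (δ := δ)
    have mp := measurePreserving_permTriple μ
    have mpm : ∀ i, Measurable (permTriple i) := fun i => (mp i).measurable
    have ms : ∀ i, Measurable fun q =>
        orderedPart A δ (permTriple i q) + closePart δ (permTriple i q) :=
      fun i => (m1.comp (mpm i)).add (m2.comp (mpm i))
    rw [lintegral_finsetSum _ fun i _ => ms i]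
    have each : ∀ i, ∫⁻ q, (orderedPart A δ (permTriple i q) + closePart δ (permTriple i q))
        ∂(μ.prod (μ.prod μ)) ≤ ENNReal.ofReal ((16 * L ^ 2 + 8) * (b - a)) := fun i => by
      rw [(mp i).lintegral_comp (f := fun q => orderedPart A δ q + closePart δ q) (m1.add m2),
        add_mul, ENNReal.ofReal_add
        (by have := sub_nonneg.2 hab; positivity) (by have := sub_nonneg.2 hab; positivity)]
      rw [lintegral_add_left m1]
      exact add_le_add (lintegral_orderedPart_le hA hδ hab) (lintegral_closePart_le hδ)
    refine (Finset.sum_le_sum fun i _ => each i).trans (le_of_eq ?_)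
    rw [Finset.sum_const, Finset.card_univ, Fintype.card_fin, nsmul_eq_mul,
      ← ENNReal.ofReal_natCast, ← ENNReal.ofReal_mul (by norm_num)]
    congr 1; push_cast; ring
  have pt : ∀ x, ‖∫ y, truncKernel A δ x y * (f y : ℂ) ∂μ‖ ^ 2 =
      (∫ y, (truncKernel A δ x y).re * f y ∂μ) ^ 2 +
      (∫ y, (truncKernel A δ x y).im * f y ∂μ) ^ 2 := by
    intro x
    have hi : Integrable (fun y => truncKernel A δ x y * (f y : ℂ)) μ := by
      refine integrable_truncKernel_mul hc.measurable hδ ?_ x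
      exact (integrable_of_measurable_of_bound hf hf1).ofReal
    rw [Complex.sq_norm, Complex.normSq_apply, ← sq, ← sq]
    congr 2
    · have := integral_re hi
      simp only [RCLike.re_eq_complex_re, Complex.re_mul_ofReal] at this
      exact this.symm
    · have := integral_im hi
      simp only [RCLike.im_eq_complex_im, Complex.im_mul_ofReal] at this
      exact this.symm
  simp only [pt]
  have hi := (integrable_sq_kernel (μ := μ) mr br hf hf1).add
    (integrable_sq_kernel (μ := μ) mi bi hf hf1)
  have ho := ofReal_integral_eq_lintegral_ofReal hi
    (Eventually.of_forall fun x => by simp only [Pi.add_apply, Pi.zero_apply]; positivity)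
  simp only [Pi.add_apply] at ho
  rw [← ho]
  refine ENNReal.ofReal_le_ofReal (key.trans ?_)
  have := sub_nonneg.2 hab
  change 4 * ∫ q, |symCauchy A δ q| ∂(μ.prod (μ.prod μ)) ≤ _
  nlinarith [mul_nonneg (sq_nonneg L) this]

end

section

variable {A : ℝ → ℝ} {L δ a b τ : ℝ} {f : ℝ → ℝ}

lemma measurable_truncCauchy (hA : Measurable A) {F : ℝ → ℂ} (hF : Measurable F) :
    Measurable (truncCauchy A δ F) := by
  have : StronglyMeasurable fun q : ℝ × ℝ => truncKernel A δ q.1 q.2 * F q.2 :=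
    ((measurable_truncKernel hA δ).mul (hF.comp measurable_snd)).stronglyMeasurable
  exact this.integral_prod_right'.measurable

lemma integrable_of_bound_of_support {a b τ : ℝ} {f : ℝ → ℝ} (hf : Measurable f)
    (hfτ : ∀ x, |f x| ≤ τ)
    (hs : ∀ x, x ∉ Ioo a b → f x = 0) : Integrable (fun x => (f x : ℂ)) := by
  have h : IntegrableOn f (Ioo a b) := by
    refine Measure.integrableOn_of_bounded (M := τ) ?_ hf.aestronglyMeasurable
      (Eventually.of_forall hfτ)
    simp
  have e : f = (Ioo a b).indicator f := by
    ext x; by_cases hx : x ∈ Ioo a b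
    · simp [hx]
    · simp [hx, hs x hx]
  rw [e]
  exact (h.integrable_indicator measurableSet_Ioo).ofReal

/-- The truncated Cauchy integrals are bounded from `L^∞` to `L¹` on every interval. -/
lemma lintegral_truncCauchy_le (hA : ∀ x₁ x₂ : ℝ, |A x₁ - A x₂| ≤ L * |x₁ - x₂|)
    (hδ : 0 < δ) (hab : a ≤ b) (hτ : 0 < τ) (hf : Measurable f) (hfτ : ∀ x, |f x| ≤ τ)
    (hs : ∀ x, x ∉ Ioo a b → f x = 0) :
    ∫⁻ x in Ioo a b, ENNReal.ofReal ‖truncCauchy A δ (fun y => (f y : ℂ)) x‖ ≤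
      ENNReal.ofReal ((200 * L ^ 2 + 101) * τ * (b - a)) := by
  have hab' := sub_nonneg.2 hab
  have h2 := lintegral_truncCauchy_sq_le hA hδ hab (f := fun x => τ⁻¹ * f x) (hf.const_mul _)
    (fun x => by
      rw [abs_mul, abs_inv, abs_of_pos hτ, inv_mul_le_iff₀ hτ, mul_one]; exact hfτ x)
  have e : ∀ x, ∫ y in Ioo a b, truncKernel A δ x y * ((τ⁻¹ * f y : ℝ) : ℂ) =
      (τ⁻¹ : ℝ) * truncCauchy A δ (fun y => (f y : ℂ)) x := fun x => by
    rw [truncCauchy, setIntegral_eq_integral_of_forall_compl_eq_zero, ← integral_const_mul]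
    · congr 1; ext y; push_cast; ring
    · intro y hy; simp [hs y hy]
  simp only [e, norm_mul, Complex.norm_real, Real.norm_eq_abs, abs_of_pos (inv_pos.2 hτ)] at h2
  calc _ ≤ ∫⁻ x in Ioo a b, ENNReal.ofReal (τ / 2) * (ENNReal.ofReal
        ((τ⁻¹ * ‖truncCauchy A δ (fun y => (f y : ℂ)) x‖) ^ 2) + ENNReal.ofReal 1) := by
        refine lintegral_mono fun x => ?_
        simp only
        rw [← ENNReal.ofReal_add (by positivity) (by norm_num),
          ← ENNReal.ofReal_mul (by positivity)]
        refine ENNReal.ofReal_le_ofReal ?_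
        generalize ‖truncCauchy A δ (fun y => (f y : ℂ)) x‖ = t
        have : τ / 2 * ((τ⁻¹ * t) ^ 2 + 1) - t = τ / 2 * (τ⁻¹ * t - 1) ^ 2 := by
          field_simp; ring
        nlinarith [mul_nonneg hτ.le (sq_nonneg (τ⁻¹ * t - 1))]
    _ ≤ ENNReal.ofReal (τ / 2) * (ENNReal.ofReal ((400 * L ^ 2 + 200) * (b - a)) +
          ENNReal.ofReal (b - a)) := by
        rw [lintegral_const_mul' _ _ ENNReal.ofReal_ne_top, lintegral_add_right _ measurable_const,
          setLIntegral_const, Real.volume_Ioo, ENNReal.ofReal_one, one_mul]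
        gcongr
    _ ≤ _ := by
        rw [← ENNReal.ofReal_add (by positivity) (by positivity),
          ← ENNReal.ofReal_mul (by positivity)]
        refine ENNReal.ofReal_le_ofReal ?_
        nlinarith [mul_nonneg hτ.le hab', sq_nonneg L]

lemma norm_integral_le_of_le_inv_sq {G : ℝ → ℂ} {c C : ℝ} (hδ : 0 < δ) (hC : 0 ≤ C)
    (h : ∀ y, δ < |y - c| → ‖G y‖ ≤ C * (1 / (y - c) ^ 2)) (h0 : ∀ y, ¬ δ < |y - c| → G y = 0) :
    ‖∫ y, G y‖ ≤ 2 * C / δ := by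
  have : ENNReal.ofReal ‖∫ y, G y‖ ≤ ENNReal.ofReal (2 * C / δ) := by
    rw [ofReal_norm]
    refine (enorm_integral_le_lintegral_enorm _).trans ?_
    calc _ ≤ ∫⁻ y in {y : ℝ | δ < |y - c|}, ENNReal.ofReal C *
          ENNReal.ofReal (1 / (y - c) ^ 2) := by
          rw [← lintegral_indicator (measurableSet_lt measurable_const (by fun_prop))]
          refine lintegral_mono fun y => ?_
          by_cases hy : δ < |y - c|
          · rw [indicator_of_mem (show y ∈ {y : ℝ | δ < |y - c|} from hy), ← ofReal_norm,
              ← ENNReal.ofReal_mul hC]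
            exact ENNReal.ofReal_le_ofReal (h y hy)
          · simp [h0 y hy]
      _ ≤ ENNReal.ofReal C * ENNReal.ofReal (2 / δ) := by
          rw [lintegral_const_mul' _ _ ENNReal.ofReal_ne_top]
          exact mul_le_mul_right (lintegral_inv_sq_le hδ c) _
      _ = _ := by
          rw [← ENNReal.ofReal_mul hC]; congr 1; ring
  exact (ENNReal.ofReal_le_ofReal_iff (by positivity)).1 this

/-- Comparison of a truncated Cauchy integral with finer truncations at nearby points. -/
lemma norm_truncCauchy_le_near (hA : ∀ x₁ x₂ : ℝ, |A x₁ - A x₂| ≤ L * |x₁ - x₂|) (hL : 0 < L)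
    {e x x' : ℝ} (he : 0 < e) (heδ : e ≤ δ / 2) (hx : |x' - x| ≤ δ / 2) (hτ : 0 < τ)
    (hfτ : ∀ x, |f x| ≤ τ) (hfi : Integrable (fun x => (f x : ℂ))) :
    ‖truncCauchy A δ (fun y => (f y : ℂ)) x‖ ≤ ‖truncCauchy A e (fun y => (f y : ℂ)) x'‖ +
      ‖truncCauchy A e (fun y => (({y | |y - x| ≤ δ}.indicator f y : ℝ) : ℂ)) x'‖ +
        2 * (1 + L) * τ := by
  have hδ : 0 < δ := by linarith
  have hm : Measurable A := (continuous_of_lipBound hA).measurable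
  set S := {y : ℝ | |y - x| ≤ δ}
  have hSm : MeasurableSet S := measurableSet_le (by fun_prop) measurable_const
  have hS : ∀ y, y ∈ S ↔ ¬ δ < |y - x| := fun y => (not_lt (a := δ) (b := |y - x|)).symm
  have hfS : Integrable (fun y => ((S.indicator f y : ℝ) : ℂ)) := by
    have := hfi.indicator hSm
    refine this.congr (Eventually.of_forall fun y => ?_)
    by_cases hy : y ∈ S <;> simp [hy]
  have i1 := integrable_truncKernel_mul hm hδ hfi x
  have i2 := integrable_truncKernel_mul hm he hfi x'
  have i3 := integrable_truncKernel_mul hm he hfS x'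
  have split : truncCauchy A δ (fun y => (f y : ℂ)) x =
      truncCauchy A e (fun y => (f y : ℂ)) x' -
      truncCauchy A e (fun y => ((S.indicator f y : ℝ) : ℂ)) x' +
      ∫ y, (truncKernel A δ x y * f y - (truncKernel A e x' y * f y -
        truncKernel A e x' y * ((S.indicator f y : ℝ) : ℂ))) := by
    have a1 := integral_sub i1 (i2.sub i3)
    have a2 := integral_sub i2 i3
    simp only [Pi.sub_apply] at a1
    rw [a1, a2]
    simp only [truncCauchy]
    ring
  rw [split]
  refine (norm_add_le _ _).trans (add_le_add (norm_sub_le _ _) ?_)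
  refine (norm_integral_le_of_le_inv_sq (c := x) hδ (C := (1 + L) * δ * τ) (by positivity)
    ?_ ?_).trans (le_of_eq (by field_simp))
  · intro y hy
    have h1 : |y - x| / 2 < |y - x'| := by
      have := abs_sub_abs_le_abs_sub (y - x) (y - x')
      rw [sub_sub_sub_cancel_left] at this
      linarith
    have h2 : e < |y - x'| := by linarith
    have hyS : y ∉ S := fun h => (hS y).1 h hy
    simp only [truncKernel, hy, h2, if_true, indicator_of_notMem hyS, Complex.ofReal_zero,
      mul_zero, sub_zero]
    rw [← sub_mul, norm_mul, Complex.norm_real, Real.norm_eq_abs]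
    have hxy : x ≠ y := by rintro rfl; simp at hy; linarith
    have hxy' : x' ≠ y := by rintro rfl; simp at h2; linarith
    have hk := norm_cauchyKernel_sub_le hA hL hxy hxy'
    rw [cauchyKernel_antisymm x y, cauchyKernel_antisymm x' y, neg_sub_neg, norm_sub_rev,
      abs_sub_comm x y, abs_sub_comm x' y, abs_sub_comm x x'] at hk
    calc _ ≤ ((1 + L) * (δ / 2) / (|y - x| * (|y - x| / 2))) * τ := by
          refine mul_le_mul (hk.trans ?_) (hfτ y) (abs_nonneg _) (by positivity)
          gcongr
      _ = (1 + L) * δ * τ * (1 / |y - x| ^ 2) := by field_simp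
      _ = _ := by rw [sq_abs]
  · intro y hy
    have hyS : y ∈ S := (hS y).2 hy
    simp [truncKernel, hy, indicator_of_mem hyS]

end

section

variable {A : ℝ → ℝ} {L δ a b τ : ℝ} {f : ℝ → ℝ}

/-- Cotlar's inequality for bounded functions, in integrated form. -/
lemma mul_norm_truncCauchy_le (hA : ∀ x₁ x₂ : ℝ, |A x₁ - A x₂| ≤ L * |x₁ - x₂|) (hL : 0 < L)
    {e x : ℝ} (he : 0 < e) (heδ : e ≤ δ / 2) (hτ : 0 < τ)
    (hf : Measurable f) (hfτ : ∀ x, |f x| ≤ τ) (hfi : Integrable (fun x => (f x : ℂ))) :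
    ENNReal.ofReal (δ * (‖truncCauchy A δ (fun y => (f y : ℂ)) x‖ -
      (800 * L ^ 2 + 2 * L + 406) * τ)) ≤
    ∫⁻ x' in Metric.closedBall x (δ / 2),
      ENNReal.ofReal ‖truncCauchy A e (fun y => (f y : ℂ)) x'‖ := by
  have hδ : 0 < δ := by linarith
  have hm : Measurable A := (continuous_of_lipBound hA).measurable
  set B := Metric.closedBall x (δ / 2)
  set h := {y : ℝ | |y - x| ≤ δ}.indicator f
  have hh : Measurable h := hf.indicator (measurableSet_le (by fun_prop) measurable_const)
  have hhτ : ∀ y, |h y| ≤ τ := fun y => by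
    simp only [h, indicator_apply]
    split_ifs
    · exact hfτ y
    · simpa using hτ.le
  have b1 := lintegral_truncCauchy_le hA he (show x - 2 * δ ≤ x + 2 * δ by linarith) hτ hh hhτ
    (fun y hy => indicator_of_notMem (fun hy' => hy (by
      have := abs_le.1 (show |y - x| ≤ δ from hy')
      constructor <;> linarith [this.1, this.2])) _)
  have hB : B ⊆ Ioo (x - 2 * δ) (x + 2 * δ) := fun y hy => by
    have := abs_le.1 (show |y - x| ≤ δ / 2 from hy)
    constructor <;> linarith [this.1, this.2]
  have hvol : volume B = ENNReal.ofReal δ := by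
    rw [Real.volume_closedBall]; congr 1; ring
  set T := truncCauchy A δ (fun y => (f y : ℂ)) x
  set c := ‖T‖ - 2 * (1 + L) * τ
  have key : ENNReal.ofReal (δ * c) ≤
      (∫⁻ x' in B, ENNReal.ofReal ‖truncCauchy A e (fun y => (f y : ℂ)) x'‖) +
      ENNReal.ofReal ((200 * L ^ 2 + 101) * τ * (x + 2 * δ - (x - 2 * δ))) := by
    calc ENNReal.ofReal (δ * c) = ∫⁻ x' in B, ENNReal.ofReal c := by
          rw [setLIntegral_const, hvol, mul_comm, ENNReal.ofReal_mul' hδ.le]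
      _ ≤ ∫⁻ x' in B, (ENNReal.ofReal ‖truncCauchy A e (fun y => (f y : ℂ)) x'‖ +
            ENNReal.ofReal ‖truncCauchy A e (fun y => (h y : ℂ)) x'‖) := by
          refine setLIntegral_mono' Metric.isClosed_closedBall.measurableSet fun x' hx' => ?_
          rw [← ENNReal.ofReal_add (norm_nonneg _) (norm_nonneg _)]
          refine ENNReal.ofReal_le_ofReal ?_
          have := norm_truncCauchy_le_near hA hL he heδ (show |x' - x| ≤ δ / 2 from hx') hτ hfτ hfi
          simp only [c]
          linarith
      _ = (∫⁻ x' in B, ENNReal.ofReal ‖truncCauchy A e (fun y => (f y : ℂ)) x'‖) +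
          ∫⁻ x' in B, ENNReal.ofReal ‖truncCauchy A e (fun y => (h y : ℂ)) x'‖ := by
          refine lintegral_add_left ?_ _
          exact (measurable_truncCauchy hm
            (Complex.measurable_ofReal.comp hf)).norm.ennreal_ofReal
      _ ≤ _ := by
          gcongr
          exact (lintegral_mono_set hB).trans b1
  have e2 : δ * (‖T‖ - (800 * L ^ 2 + 2 * L + 406) * τ) =
      δ * c - (200 * L ^ 2 + 101) * τ * (x + 2 * δ - (x - 2 * δ)) := by
    simp only [c]; ring
  rw [e2, ENNReal.ofReal_sub _ (by
    have : x + 2 * δ - (x - 2 * δ) = 4 * δ := by ring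
    rw [this]; positivity)]
  exact tsub_le_iff_right.2 key

lemma truncCauchy_eq_zero_of_le {F : ℝ → ℂ} (hs : ∀ x, x ∉ Ioo a b → F x = 0) {x : ℝ}
    (hx : x ∈ Ioo a b) (hδ : b - a ≤ δ) : truncCauchy A δ F x = 0 := by
  unfold truncCauchy
  rw [integral_eq_zero_of_ae]
  refine Eventually.of_forall fun y => ?_
  by_cases hy : y ∈ Ioo a b
  · have : ¬ δ < |y - x| := by
      rw [not_lt, abs_le]
      constructor <;> linarith [hx.1, hx.2, hy.1, hy.2]
    simp [truncKernel, this]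
  · simp [hs y hy]

lemma volume_truncCauchy_gt_le_aux (hA : ∀ x₁ x₂ : ℝ, |A x₁ - A x₂| ≤ L * |x₁ - x₂|)
    (hL : 0 < L) {lam e : ℝ} (hab : a < b) (hτ : 0 < τ) (he : 0 < e)
    (hlam : 2 * (800 * L ^ 2 + 2 * L + 406) * τ ≤ lam)
    (hf : Measurable f) (hfτ : ∀ x, |f x| ≤ τ) (hs : ∀ x, x ∉ Ioo a b → f x = 0) :
    volume {x ∈ Ioo a b | ∃ δ, 2 * e ≤ δ ∧ lam < ‖truncCauchy A δ (fun y => (f y : ℂ)) x‖} ≤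
      ENNReal.ofReal (30 * (200 * L ^ 2 + 101) * τ * (b - a) / lam) := by
  have hlam0 : 0 < lam := lt_of_lt_of_le (by positivity) hlam
  set E := {x ∈ Ioo a b | ∃ δ, 2 * e ≤ δ ∧ lam < ‖truncCauchy A δ (fun y => (f y : ℂ)) x‖}
  have hfi := integrable_of_bound_of_support hf hfτ hs
  have hsub := sub_pos.2 hab
  choose! ρ hρ using fun x (hx : x ∈ E) => hx.2
  have hρ0 : ∀ x ∈ E, 0 < ρ x := fun x hx => by linarith [(hρ x hx).1]
  have hρℓ : ∀ x ∈ E, ρ x < b - a := fun x hx => by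
    by_contra! h
    have := (hρ x hx).2
    rw [truncCauchy_eq_zero_of_le (fun y hy => by simp [hs y hy]) hx.1 h, norm_zero] at this
    linarith
  obtain ⟨u, huE, hdisj, hcov⟩ := Vitali.exists_disjoint_subfamily_covering_enlargement_closedBall
    E (fun x => x) (fun x => ρ x / 2) (b - a) (fun x hx => by linarith [hρℓ x hx, hρ0 x hx]) 5
    (by norm_num)
  have hucount : u.Countable := by
    refine hdisj.countable_of_nonempty_interior fun x hx => ?_
    rw [interior_closedBall _ (by have := hρ0 x (huE hx); positivity)]
    exact Metric.nonempty_ball.2 (by have := hρ0 x (huE hx); positivity)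
  set G := fun x => ENNReal.ofReal ‖truncCauchy A e (fun y => (f y : ℂ)) x‖
  have hball : ∀ x ∈ u, volume (Metric.closedBall x (5 * (ρ x / 2))) ≤
      ENNReal.ofReal (10 / lam) * ∫⁻ y in Metric.closedBall x (ρ x / 2), G y := by
    intro x hx
    have hx := huE hx
    have p := hρ0 x hx
    have h1 := mul_norm_truncCauchy_le hA hL he (δ := ρ x) (x := x) (by linarith [(hρ x hx).1])
      hτ hf hfτ hfi
    rw [Real.volume_closedBall]
    refine le_trans ?_ (mul_le_mul_right h1 _)
    rw [← ENNReal.ofReal_mul (by positivity)]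
    refine ENNReal.ofReal_le_ofReal ?_
    have h2 : lam / 2 ≤ ‖truncCauchy A (ρ x) (fun y => (f y : ℂ)) x‖ -
        (800 * L ^ 2 + 2 * L + 406) * τ := by linarith [(hρ x hx).2]
    calc 2 * (5 * (ρ x / 2)) = 10 / lam * (ρ x * (lam / 2)) := by field_simp; norm_num
      _ ≤ _ := by gcongr
  calc volume E ≤ volume (⋃ x ∈ u, Metric.closedBall x (5 * (ρ x / 2))) := by
        refine measure_mono fun x hx => ?_
        obtain ⟨y, hy, hxy⟩ := hcov x hx
        refine mem_biUnion hy (hxy (Metric.mem_closedBall_self ?_))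
        have := hρ0 x hx; positivity
    _ ≤ ∑' x : u, volume (Metric.closedBall (x : ℝ) (5 * (ρ x / 2))) :=
        measure_biUnion_le _ hucount _
    _ ≤ ∑' x : u, ENNReal.ofReal (10 / lam) * ∫⁻ y in Metric.closedBall (x : ℝ) (ρ x / 2), G y :=
        ENNReal.tsum_le_tsum fun x => hball x x.2
    _ = ENNReal.ofReal (10 / lam) * ∫⁻ y in ⋃ x ∈ u, Metric.closedBall (x : ℝ) (ρ x / 2), G y := by
        rw [ENNReal.tsum_mul_left, lintegral_biUnion hucount
          (fun x _ => Metric.isClosed_closedBall.measurableSet) hdisj]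
    _ ≤ ENNReal.ofReal (10 / lam) * ∫⁻ y in Ioo (a - (b - a)) (b + (b - a)), G y := by
        gcongr
        refine iUnion₂_subset fun x hx y hy => ?_
        have hx := huE hx
        have := abs_le.1 (show |y - x| ≤ ρ x / 2 from hy)
        have := hρℓ x hx
        have := hρ0 x hx
        constructor <;> linarith [hx.1.1, hx.1.2]
    _ ≤ ENNReal.ofReal (10 / lam) * ENNReal.ofReal ((200 * L ^ 2 + 101) * τ *
          (b + (b - a) - (a - (b - a)))) := by
        gcongr
        refine lintegral_truncCauchy_le hA he (by linarith) hτ hf hfτ fun y hy => hs y fun hy' => ?_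
        exact hy ⟨by linarith [hy'.1], by linarith [hy'.2]⟩
    _ = _ := by
        rw [← ENNReal.ofReal_mul (by positivity)]
        congr 1; ring

/-- Weak-type bound for the maximal truncated Cauchy integral of bounded functions. -/
lemma volume_truncCauchy_gt_le (hA : ∀ x₁ x₂ : ℝ, |A x₁ - A x₂| ≤ L * |x₁ - x₂|)
    (hL : 0 < L) {lam : ℝ} (hab : a < b) (hτ : 0 < τ) (hlam : 0 < lam)
    (hf : Measurable f) (hfτ : ∀ x, |f x| ≤ τ) (hs : ∀ x, x ∉ Ioo a b → f x = 0) :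
    volume {x ∈ Ioo a b | ∃ δ > 0, lam < ‖truncCauchy A δ (fun y => (f y : ℂ)) x‖} ≤
      ENNReal.ofReal ((8000 * L ^ 2 + 4 * L + 4000) * τ * (b - a) / lam) := by
  have hsub := sub_pos.2 hab
  rcases le_or_gt (2 * (800 * L ^ 2 + 2 * L + 406) * τ) lam with h | h
  · set E := fun n : ℕ => {x ∈ Ioo a b | ∃ δ, 2 * (1 / ((n : ℝ) + 1)) ≤ δ ∧
      lam < ‖truncCauchy A δ (fun y => (f y : ℂ)) x‖}
    have hmono : Monotone E := fun n m hnm x hx => by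
      obtain ⟨hx, δ, h1, h2⟩ := hx
      refine ⟨hx, δ, le_trans ?_ h1, h2⟩
      gcongr
    have hE : {x ∈ Ioo a b | ∃ δ > 0, lam < ‖truncCauchy A δ (fun y => (f y : ℂ)) x‖} ⊆
        ⋃ n, E n := by
      rintro x ⟨hx, δ, h1, h2⟩
      obtain ⟨n, hn⟩ := exists_nat_one_div_lt (half_pos h1)
      exact mem_iUnion.2 ⟨n, hx, δ, by linarith, h2⟩
    refine (measure_mono hE).trans ?_
    rw [hmono.directed_le.measure_iUnion]
    refine iSup_le fun n => (volume_truncCauchy_gt_le_aux hA hL hab hτ (by positivity) h hf hfτ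
      hs).trans (ENNReal.ofReal_le_ofReal ?_)
    gcongr
    nlinarith [sq_nonneg L]
  · refine (measure_mono (sep_subset _ _)).trans ?_
    rw [Real.volume_Ioo]
    refine ENNReal.ofReal_le_ofReal ?_
    rw [le_div_iff₀ hlam]
    nlinarith [mul_pos hτ hsub, sq_nonneg L, mul_nonneg (sq_nonneg L) (mul_pos hτ hsub).le]

end

section CalderonZygmund

/-- Dyadic grid intervals are the level sets of the floor map. -/
lemma mem_dyadicIco_iff {a h x : ℝ} (hh : 0 < h) (k : ℕ) :
    x ∈ Ico (a + k * h) (a + (k + 1) * h) ↔ a ≤ x ∧ ⌊(x - a) / h⌋₊ = k := by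
  constructor
  · rintro ⟨h1, h2⟩
    have hx : a ≤ x := le_trans (by have : 0 ≤ (k : ℝ) * h := by positivity
                                    linarith) h1
    refine ⟨hx, (Nat.floor_eq_iff (div_nonneg (by linarith) hh.le)).2 ⟨?_, ?_⟩⟩
    · rw [le_div_iff₀ hh]; linarith
    · rw [div_lt_iff₀ hh]; linarith
  · rintro ⟨hx, h1⟩
    obtain ⟨h1, h2⟩ := (Nat.floor_eq_iff (div_nonneg (by linarith) hh.le)).1 h1
    rw [le_div_iff₀ hh] at h1
    rw [div_lt_iff₀ hh] at h2
    constructor <;> linarith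

lemma floor_dyadic_div {a l x : ℝ} {m n : ℕ} (hmn : m ≤ n) :
    ⌊(x - a) / (l / 2 ^ m)⌋₊ = ⌊(x - a) / (l / 2 ^ n)⌋₊ / 2 ^ (n - m) := by
  rw [← Nat.floor_div_natCast]
  congr 1
  push_cast
  obtain ⟨d, rfl⟩ := Nat.exists_eq_add_of_le hmn
  rw [Nat.add_sub_cancel_left, pow_add]
  field_simp

lemma dyadicIco_subset {a l : ℝ} (hl : 0 < l) {m n : ℕ} (hmn : m ≤ n) (k : ℕ) :
    Ico (a + k * (l / 2 ^ n)) (a + (k + 1) * (l / 2 ^ n)) ⊆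
      Ico (a + (k / 2 ^ (n - m) : ℕ) * (l / 2 ^ m))
        (a + ((k / 2 ^ (n - m) : ℕ) + 1) * (l / 2 ^ m)) := by
  intro x hx
  obtain ⟨h1, h2⟩ := (mem_dyadicIco_iff (by positivity) k).1 hx
  refine (mem_dyadicIco_iff (by positivity) _).2 ⟨h1, ?_⟩
  rw [floor_dyadic_div hmn, h2]

/-- The Calderón–Zygmund stopping intervals of a nonnegative integrable function. -/
lemma exists_calderonZygmund {v : ℝ → ℝ} {a b β : ℝ} (hab : a < b)
    (hv : Integrable v) (hv0 : ∀ x, 0 ≤ v x)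
    (h : ∫ x in Ico a b, v x ≤ β * (b - a)) :
    ∃ S : Set (ℝ × ℝ), S.Countable ∧
      (∀ q ∈ S, a ≤ q.1 ∧ q.1 < q.2 ∧ q.2 ≤ b ∧ β * (q.2 - q.1) < ∫ x in Ico q.1 q.2, v x ∧
        ∫ x in Ico q.1 q.2, v x ≤ 2 * β * (q.2 - q.1)) ∧
      S.PairwiseDisjoint (fun q => Ico q.1 q.2) ∧
      ∀ᵐ x, x ∈ Ico a b → (∀ q ∈ S, x ∉ Ico q.1 q.2) → v x ≤ β := by
  have hl : 0 < b - a := sub_pos.2 hab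
  set l := b - a with hldef
  let Q : ℕ → ℕ → Set ℝ := fun n k => Ico (a + k * (l / 2 ^ n)) (a + (k + 1) * (l / 2 ^ n))
  let P : ℕ → ℕ → Prop := fun n k => β * (l / 2 ^ n) < ∫ x in Q n k, v x
  let St : ℕ → ℕ → Prop := fun n k => k < 2 ^ n ∧ P n k ∧ ∀ m < n, ¬ P m (k / 2 ^ (n - m))
  have hpos : ∀ n : ℕ, 0 < l / 2 ^ n := fun n => by positivity
  have hP0 : ¬ P 0 0 := by
    have : Q 0 0 = Ico a b := by simp [Q, hldef]
    simp only [P, this, not_lt]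
    simpa using h
  refine ⟨(fun nk : ℕ × ℕ => (a + nk.2 * (l / 2 ^ nk.1), a + (nk.2 + 1) * (l / 2 ^ nk.1))) ''
    {nk | St nk.1 nk.2}, (to_countable _).image _, ?_, ?_, ?_⟩
  · rintro _ ⟨⟨n, k⟩, hst, rfl⟩
    obtain ⟨hk, hP, hm⟩ := (show St n k from hst)
    have hn := hpos n
    have e : a + (k + 1) * (l / 2 ^ n) - (a + k * (l / 2 ^ n)) = l / 2 ^ n := by ring
    simp only
    rw [e]
    refine ⟨?_, by linarith, ?_, hP, ?_⟩
    · have : 0 ≤ (k : ℝ) * (l / 2 ^ n) := by positivity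
      linarith
    · have hk' : (k : ℝ) + 1 ≤ 2 ^ n := by exact_mod_cast hk
      have : ((k : ℝ) + 1) * (l / 2 ^ n) ≤ 2 ^ n * (l / 2 ^ n) := by gcongr
      rw [mul_div_cancel₀ _ (by positivity)] at this
      linarith
    · rcases Nat.eq_zero_or_pos n with rfl | hn0
      · have hk0 : k = 0 := by simpa using hk
        subst hk0
        exact absurd hP hP0
      · have h1 := hm (n - 1) (by omega)
        simp only [P, not_lt] at h1
        have h2 : ∫ x in Q n k, v x ≤ ∫ x in Q (n - 1) (k / 2 ^ (n - (n - 1))), v x :=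
          setIntegral_mono_set hv.integrableOn (ae_of_all _ hv0)
            (dyadicIco_subset hl (Nat.sub_le n 1) k).eventuallyLE
        refine h2.trans (h1.trans (le_of_eq ?_))
        obtain ⟨n, rfl⟩ := Nat.exists_eq_succ_of_ne_zero hn0.ne'
        simp only [Nat.succ_eq_add_one, Nat.add_sub_cancel]
        rw [pow_succ]
        field_simp
  · rintro _ ⟨⟨n, k⟩, hst, rfl⟩ _ ⟨⟨m, j⟩, hst', rfl⟩ hne
    wlog hnm : n ≤ m generalizing n k m j
    · exact (this m j hst' n k hst hne.symm (by omega)).symm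
    refine Set.disjoint_left.2 fun x hx hx' => ?_
    obtain ⟨h1, h2⟩ := (mem_dyadicIco_iff (hpos n) k).1 hx
    obtain ⟨-, h3⟩ := (mem_dyadicIco_iff (hpos m) j).1 hx'
    rcases hnm.eq_or_lt with rfl | hlt
    · exact hne (by rw [← h2, ← h3])
    · have := hst'.2.2 n hlt
      rw [floor_dyadic_div hlt.le] at h2
      simp only [h3] at h2
      simp only [h2] at this
      exact this hst.2.1
  · filter_upwards [IsUnifLocDoublingMeasure.ae_tendsto_average (μ := volume)
      hv.locallyIntegrable 1] with x hx hxab hxS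
    have hnP : ∀ n, ¬ P n ⌊(x - a) / (l / 2 ^ n)⌋₊ := by
      intro n
      induction n using Nat.strong_induction_on with
      | _ n ih =>
        intro hP
        have hmem := (mem_dyadicIco_iff (hpos n) ⌊(x - a) / (l / 2 ^ n)⌋₊).2 ⟨hxab.1, rfl⟩
        refine hxS _ ⟨(n, ⌊(x - a) / (l / 2 ^ n)⌋₊), ⟨?_, hP, fun m hm => ?_⟩, rfl⟩ hmem
        · have : ((⌊(x - a) / (l / 2 ^ n)⌋₊ : ℕ) : ℝ) < 2 ^ n := by
            refine (Nat.floor_le (div_nonneg (by linarith [hxab.1]) (hpos n).le)).trans_lt ?_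
            rw [div_lt_iff₀ (hpos n), mul_div_cancel₀ _ (by positivity)]
            linarith [hxab.2]
          exact_mod_cast this
        · simp only
          rw [← floor_dyadic_div hm.le]
          exact ih m hm
    set w : ℕ → ℝ := fun n => a + (⌊(x - a) / (l / 2 ^ n)⌋₊ + 1 / 2) * (l / 2 ^ n)
    have hlim : Tendsto (fun n : ℕ => l / 2 ^ n / 2) atTop (nhdsWithin 0 (Ioi 0)) := by
      refine tendsto_nhdsWithin_iff.2 ⟨?_, Eventually.of_forall fun n => half_pos (hpos n)⟩
      have := (tendsto_pow_atTop_nhds_zero_of_lt_one (r := (1 / 2 : ℝ)) (by norm_num)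
        (by norm_num)).const_mul (l / 2)
      simp only [mul_zero] at this
      refine this.congr fun n => ?_
      rw [div_pow, one_pow]; ring
    have hball : ∀ n, Metric.closedBall (w n) (l / 2 ^ n / 2) =
        Icc (a + ⌊(x - a) / (l / 2 ^ n)⌋₊ * (l / 2 ^ n))
          (a + (⌊(x - a) / (l / 2 ^ n)⌋₊ + 1) * (l / 2 ^ n)) := fun n => by
      rw [Real.closedBall_eq_Icc]
      congr 1 <;> simp only [w] <;> ring
    have := hx w (fun n : ℕ => l / 2 ^ n / 2) hlim (Eventually.of_forall fun n => by
      rw [one_mul, hball]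
      exact Ico_subset_Icc_self ((mem_dyadicIco_iff (hpos n) _).2 ⟨hxab.1, rfl⟩))
    refine le_of_tendsto this (Eventually.of_forall fun n => ?_)
    rw [hball, setAverage_eq, integral_Icc_eq_integral_Ico]
    have e : volume.real (Icc (a + ⌊(x - a) / (l / 2 ^ n)⌋₊ * (l / 2 ^ n))
          (a + (⌊(x - a) / (l / 2 ^ n)⌋₊ + 1) * (l / 2 ^ n))) = l / 2 ^ n := by
      rw [Real.volume_real_Icc_of_le (by linarith [hpos n])]; ring
    rw [e, smul_eq_mul, inv_mul_le_iff₀ (hpos n), mul_comm (l / 2 ^ n) β]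
    exact not_lt.1 (hnP n)

end CalderonZygmund

section GoodBad

/-- Calderón–Zygmund decomposition into a bounded function and mean-zero atoms. -/
lemma exists_good_bad {F : ℝ → ℝ} {a b β : ℝ} (hab : a < b) (hβ : 0 < β)
    (hFm : Measurable F) (hF : Integrable F) (hs : ∀ x, x ∉ Ioo a b → F x = 0)
    (h : ∫ x, |F x| ≤ β * (b - a)) :
    ∃ (S : Set (ℝ × ℝ)) (g : ℝ → ℝ), S.Countable ∧ (∀ q ∈ S, q.1 < q.2) ∧
      S.PairwiseDisjoint (fun q => Ico q.1 q.2) ∧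
      ∑' q : S, ENNReal.ofReal (β * (q.1.2 - q.1.1)) ≤ ENNReal.ofReal (∫ x, |F x|) ∧
      Measurable g ∧ (∀ x, |g x| ≤ 2 * β) ∧ (∀ x, x ∉ Ioo a b → g x = 0) ∧
      (∀ᵐ x, (∀ q ∈ S, x ∉ Ico q.1 q.2) → F x - g x = 0) ∧
      ∀ q ∈ S, ∫ x in Ico q.1 q.2, (F x - g x) = 0 ∧
        ∫ x in Ico q.1 q.2, |F x - g x| ≤ 4 * β * (q.2 - q.1) := by
  have hFa : Integrable fun x => |F x| := hF.abs
  classical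
  obtain ⟨S, hSc, hS, hdisj, hout⟩ := exists_calderonZygmund (v := fun x => |F x|) hab hFa
    (fun x => abs_nonneg _) ((setIntegral_le_integral hFa (ae_of_all _ fun x => abs_nonneg _)).trans h)
  have := hSc.to_subtype
  have hdisj' : Pairwise (Function.onFun Disjoint fun q : S => Ico q.1.1 q.1.2) :=
    fun p q hpq => hdisj p.2 q.2 fun e => hpq (Subtype.ext e)
  set avg : ℝ × ℝ → ℝ := fun q => (∫ x in Ico q.1 q.2, F x) / (q.2 - q.1) with havg
  have havgle : ∀ q ∈ S, |avg q| ≤ 2 * β := fun q hq => by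
    obtain ⟨-, h1, -, -, h2⟩ := hS q hq
    rw [havg]; simp only
    rw [abs_div, abs_of_pos (sub_pos.2 h1), div_le_iff₀ (sub_pos.2 h1)]
    exact (abs_integral_le_integral_abs).trans h2
  set U : Set ℝ := ⋃ q : S, Ico q.1.1 q.1.2
  have hU : MeasurableSet U := MeasurableSet.iUnion fun q => measurableSet_Ico
  set G0 : ℝ → ℝ := fun x => ∑' q : S, (Ico q.1.1 q.1.2).indicator (fun _ => avg q.1) x
  have hG0m : Measurable G0 := Measurable.tsum fun q => measurable_const.indicator measurableSet_Ico
  have hG0 : ∀ q ∈ S, ∀ x ∈ Ico q.1 q.2, G0 x = avg q := fun q hq x hx => by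
    simp only [G0]
    rw [tsum_eq_single ⟨q, hq⟩, indicator_of_mem hx]
    intro q' hq'
    rw [indicator_of_notMem]
    exact fun hx' => Set.disjoint_left.1 (hdisj' hq') hx' hx
  set g : ℝ → ℝ := (Ioo a b).indicator (U.piecewise G0 fun x => max (-β) (min β (F x)))
  have hgm : Measurable g := (Measurable.piecewise hU hG0m (by fun_prop)).indicator measurableSet_Ioo
  have hgle : ∀ x, |g x| ≤ 2 * β := fun x => by
    by_cases hx : x ∈ Ioo a b
    · simp only [g, indicator_of_mem hx]
      by_cases hxU : x ∈ U
      · rw [Set.piecewise_eq_of_mem _ _ _ hxU]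
        obtain ⟨q, hq⟩ := mem_iUnion.1 hxU
        rw [hG0 q.1 q.2 x hq]; exact havgle q.1 q.2
      · rw [Set.piecewise_eq_of_notMem _ _ _ hxU, abs_le]
        constructor
        · linarith [le_max_left (-β) (min β (F x))]
        · exact max_le (by linarith) ((min_le_left _ _).trans (by linarith))
    · simp only [g, indicator_of_notMem hx, abs_zero]; positivity
  have hgi : ∀ q : ℝ × ℝ, IntegrableOn g (Ico q.1 q.2) := fun q =>
    Measure.integrableOn_of_bounded (M := 2 * β) (by simp) hgm.aestronglyMeasurable
      (ae_of_all _ hgle)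
  have hgq : ∀ q ∈ S, ∀ᵐ x ∂volume.restrict (Ico q.1 q.2), g x = avg q := fun q hq => by
    rw [ae_restrict_iff' measurableSet_Ico]
    have : ∀ᵐ x : ℝ, x ≠ a := by simp [ae_iff]
    filter_upwards [this] with x hxa hx
    obtain ⟨h1, h2, h3, -⟩ := hS q hq
    have hxI : x ∈ Ioo a b := ⟨lt_of_le_of_ne (h1.trans hx.1) (Ne.symm hxa), hx.2.trans_le h3⟩
    simp only [g, indicator_of_mem hxI]
    rw [Set.piecewise_eq_of_mem _ _ _ (mem_iUnion.2 ⟨⟨q, hq⟩, hx⟩), hG0 q hq x hx]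
  refine ⟨S, g, hSc, fun q hq => (hS q hq).2.1, hdisj, ?_, hgm, hgle,
    fun x hx => indicator_of_notMem hx _, ?_, fun q hq => ⟨?_, ?_⟩⟩
  · calc ∑' q : S, ENNReal.ofReal (β * (q.1.2 - q.1.1))
        ≤ ∑' q : S, ∫⁻ x in Ico q.1.1 q.1.2, ENNReal.ofReal |F x| := by
          refine ENNReal.tsum_le_tsum fun q => ?_
          rw [← ofReal_integral_eq_lintegral_ofReal hFa.integrableOn
            (ae_of_all _ fun x => abs_nonneg _)]
          exact ENNReal.ofReal_le_ofReal (hS q.1 q.2).2.2.2.1.le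
      _ = ∫⁻ x in U, ENNReal.ofReal |F x| :=
          (lintegral_iUnion (fun q => measurableSet_Ico) hdisj' _).symm
      _ ≤ ∫⁻ x, ENNReal.ofReal |F x| := setLIntegral_le_lintegral _ _
      _ = _ := (ofReal_integral_eq_lintegral_ofReal hFa (ae_of_all _ fun x => abs_nonneg _)).symm
  · filter_upwards [hout] with x hx hxS
    by_cases hxI : x ∈ Ioo a b
    · have hxU : x ∉ U := fun h => by
        obtain ⟨q, hq⟩ := mem_iUnion.1 h
        exact hxS q.1 q.2 hq
      have := abs_le.1 (hx ⟨hxI.1.le, hxI.2⟩ hxS)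
      simp only [g, indicator_of_mem hxI]
      rw [Set.piecewise_eq_of_notMem _ _ _ hxU, min_eq_right this.2, max_eq_right this.1, sub_self]
    · simp only [g, indicator_of_notMem hxI, hs x hxI, sub_self]
  · have h1 := sub_pos.2 (hS q hq).2.1
    rw [integral_sub hF.integrableOn (hgi q), integral_congr_ae (hgq q hq)]
    simp only [integral_const, smul_eq_mul, measureReal_restrict_apply_univ]
    rw [Real.volume_real_Ico_of_le (by linarith)]
    simp only [havg]
    field_simp
    ring
  · obtain ⟨-, h1, -, -, h2⟩ := hS q hq
    calc ∫ x in Ico q.1 q.2, |F x - g x| ≤ ∫ x in Ico q.1 q.2, (|F x| + 2 * β) := by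
          refine integral_mono (hF.integrableOn.sub (hgi q)).abs
            (hFa.integrableOn.add (integrable_const _)) fun x => ?_
          exact (abs_sub _ _).trans (by linarith [hgle x])
      _ = (∫ x in Ico q.1 q.2, |F x|) + 2 * β * (q.2 - q.1) := by
          rw [integral_add hFa.integrableOn (integrable_const _)]
          simp only [integral_const, smul_eq_mul, measureReal_restrict_apply_univ]
          rw [Real.volume_real_Ico_of_le h1.le]; ring
      _ ≤ _ := by linarith

variable {A : ℝ → ℝ} {L : ℝ}

/-- Truncated Cauchy integral of a mean-zero atom away from its support. -/
lemma enorm_setIntegral_truncKernel_le (hA : ∀ x₁ x₂ : ℝ, |A x₁ - A x₂| ≤ L * |x₁ - x₂|)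
    (hL : 0 < L) {u v δ B x : ℝ} (huv : u < v) (hδ : 0 < δ) {h : ℝ → ℝ}
    (hh : IntegrableOn h (Ico u v)) (h0 : ∫ y in Ico u v, h y = 0)
    (hB : ∫ y in Ico u v, |h y| ≤ B) (hx : v - u < |x - (u + v) / 2|) :
    ‖∫ y in Ico u v, truncKernel A δ x y * (h y : ℂ)‖ₑ ≤
      ENNReal.ofReal ((1 + L) * B * (v - u) * (1 / (x - (u + v) / 2) ^ 2)) +
        ENNReal.ofReal (B / (δ * (v - u))) *
          volume (Ico u v ∩ Metric.closedBall x (3 * δ)) := by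
  have hB0 : 0 ≤ B := le_trans (integral_nonneg fun y => abs_nonneg _) hB
  have hl := sub_pos.2 huv
  set c := (u + v) / 2 with hc
  have hAm : Measurable A := (continuous_of_lipBound hA).measurable
  have hhC : IntegrableOn (fun y => (h y : ℂ)) (Ico u v) := hh.ofReal
  have hnear : ∀ y ∈ Ico u v, |y - c| ≤ (v - u) / 2 := fun y hy =>
    abs_le.2 ⟨by linarith [hy.1], by linarith [hy.2]⟩
  have hfar : ∀ y ∈ Ico u v, |x - c| / 2 ≤ |y - x| := fun y hy => by
    have := abs_sub_le x y c
    rw [abs_sub_comm x y] at this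
    linarith [hnear y hy]
  have hxc : 0 < |x - c| := hl.trans hx
  by_cases hall : ∀ y ∈ Ico u v, δ < |y - x|
  · refine le_trans ?_ le_self_add
    rw [← ofReal_norm]
    refine ENNReal.ofReal_le_ofReal ?_
    have e1 : ∫ y in Ico u v, truncKernel A δ x y * (h y : ℂ) =
        ∫ y in Ico u v, (truncKernel A δ x y * (h y : ℂ) - cauchyKernel A x c * (h y : ℂ)) := by
      rw [integral_sub (integrable_truncKernel_mul hAm hδ hhC x) (hhC.const_mul _),
        integral_const_mul, integral_complex_ofReal, h0]
      simp
    rw [e1]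
    have h1 : ‖∫ y in Ico u v, (truncKernel A δ x y * (h y : ℂ) - cauchyKernel A x c * (h y : ℂ))‖ ≤
        ∫ y in Ico u v, (1 + L) * (v - u) * (1 / (x - c) ^ 2) * |h y| := by
      refine norm_integral_le_of_norm_le (hh.abs.const_mul _) ?_
      rw [ae_restrict_iff' measurableSet_Ico]
      refine ae_of_all _ fun y hy => ?_
      have hyx := hδ.trans (hall y hy)
      rw [← sub_mul, norm_mul, Complex.norm_real, Real.norm_eq_abs]
      refine mul_le_mul_of_nonneg_right ?_ (abs_nonneg _)
      simp only [truncKernel, if_pos (hall y hy)]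
      have hcx : c ≠ x := fun e => by simp [e] at hxc
      refine (norm_cauchyKernel_sub_le hA hL (sub_ne_zero.1 (abs_pos.1 hyx)) hcx).trans ?_
      rw [mul_one_div, ← sq_abs (x - c), abs_sub_comm c x]
      calc (1 + L) * |y - c| / (|y - x| * |x - c|)
          ≤ (1 + L) * ((v - u) / 2) / (|x - c| / 2 * |x - c|) := by
            gcongr
            · exact hnear y hy
            · exact hfar y hy
        _ = _ := by field_simp
    refine h1.trans ?_
    rw [integral_const_mul]
    calc _ ≤ (1 + L) * (v - u) * (1 / (x - c) ^ 2) * B := by gcongr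
      _ = _ := by ring
  push Not at hall
  obtain ⟨y1, hy1, hy1δ⟩ := hall
  by_cases hall' : ∀ y ∈ Ico u v, |y - x| ≤ δ
  · rw [setIntegral_congr_fun (g := fun _ => (0 : ℂ)) measurableSet_Ico fun y hy => by
      simp [truncKernel, not_lt.2 (hall' y hy)]]
    simp
  push Not at hall'
  obtain ⟨y2, hy2, hy2δ⟩ := hall'
  refine le_trans ?_ le_add_self
  have hlδ : v - u ≤ 2 * δ := by linarith [hfar y1 hy1]
  have hsub : Ico u v ⊆ Metric.closedBall x (3 * δ) := fun y hy => by
    rw [Metric.mem_closedBall, Real.dist_eq]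
    have h1 := abs_sub_le y y1 x
    have h2 : |y - y1| ≤ v - u := abs_le.2 ⟨by linarith [hy.1, hy1.2], by linarith [hy.2, hy1.1]⟩
    linarith
  rw [inter_eq_left.2 hsub, Real.volume_Ico, ← ENNReal.ofReal_mul (by positivity), ← ofReal_norm]
  refine ENNReal.ofReal_le_ofReal ?_
  have h1 : ‖∫ y in Ico u v, truncKernel A δ x y * (h y : ℂ)‖ ≤
      ∫ y in Ico u v, δ⁻¹ * |h y| := by
    refine norm_integral_le_of_norm_le (hh.abs.const_mul _) (ae_of_all _ fun y => ?_)
    rw [norm_mul, Complex.norm_real, Real.norm_eq_abs]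
    exact mul_le_mul_of_nonneg_right (norm_truncKernel_le hδ x y) (abs_nonneg _)
  refine h1.trans ?_
  rw [integral_const_mul]
  calc _ ≤ δ⁻¹ * B := by gcongr
    _ = _ := by field_simp

end GoodBad

section WeakType

variable {A F : ℝ → ℝ} {L a b β : ℝ}

lemma truncCauchy_add (hA : Measurable A) {δ : ℝ} (hδ : 0 < δ) {G H : ℝ → ℂ}
    (hG : Integrable G) (hH : Integrable H) (x : ℝ) :
    truncCauchy A δ (fun y => G y + H y) x = truncCauchy A δ G x + truncCauchy A δ H x := by
  unfold truncCauchy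
  rw [← integral_add (integrable_truncKernel_mul hA hδ hG x)
    (integrable_truncKernel_mul hA hδ hH x)]
  simp only [mul_add]

lemma truncCauchy_const_mul {δ : ℝ} (c : ℂ) (G : ℝ → ℂ) (x : ℝ) :
    truncCauchy A δ (fun y => c * G y) x = c * truncCauchy A δ G x := by
  unfold truncCauchy
  rw [← integral_const_mul]
  congr 1
  ext y
  ring

/-- Weak-type estimate for the maximal truncated Cauchy integral of integrable functions. -/
lemma volume_truncCauchy_gt_le_of_integrable
    (hA : ∀ x₁ x₂ : ℝ, |A x₁ - A x₂| ≤ L * |x₁ - x₂|) (hL : 0 < L) {lam : ℝ} (hab : a < b)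
    (hβ : 0 < β) (hlam : 72 * β ≤ lam) (hFm : Measurable F) (hF : Integrable F)
    (hs : ∀ x, x ∉ Ioo a b → F x = 0) (hI : ∫ x, |F x| ≤ β * (b - a)) :
    volume {x ∈ Ioo a b | ∃ δ > 0, lam < ‖truncCauchy A δ (fun y => (F y : ℂ)) x‖} ≤
      ENNReal.ofReal (6 * (8000 * L ^ 2 + 4 * L + 4000) * β * (b - a) / lam +
        (3 + L) * (∫ x, |F x|) / β) := by
  have hlam0 : 0 < lam := by linarith
  obtain ⟨S, g, hSc, hlt, hdisj, hsum, hgm, hgle, hgs, hout, hat⟩ :=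
    exists_good_bad hab hβ hFm hF hs hI
  have := hSc.to_subtype
  have hdisj' : Pairwise (Function.onFun Disjoint fun q : S => Ico q.1.1 q.1.2) :=
    fun p q hpq => hdisj p.2 q.2 fun e => hpq (Subtype.ext e)
  have hAm : Measurable A := (continuous_of_lipBound hA).measurable
  have hgi : Integrable (fun x => (g x : ℂ)) := integrable_of_bound_of_support hgm hgle hgs
  have hgr : Integrable g := by simpa using hgi.re
  set M : ℝ → ℝ≥0∞ := fun x => ∑' q : S,
    {x : ℝ | q.1.2 - q.1.1 < |x - (q.1.1 + q.1.2) / 2|}.indicator (fun x =>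
      ENNReal.ofReal ((1 + L) * (4 * β * (q.1.2 - q.1.1)) * (q.1.2 - q.1.1)) *
        ENNReal.ofReal (1 / (x - (q.1.1 + q.1.2) / 2) ^ 2)) x with hM
  have hmeas : ∀ q : S, MeasurableSet {x : ℝ | q.1.2 - q.1.1 < |x - (q.1.1 + q.1.2) / 2|} :=
    fun q => measurableSet_lt measurable_const (by fun_prop)
  have hind : ∀ q : S, Measurable ({x : ℝ | q.1.2 - q.1.1 < |x - (q.1.1 + q.1.2) / 2|}.indicator
      (fun x => ENNReal.ofReal ((1 + L) * (4 * β * (q.1.2 - q.1.1)) * (q.1.2 - q.1.1)) *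
        ENNReal.ofReal (1 / (x - (q.1.1 + q.1.2) / 2) ^ 2))) :=
    fun q => (by fun_prop : Measurable _).indicator (hmeas q)
  have hMm : Measurable M := Measurable.tsum hind
  have hMint : ∫⁻ x, M x ≤ ENNReal.ofReal (8 * (1 + L) * ∫ x, |F x|) := by
    simp only [hM]
    rw [lintegral_tsum fun q => (hind q).aemeasurable]
    calc _ ≤ ∑' q : S, ENNReal.ofReal (8 * (1 + L)) *
          ENNReal.ofReal (β * (q.1.2 - q.1.1)) := by
          refine ENNReal.tsum_le_tsum fun q => ?_
          have hl := sub_pos.2 (hlt q.1 q.2)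
          rw [lintegral_indicator (hmeas q), lintegral_const_mul' _ _ ENNReal.ofReal_ne_top]
          refine (mul_le_mul_right (lintegral_inv_sq_le hl _) _).trans (le_of_eq ?_)
          rw [← ENNReal.ofReal_mul (by positivity), ← ENNReal.ofReal_mul (by positivity)]
          congr 1
          field_simp
          ring
      _ ≤ _ := by
          rw [ENNReal.tsum_mul_left, ENNReal.ofReal_mul (p := 8 * (1 + L)) (by positivity)]
          exact mul_le_mul_right hsum _
  have hbad : ∀ x, (∀ q : S, q.1.2 - q.1.1 < |x - (q.1.1 + q.1.2) / 2|) → ∀ δ > 0,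
      ‖truncCauchy A δ (fun y => ((F y - g y : ℝ) : ℂ)) x‖ₑ ≤ M x + ENNReal.ofReal (24 * β) := by
    intro x hx δ hδ
    have hhi : Integrable (fun y => ((F y - g y : ℝ) : ℂ)) := (hF.sub hgr).ofReal
    have e : truncCauchy A δ (fun y => ((F y - g y : ℝ) : ℂ)) x =
        ∑' q : S, ∫ y in Ico q.1.1 q.1.2, truncKernel A δ x y * ((F y - g y : ℝ) : ℂ) := by
      rw [← integral_iUnion (fun q => measurableSet_Ico) hdisj'
        (integrable_truncKernel_mul hAm hδ hhi x).integrableOn]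
      refine (setIntegral_eq_integral_of_ae_compl_eq_zero ?_).symm
      filter_upwards [hout] with y hy hyU
      rw [hy fun q hq hyq => hyU (mem_iUnion.2 ⟨⟨q, hq⟩, hyq⟩)]
      simp
    rw [e]
    refine enorm_tsum_le_tsum_enorm.trans ?_
    calc _ ≤ ∑' q : S, (ENNReal.ofReal ((1 + L) * (4 * β * (q.1.2 - q.1.1)) * (q.1.2 - q.1.1)) *
            ENNReal.ofReal (1 / (x - (q.1.1 + q.1.2) / 2) ^ 2) +
          ENNReal.ofReal (4 * β / δ) *
            volume (Ico q.1.1 q.1.2 ∩ Metric.closedBall x (3 * δ))) := by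
          refine ENNReal.tsum_le_tsum fun q => ?_
          have hl := sub_pos.2 (hlt q.1 q.2)
          refine (enorm_setIntegral_truncKernel_le hA hL (hlt q.1 q.2) hδ
            (hF.sub hgr).integrableOn (hat q.1 q.2).1 (hat q.1 q.2).2 (hx q)).trans (le_of_eq ?_)
          rw [← ENNReal.ofReal_mul (by positivity)]
          congr 3
          field_simp
      _ = M x + ENNReal.ofReal (4 * β / δ) *
            volume (⋃ q : S, Ico q.1.1 q.1.2 ∩ Metric.closedBall x (3 * δ)) := by
          rw [ENNReal.tsum_add, ENNReal.tsum_mul_left, measure_iUnion]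
          · congr 1
            simp only [hM]
            congr 1
            ext q
            simp only [Set.indicator]
            exact (if_pos (hx q)).symm
          · exact fun p q hpq => (hdisj' hpq).mono inter_subset_left inter_subset_left
          · exact fun q => measurableSet_Ico.inter Metric.isClosed_closedBall.measurableSet
      _ ≤ M x + ENNReal.ofReal (4 * β / δ) * volume (Metric.closedBall x (3 * δ)) := by
          gcongr
          exact iUnion_subset fun q => inter_subset_right
      _ = _ := by
          rw [Real.volume_closedBall, ← ENNReal.ofReal_mul (by positivity)]
          congr 2
          field_simp
          norm_num
  have hsub : {x ∈ Ioo a b | ∃ δ > 0, lam < ‖truncCauchy A δ (fun y => (F y : ℂ)) x‖} ⊆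
      ({x ∈ Ioo a b | ∃ δ > 0, lam / 3 < ‖truncCauchy A δ (fun y => (g y : ℂ)) x‖} ∪
        ⋃ q : S, Metric.closedBall ((q.1.1 + q.1.2) / 2) (q.1.2 - q.1.1)) ∪
        {x | ENNReal.ofReal (lam / 3) ≤ M x} := by
    rintro x ⟨hxI, δ, hδ, hx⟩
    by_contra hnot
    simp only [mem_union, not_or] at hnot
    obtain ⟨⟨h1, h2⟩, h3⟩ := hnot
    have h1 : ‖truncCauchy A δ (fun y => (g y : ℂ)) x‖ ≤ lam / 3 := by
      by_contra hc
      exact h1 ⟨hxI, δ, hδ, not_le.1 hc⟩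
    have h2 : ∀ q : S, q.1.2 - q.1.1 < |x - (q.1.1 + q.1.2) / 2| := fun q => by
      by_contra hc
      exact h2 (mem_iUnion.2 ⟨q, by rw [Metric.mem_closedBall, Real.dist_eq]; exact not_lt.1 hc⟩)
    have h3 : M x < ENNReal.ofReal (lam / 3) := not_le.1 h3
    have h4 := hbad x h2 δ hδ
    have e : truncCauchy A δ (fun y => (F y : ℂ)) x = truncCauchy A δ (fun y => (g y : ℂ)) x +
        truncCauchy A δ (fun y => ((F y - g y : ℝ) : ℂ)) x := by
      rw [← truncCauchy_add (H := fun y => ((F y - g y : ℝ) : ℂ)) hAm hδ hgi (hF.sub hgr).ofReal]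
      congr 1
      ext y
      simp
    have h5 : 2 * (lam / 3) < ‖truncCauchy A δ (fun y => ((F y - g y : ℝ) : ℂ)) x‖ := by
      have := norm_add_le (truncCauchy A δ (fun y => (g y : ℂ)) x)
        (truncCauchy A δ (fun y => ((F y - g y : ℝ) : ℂ)) x)
      rw [← e] at this
      linarith
    have h6 : ENNReal.ofReal (2 * (lam / 3)) <
        ENNReal.ofReal (lam / 3) + ENNReal.ofReal (24 * β) := by
      refine lt_of_le_of_lt ((ENNReal.ofReal_le_ofReal h5.le).trans ?_)
        (ENNReal.add_lt_add_right ENNReal.ofReal_ne_top h3)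
      rw [ofReal_norm]
      exact h4
    rw [← ENNReal.ofReal_add (by positivity) (by positivity)] at h6
    have := (ENNReal.ofReal_lt_ofReal_iff (by positivity)).1 h6
    linarith
  refine (measure_mono hsub).trans ((measure_union_le _ _).trans (add_le_add_left
    (measure_union_le _ _) _ |>.trans ?_))
  have b1 := volume_truncCauchy_gt_le (f := g) hA hL hab (τ := 2 * β) (lam := lam / 3)
    (by positivity) (by positivity) hgm hgle hgs
  have b2 : volume (⋃ q : S, Metric.closedBall ((q.1.1 + q.1.2) / 2) (q.1.2 - q.1.1)) ≤
      ENNReal.ofReal (2 / β * ∫ x, |F x|) := by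
    refine (measure_iUnion_le _).trans ?_
    rw [ENNReal.ofReal_mul (by positivity)]
    refine le_trans (le_of_eq ?_) (mul_le_mul_right hsum _)
    rw [← ENNReal.tsum_mul_left]
    congr 1
    ext q
    rw [Real.volume_closedBall, ← ENNReal.ofReal_mul (by positivity)]
    congr 1
    field_simp
  have b3 : volume {x | ENNReal.ofReal (lam / 3) ≤ M x} ≤
      ENNReal.ofReal (8 * (1 + L) * (∫ x, |F x|) / (lam / 3)) := by
    rw [ENNReal.ofReal_div_of_pos (y := lam / 3) (by positivity)]
    refine (meas_ge_le_lintegral_div hMm.aemeasurable ?_ ENNReal.ofReal_ne_top).trans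
      (ENNReal.div_le_div_right hMint _)
    rw [Ne, ENNReal.ofReal_eq_zero, not_le]
    positivity
  refine (add_le_add (add_le_add b1 b2) b3).trans ?_
  have hba := sub_pos.2 hab
  rw [← ENNReal.ofReal_add (by positivity) (by positivity),
    ← ENNReal.ofReal_add (by positivity) (by positivity)]
  refine ENNReal.ofReal_le_ofReal ?_
  have e3 : 8 * (1 + L) * (∫ x, |F x|) / (lam / 3) ≤ (1 + L) / 3 * (∫ x, |F x|) / β := by
    rw [div_le_div_iff₀ (by positivity) hβ]
    have : 0 ≤ (1 + L) * (∫ x, |F x|) := by positivity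
    nlinarith
  have e1 : (8000 * L ^ 2 + 4 * L + 4000) * (2 * β) * (b - a) / (lam / 3) =
    6 * (8000 * L ^ 2 + 4 * L + 4000) * β * (b - a) / lam := by field_simp; ring
  have e4 : (3 + L) * (∫ x, |F x|) / β = 2 / β * (∫ x, |F x|) + (1 + L) * (∫ x, |F x|) / β := by
    field_simp; ring
  have e5 : (1 + L) / 3 * (∫ x, |F x|) / β ≤ (1 + L) * (∫ x, |F x|) / β := by
    gcongr; linarith
  rw [e1, e4]
  linarith

end WeakType

section Closure

variable {A : ℝ → ℝ} {L a b : ℝ}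

/-- The maximal truncated Cauchy integral of a real function is small in measure when the
function is small in `L¹`. -/
lemma exists_volume_truncCauchy_gt_le_real
    (hA : ∀ x₁ x₂ : ℝ, |A x₁ - A x₂| ≤ L * |x₁ - x₂|) (hL : 0 < L) (hab : a < b)
    {lam η : ℝ} (hlam : 0 < lam) (hη : 0 < η) :
    ∃ θ > 0, ∀ F : ℝ → ℝ, Measurable F → Integrable F → (∀ x, x ∉ Ioo a b → F x = 0) →
      ∫ x, |F x| ≤ θ →
      volume {x ∈ Ioo a b | ∃ δ > 0, lam < ‖truncCauchy A δ (fun y => (F y : ℂ)) x‖} ≤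
        ENNReal.ofReal η := by
  have hba := sub_pos.2 hab
  set C := 6 * (8000 * L ^ 2 + 4 * L + 4000) with hC
  set β := min (lam / 72) (η / 2 * lam / (C * (b - a)))
  have hβ : 0 < β := by positivity
  have hβ1 : β ≤ lam / 72 := min_le_left _ _
  have hβ2 : β ≤ η / 2 * lam / (C * (b - a)) := min_le_right _ _
  refine ⟨min (β * (b - a)) (η / 2 * β / (3 + L)), by positivity, fun F hFm hF hs hI => ?_⟩
  refine (volume_truncCauchy_gt_le_of_integrable hA hL hab hβ (by linarith) hFm hF hs
    (hI.trans (min_le_left _ _))).trans (ENNReal.ofReal_le_ofReal ?_)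
  rw [← hC]
  have h1 : C * β * (b - a) / lam ≤ η / 2 := by
    rw [le_div_iff₀ (by positivity)] at hβ2
    rw [div_le_iff₀ hlam]
    linarith
  have h2 : (3 + L) * (∫ x, |F x|) / β ≤ η / 2 := by
    have := hI.trans (min_le_right _ _)
    rw [le_div_iff₀ (by positivity)] at this
    rw [div_le_iff₀ hβ]
    linarith
  linarith

lemma exists_volume_truncCauchy_gt_le
    (hA : ∀ x₁ x₂ : ℝ, |A x₁ - A x₂| ≤ L * |x₁ - x₂|) (hL : 0 < L) (hab : a < b)
    {lam η : ℝ} (hlam : 0 < lam) (hη : 0 < η) :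
    ∃ θ > 0, ∀ F : ℝ → ℂ, Measurable F → Integrable F → (∀ x, x ∉ Ioo a b → F x = 0) →
      ∫ x, ‖F x‖ ≤ θ →
      volume {x ∈ Ioo a b | ∃ δ > 0, lam < ‖truncCauchy A δ F x‖} ≤ ENNReal.ofReal η := by
  obtain ⟨θ, hθ, h⟩ := exists_volume_truncCauchy_gt_le_real hA hL hab (half_pos hlam) (half_pos hη)
  refine ⟨θ, hθ, fun F hFm hF hs hI => ?_⟩
  have hAm : Measurable A := (continuous_of_lipBound hA).measurable
  have h1 := h (fun x => (F x).re) (Complex.measurable_re.comp hFm) hF.re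
    (fun x hx => by simp [hs x hx])
    ((integral_mono hF.re.abs hF.norm fun x => Complex.abs_re_le_norm _).trans hI)
  have h2 := h (fun x => (F x).im) (Complex.measurable_im.comp hFm) hF.im
    (fun x hx => by simp [hs x hx])
    ((integral_mono hF.im.abs hF.norm fun x => Complex.abs_im_le_norm _).trans hI)
  have hsub : {x ∈ Ioo a b | ∃ δ > 0, lam < ‖truncCauchy A δ F x‖} ⊆
      {x ∈ Ioo a b | ∃ δ > 0, lam / 2 < ‖truncCauchy A δ (fun y => ((F y).re : ℂ)) x‖} ∪
      {x ∈ Ioo a b | ∃ δ > 0, lam / 2 < ‖truncCauchy A δ (fun y => ((F y).im : ℂ)) x‖} := by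
    rintro x ⟨hx, δ, hδ, hlt⟩
    have e : truncCauchy A δ F x = truncCauchy A δ (fun y => ((F y).re : ℂ)) x +
        Complex.I * truncCauchy A δ (fun y => ((F y).im : ℂ)) x := by
      rw [← truncCauchy_const_mul, ← truncCauchy_add (G := fun y => ((F y).re : ℂ))
        (H := fun y => Complex.I * ((F y).im : ℂ)) hAm hδ hF.re.ofReal
        (hF.im.ofReal.const_mul _)]
      congr 1
      ext y
      conv_lhs => rw [← Complex.re_add_im (F y), mul_comm]
    by_contra hnot
    simp only [mem_union, not_or] at hnot
    have k1 : ‖truncCauchy A δ (fun y => ((F y).re : ℂ)) x‖ ≤ lam / 2 :=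
      not_lt.1 fun hc => hnot.1 ⟨hx, δ, hδ, hc⟩
    have k2 : ‖truncCauchy A δ (fun y => ((F y).im : ℂ)) x‖ ≤ lam / 2 :=
      not_lt.1 fun hc => hnot.2 ⟨hx, δ, hδ, hc⟩
    have := norm_add_le (truncCauchy A δ (fun y => ((F y).re : ℂ)) x)
      (Complex.I * truncCauchy A δ (fun y => ((F y).im : ℂ)) x)
    rw [← e, norm_mul, Complex.norm_I, one_mul] at this
    linarith
  refine (measure_mono hsub).trans ((measure_union_le _ _).trans ((add_le_add h1 h2).trans ?_))
  rw [← ENNReal.ofReal_add (by positivity) (by positivity), add_halves]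

/-- Almost everywhere existence of principal values passes to `L¹` limits. -/
lemma ae_tendsto_truncCauchy_of_approx
    (hA : ∀ x₁ x₂ : ℝ, |A x₁ - A x₂| ≤ L * |x₁ - x₂|) (hL : 0 < L) (hab : a < b)
    {F : ℝ → ℂ} (hFm : Measurable F) (hF : Integrable F) (hs : ∀ x, x ∉ Ioo a b → F x = 0)
    (happ : ∀ θ > 0, ∃ G : ℝ → ℂ, Measurable G ∧ Integrable G ∧ (∀ x, x ∉ Ioo a b → G x = 0) ∧
      (∫ x, ‖F x - G x‖ ≤ θ) ∧ ∀ᵐ x, x ∈ Ioo a b →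
        ∃ u, Tendsto (fun δ => truncCauchy A δ G x) (nhdsWithin 0 (Ioi 0)) (nhds u)) :
    ∀ᵐ x, x ∈ Ioo a b →
      ∃ u, Tendsto (fun δ => truncCauchy A δ F x) (nhdsWithin 0 (Ioi 0)) (nhds u) := by
  have hAm : Measurable A := (continuous_of_lipBound hA).measurable
  have key : ∀ n : ℕ, ∀ᵐ x, x ∈ Ioo a b → ∃ t ∈ nhdsWithin (0 : ℝ) (Ioi 0), ∀ δ ∈ t, ∀ δ' ∈ t,
      ‖truncCauchy A δ F x - truncCauchy A δ' F x‖ < 3 * (1 / ((n : ℝ) + 1)) := by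
    intro n
    set lam : ℝ := 1 / ((n : ℝ) + 1)
    have hlam : 0 < lam := by positivity
    rw [ae_iff]
    refine le_antisymm (ENNReal.le_of_forall_pos_le_add fun η hη _ => ?_) zero_le
    rw [zero_add]
    obtain ⟨θ, hθ, h⟩ := exists_volume_truncCauchy_gt_le hA hL hab hlam (NNReal.coe_pos.2 hη)
    obtain ⟨G, hGm, hG, hGs, hFG, hGpv⟩ := happ θ hθ
    have h1 := h (fun x => F x - G x) (hFm.sub hGm) (hF.sub hG)
      (fun x hx => by simp [hs x hx, hGs x hx]) hFG
    rw [ENNReal.ofReal_coe_nnreal] at h1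
    refine le_trans (measure_mono_ae ?_) h1
    filter_upwards [hGpv] with x hx hbad
    change ¬ _ at hbad
    push Not at hbad
    obtain ⟨hxI, hbad⟩ := hbad
    refine ⟨hxI, ?_⟩
    by_contra hsmall
    push Not at hsmall
    obtain ⟨u, hu⟩ := hx hxI
    have hev := Metric.tendsto_nhds.1 hu (lam / 2) (half_pos hlam)
    obtain ⟨δ, hδ, δ', hδ', hge⟩ := hbad _ (inter_mem hev self_mem_nhdsWithin)
    have e : ∀ δ > 0, truncCauchy A δ F x = truncCauchy A δ G x +
        truncCauchy A δ (fun y => F y - G y) x := fun δ hδ => by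
      rw [← truncCauchy_add (H := fun y => F y - G y) hAm hδ hG (hF.sub hG)]
      congr 1
      ext y
      ring
    rw [e δ hδ.2, e δ' hδ'.2] at hge
    have d1 : ‖truncCauchy A δ G x - u‖ < lam / 2 := by rw [← dist_eq_norm]; exact hδ.1
    have d2 : ‖truncCauchy A δ' G x - u‖ < lam / 2 := by rw [← dist_eq_norm]; exact hδ'.1
    have d3 := hsmall δ hδ.2
    have d4 := hsmall δ' hδ'.2
    have : truncCauchy A δ G x + truncCauchy A δ (fun y => F y - G y) x -
        (truncCauchy A δ' G x + truncCauchy A δ' (fun y => F y - G y) x) =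
        ((truncCauchy A δ G x - u) - (truncCauchy A δ' G x - u)) +
        (truncCauchy A δ (fun y => F y - G y) x - truncCauchy A δ' (fun y => F y - G y) x) := by
      ring
    rw [this] at hge
    have t1 := norm_add_le ((truncCauchy A δ G x - u) - (truncCauchy A δ' G x - u))
      (truncCauchy A δ (fun y => F y - G y) x - truncCauchy A δ' (fun y => F y - G y) x)
    have t2 := norm_sub_le (truncCauchy A δ G x - u) (truncCauchy A δ' G x - u)
    have t3 := norm_sub_le (truncCauchy A δ (fun y => F y - G y) x)
      (truncCauchy A δ' (fun y => F y - G y) x)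
    linarith
  filter_upwards [ae_all_iff.2 key] with x hx hxI
  refine cauchy_map_iff_exists_tendsto.1 (Metric.cauchy_iff.2 ⟨inferInstance, fun ε hε => ?_⟩)
  obtain ⟨n, hn⟩ := exists_nat_one_div_lt (show 0 < ε / 3 by positivity)
  obtain ⟨t, ht, htn⟩ := hx n hxI
  refine ⟨_, image_mem_map ht, ?_⟩
  rintro _ ⟨δ, hδ, rfl⟩ _ ⟨δ', hδ', rfl⟩
  rw [dist_eq_norm]
  exact (htn δ hδ δ' hδ').trans (by linarith)

end Closure

section Smooth

variable {A : ℝ → ℝ} {L a b : ℝ}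

/-- The derivative of `graphPt A`. -/
noncomputable def graphSlope (A : ℝ → ℝ) (x : ℝ) : ℂ := 1 + Complex.I * ((deriv A x : ℝ) : ℂ)

lemma graphSlope_re (x : ℝ) : (graphSlope A x).re = 1 := by simp [graphSlope]

lemma one_le_norm_graphSlope (x : ℝ) : 1 ≤ ‖graphSlope A x‖ := by
  have := Complex.abs_re_le_norm (graphSlope A x)
  rwa [graphSlope_re, abs_one] at this

lemma lipschitzWith_of_lipBound (hA : ∀ x₁ x₂ : ℝ, |A x₁ - A x₂| ≤ L * |x₁ - x₂|) (hL : 0 < L) :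
    LipschitzWith ⟨L, hL.le⟩ A :=
  LipschitzWith.of_dist_le_mul fun x y => by
    rw [Real.dist_eq, Real.dist_eq]; exact hA x y

lemma norm_graphSlope_le (hA : ∀ x₁ x₂ : ℝ, |A x₁ - A x₂| ≤ L * |x₁ - x₂|) (hL : 0 < L) (x : ℝ) :
    ‖graphSlope A x‖ ≤ 1 + L := by
  unfold graphSlope
  refine (norm_add_le _ _).trans ?_
  rw [norm_one, norm_mul, Complex.norm_I, one_mul, Complex.norm_real]
  have := norm_deriv_le_of_lipschitz (x₀ := x) (lipschitzWith_of_lipBound hA hL)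
  gcongr
  exact this

lemma measurable_graphSlope : Measurable (graphSlope A) := by
  unfold graphSlope
  have := measurable_deriv A
  fun_prop

lemma hasDerivAt_graphPt {x : ℝ} (h : DifferentiableAt ℝ A x) :
    HasDerivAt (graphPt A) (graphSlope A x) x := by
  have h1 : HasDerivAt (fun y : ℝ => (y : ℂ)) 1 x := by simpa using (hasDerivAt_id x).ofReal_comp
  exact (h1.add (h.hasDerivAt.ofReal_comp.const_mul Complex.I)).congr_of_eventuallyEq
    (Eventually.of_forall fun y => by simp [graphPt])

/-- The fundamental theorem of calculus for complex-valued Lipschitz functions. -/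
lemma integral_eq_sub_of_lipschitzOnWith {H h : ℝ → ℂ} {c d : ℝ} {K : NNReal}
    (hH : LipschitzOnWith K H (uIcc c d)) (hi : IntervalIntegrable h volume c d)
    (hd : ∀ᵐ y, y ∈ uIoc c d → HasDerivAt H (h y) y) : ∫ y in c..d, h y = H d - H c := by
  have hre : LipschitzOnWith K (fun y => (H y).re) (uIcc c d) :=
    LipschitzOnWith.of_dist_le_mul fun x hx y hy =>
      (show dist (H x).re (H y).re ≤ dist (H x) (H y) by
        rw [Real.dist_eq, dist_eq_norm, ← Complex.sub_re]
        exact Complex.abs_re_le_norm _).trans (hH.dist_le_mul x hx y hy)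
  have him : LipschitzOnWith K (fun y => (H y).im) (uIcc c d) :=
    LipschitzOnWith.of_dist_le_mul fun x hx y hy =>
      (show dist (H x).im (H y).im ≤ dist (H x) (H y) by
        rw [Real.dist_eq, dist_eq_norm, ← Complex.sub_im]
        exact Complex.abs_im_le_norm _).trans (hH.dist_le_mul x hx y hy)
  have i1 := hre.absolutelyContinuousOnInterval.integral_deriv_eq_sub
  have i2 := him.absolutelyContinuousOnInterval.integral_deriv_eq_sub
  have e1 := Complex.reCLM.intervalIntegral_comp_comm hi
  have e2 := Complex.imCLM.intervalIntegral_comp_comm hi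
  apply Complex.ext
  · rw [Complex.sub_re, ← i1]
    refine e1.symm.trans (intervalIntegral.integral_congr_ae ?_)
    filter_upwards [hd] with y hy hyI
    exact (Complex.reCLM.hasFDerivAt.comp_hasDerivAt y (hy hyI)).deriv.symm
  · rw [Complex.sub_im, ← i2]
    refine e2.symm.trans (intervalIntegral.integral_congr_ae ?_)
    filter_upwards [hd] with y hy hyI
    exact (Complex.imCLM.hasFDerivAt.comp_hasDerivAt y (hy hyI)).deriv.symm

lemma lipschitzOnWith_log {δ : ℝ} (hδ : 0 < δ) :
    LipschitzOnWith (δ⁻¹).toNNReal Complex.log {z : ℂ | δ ≤ z.re} := by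
  have hsl : ∀ z ∈ {z : ℂ | δ ≤ z.re}, z ∈ Complex.slitPlane := fun z hz =>
    Complex.mem_slitPlane_iff.2 (Or.inl (hδ.trans_le hz))
  refine Convex.lipschitzOnWith_of_nnnorm_deriv_le (𝕜 := ℂ)
    (fun z hz => (Complex.hasDerivAt_log (hsl z hz)).differentiableAt) (fun z hz => ?_)
    (convex_halfSpace_re_ge δ)
  rw [(Complex.hasDerivAt_log (hsl z hz)).deriv, ← NNReal.coe_le_coe, coe_nnnorm,
    Real.coe_toNNReal _ (by positivity), norm_inv]
  exact inv_anti₀ hδ ((show δ ≤ z.re from hz).trans (Complex.re_le_norm z))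

/-- Integration of a logarithmic derivative along a Lipschitz curve in the right half plane. -/
lemma integral_logDeriv_eq {w w' : ℝ → ℂ} {c d δ : ℝ} {K : NNReal} (hδ : 0 < δ)
    (hw : LipschitzWith K w) (hre : ∀ y ∈ uIcc c d, δ ≤ (w y).re)
    (hi : IntervalIntegrable (fun y => w' y / w y) volume c d)
    (hd : ∀ᵐ y, HasDerivAt w (w' y) y) :
    ∫ y in c..d, w' y / w y = Complex.log (w d) - Complex.log (w c) := by
  refine integral_eq_sub_of_lipschitzOnWith (H := fun y => Complex.log (w y))
    ((lipschitzOnWith_log hδ).comp hw.lipschitzOnWith fun y hy => hre y hy) hi ?_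
  filter_upwards [hd] with y hy hyI
  exact hy.clog_real (Complex.mem_slitPlane_iff.2
    (Or.inl (hδ.trans_le (hre y (uIoc_subset_uIcc hyI)))))

lemma integrable_indicator_graphSlope (hA : ∀ x₁ x₂ : ℝ, |A x₁ - A x₂| ≤ L * |x₁ - x₂|)
    (hL : 0 < L) : Integrable ((Ioo a b).indicator (graphSlope A)) := by
  rw [integrable_indicator_iff measurableSet_Ioo]
  exact Measure.integrableOn_of_bounded (M := 1 + L) (by simp)
    measurable_graphSlope.aestronglyMeasurable (ae_of_all _ (norm_graphSlope_le hA hL))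

lemma truncCauchy_graphSlope (hA : ∀ x₁ x₂ : ℝ, |A x₁ - A x₂| ≤ L * |x₁ - x₂|) (hL : 0 < L)
    {x δ : ℝ} (hδ : 0 < δ) (h1 : a < x - δ) (h2 : x + δ < b) :
    truncCauchy A δ ((Ioo a b).indicator (graphSlope A)) x =
      (Complex.log (graphPt A x - graphPt A (x - δ)) - Complex.log (graphPt A x - graphPt A a)) +
      (Complex.log (graphPt A b - graphPt A x) -
        Complex.log (graphPt A (x + δ) - graphPt A x)) := by
  have hAm : Measurable A := (continuous_of_lipBound hA).measurable
  have hlip : LipschitzWith ⟨1 + L, by positivity⟩ (graphPt A) :=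
    LipschitzWith.of_dist_le_mul fun x y => by
      rw [dist_eq_norm, Real.dist_eq]; exact norm_graphPt_sub_le hA y x
  have hdiff : ∀ᵐ y, HasDerivAt (graphPt A) (graphSlope A y) y := by
    filter_upwards [(lipschitzWith_of_lipBound hA hL).ae_differentiableAt_real] with y hy
    exact hasDerivAt_graphPt hy
  have hii : IntervalIntegrable (fun y => truncKernel A δ x y * graphSlope A y) volume a b := by
    rw [intervalIntegrable_iff_integrableOn_Ioo_of_le (by linarith)]
    exact integrable_truncKernel_mul hAm hδ ((integrable_indicator_iff measurableSet_Ioo).1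
      (integrable_indicator_graphSlope hA hL)) x
  have e0 : truncCauchy A δ ((Ioo a b).indicator (graphSlope A)) x =
      ∫ y in a..b, truncKernel A δ x y * graphSlope A y := by
    rw [intervalIntegral.integral_of_le (by linarith), integral_Ioc_eq_integral_Ioo,
      ← integral_indicator measurableSet_Ioo]
    unfold truncCauchy
    congr 1
    ext y
    by_cases hy : y ∈ Ioo a b <;> simp [hy]
  have sub1 : uIcc a (x - δ) ⊆ uIcc a b := by
    rw [uIcc_of_le h1.le, uIcc_of_le (by linarith)]; exact Icc_subset_Icc_right (by linarith)
  have sub2 : uIcc (x - δ) (x + δ) ⊆ uIcc a b := by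
    rw [uIcc_of_le (by linarith), uIcc_of_le (by linarith)]
    exact Icc_subset_Icc (by linarith) (by linarith)
  have sub3 : uIcc (x + δ) b ⊆ uIcc a b := by
    rw [uIcc_of_le h2.le, uIcc_of_le (by linarith)]; exact Icc_subset_Icc_left (by linarith)
  have ii1 := hii.mono_set sub1
  have ii2 := hii.mono_set sub2
  have ii3 := hii.mono_set sub3
  rw [e0, ← intervalIntegral.integral_add_adjacent_intervals (ii1.trans ii2) ii3,
    ← intervalIntegral.integral_add_adjacent_intervals ii1 ii2]
  have m2 : ∫ y in (x - δ)..(x + δ), truncKernel A δ x y * graphSlope A y = 0 := by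
    rw [intervalIntegral.integral_congr (g := fun _ => 0)]
    · simp
    intro y hy
    rw [uIcc_of_le (by linarith)] at hy
    have : ¬ δ < |y - x| := not_lt.2 (abs_le.2 ⟨by linarith [hy.1], by linarith [hy.2]⟩)
    simp [truncKernel, this]
  have c1 : ∀ᵐ y : ℝ, y ∈ uIoc a (x - δ) → truncKernel A δ x y * graphSlope A y =
      -graphSlope A y / (graphPt A x - graphPt A y) := by
    have : ∀ᵐ y : ℝ, y ≠ x - δ := by simp [ae_iff]
    filter_upwards [this] with y hy hyI
    rw [uIoc_of_le h1.le] at hyI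
    have h3 : y < x - δ := lt_of_le_of_ne hyI.2 hy
    have : δ < |y - x| := by rw [abs_sub_comm]; exact lt_of_lt_of_le (by linarith) (le_abs_self _)
    rw [truncKernel, if_pos this, cauchyKernel_eq, ← neg_sub (graphPt A y), neg_div_neg_eq]
    ring
  have c3 : ∀ᵐ y : ℝ, y ∈ uIoc (x + δ) b → truncKernel A δ x y * graphSlope A y =
      graphSlope A y / (graphPt A y - graphPt A x) := by
    refine ae_of_all _ fun y hyI => ?_
    rw [uIoc_of_le h2.le] at hyI
    have : δ < |y - x| := lt_of_lt_of_le (by linarith [hyI.1]) (le_abs_self _)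
    rw [truncKernel, if_pos this, cauchyKernel_eq]
    ring
  rw [m2, add_zero, intervalIntegral.integral_congr_ae c1, intervalIntegral.integral_congr_ae c3]
  congr 1
  · refine integral_logDeriv_eq (w := fun y => graphPt A x - graphPt A y)
      (w' := fun y => -graphSlope A y) hδ (K := ⟨1 + L, by positivity⟩) ?_ ?_ ?_ ?_
    · exact LipschitzWith.of_dist_le_mul fun y y' => by
        rw [dist_sub_left]; exact hlip.dist_le_mul y y'
    · intro y hy
      rw [uIcc_of_le h1.le] at hy
      rw [graphPt_sub_re]
      linarith [hy.2]
    · exact ii1.congr_ae ((ae_restrict_iff' measurableSet_uIoc).2 c1)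
    · filter_upwards [hdiff] with y hy
      exact hy.const_sub _
  · refine integral_logDeriv_eq (w := fun y => graphPt A y - graphPt A x)
      (w' := fun y => graphSlope A y) hδ (K := ⟨1 + L, by positivity⟩) ?_ ?_ ?_ ?_
    · exact LipschitzWith.of_dist_le_mul fun y y' => by
        rw [dist_sub_right]; exact hlip.dist_le_mul y y'
    · intro y hy
      rw [uIcc_of_le h2.le] at hy
      rw [graphPt_sub_re]
      linarith [hy.1]
    · exact ii3.congr_ae ((ae_restrict_iff' measurableSet_uIoc).2 c3)
    · filter_upwards [hdiff] with y hy
      exact hy.sub_const _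

end Smooth

section PrincipalValue

variable {A : ℝ → ℝ} {L a b : ℝ}

lemma tendsto_log_graphPt_sub {x : ℝ} (h : DifferentiableAt ℝ A x) :
    Tendsto (fun δ : ℝ => Complex.log (graphPt A x - graphPt A (x - δ)) -
      Complex.log (graphPt A (x + δ) - graphPt A x)) (nhdsWithin 0 (Ioi 0)) (nhds 0) := by
  have hs := hasDerivAt_iff_tendsto_slope_zero.1 (hasDerivAt_graphPt h)
  have hpos : Tendsto (fun δ : ℝ => δ) (nhdsWithin 0 (Ioi 0)) (nhdsWithin 0 {0}ᶜ) :=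
    tendsto_id.mono_left (nhdsWithin_mono _ fun t ht => (ne_of_gt (show (0:ℝ) < t from ht)))
  have hneg : Tendsto (fun δ : ℝ => -δ) (nhdsWithin 0 (Ioi 0)) (nhdsWithin 0 {0}ᶜ) := by
    refine tendsto_nhdsWithin_iff.2 ⟨?_, ?_⟩
    · have : Tendsto (fun δ : ℝ => -δ) (nhds 0) (nhds (-0)) := (continuous_neg.tendsto _)
      rw [neg_zero] at this
      exact this.mono_left nhdsWithin_le_nhds
    · filter_upwards [self_mem_nhdsWithin] with t ht
      exact neg_ne_zero.2 (ne_of_gt (show (0:ℝ) < t from ht))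
  have hsl : graphSlope A x ∈ Complex.slitPlane :=
    Complex.mem_slitPlane_iff.2 (Or.inl (by rw [graphSlope_re]; exact one_pos))
  have l1 := (hs.comp hneg).clog hsl
  have l2 := (hs.comp hpos).clog hsl
  have l3 := l1.sub l2
  rw [sub_self] at l3
  refine l3.congr' ?_
  filter_upwards [self_mem_nhdsWithin] with δ hδ
  have hδ : (0:ℝ) < δ := hδ
  have n1 : graphPt A x - graphPt A (x - δ) ≠ 0 := graphPt_sub_ne_zero (by linarith)
  have n2 : graphPt A (x + δ) - graphPt A x ≠ 0 := graphPt_sub_ne_zero (by linarith)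
  have e1 : (-δ)⁻¹ • (graphPt A (x + -δ) - graphPt A x) =
      ((δ⁻¹ : ℝ) : ℂ) * (graphPt A x - graphPt A (x - δ)) := by
    rw [Complex.real_smul, ← sub_eq_add_neg]; push_cast; rw [inv_neg]; ring
  have e2 : δ⁻¹ • (graphPt A (x + δ) - graphPt A x) =
      ((δ⁻¹ : ℝ) : ℂ) * (graphPt A (x + δ) - graphPt A x) := Complex.real_smul ..
  simp only [Function.comp]
  rw [e1, e2, Complex.log_ofReal_mul (inv_pos.2 hδ) n1, Complex.log_ofReal_mul (inv_pos.2 hδ) n2]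
  ring

lemma tendsto_truncCauchy_graphSlope (hA : ∀ x₁ x₂ : ℝ, |A x₁ - A x₂| ≤ L * |x₁ - x₂|)
    (hL : 0 < L) {x : ℝ} (hx : x ∈ Ioo a b) (h : DifferentiableAt ℝ A x) :
    Tendsto (fun δ => truncCauchy A δ ((Ioo a b).indicator (graphSlope A)) x)
      (nhdsWithin 0 (Ioi 0)) (nhds (Complex.log (graphPt A b - graphPt A x) -
        Complex.log (graphPt A x - graphPt A a))) := by
  have := (tendsto_log_graphPt_sub h).add_const (Complex.log (graphPt A b - graphPt A x) -
        Complex.log (graphPt A x - graphPt A a))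
  rw [zero_add] at this
  refine this.congr' ?_
  have hm : Ioo 0 (min (x - a) (b - x)) ∈ nhdsWithin (0:ℝ) (Ioi 0) :=
    Ioo_mem_nhdsGT (lt_min (by linarith [hx.1]) (by linarith [hx.2]))
  filter_upwards [hm] with δ hδ
  rw [truncCauchy_graphSlope hA hL hδ.1 (by linarith [hδ.2.trans_le (min_le_left _ _)])
    (by linarith [hδ.2.trans_le (min_le_right _ _)])]
  ring

lemma tendsto_truncCauchy_graphSlope_mul (hA : ∀ x₁ x₂ : ℝ, |A x₁ - A x₂| ≤ L * |x₁ - x₂|)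
    (hL : 0 < L) {φ : ℝ → ℂ} {C : NNReal} (hφ : LipschitzWith C φ)
    (hφi : Integrable ((Ioo a b).indicator fun y => graphSlope A y * φ y)) {x : ℝ}
    (hx : x ∈ Ioo a b) (h : DifferentiableAt ℝ A x) :
    ∃ u, Tendsto (fun δ => truncCauchy A δ ((Ioo a b).indicator fun y => graphSlope A y * φ y) x)
      (nhdsWithin 0 (Ioi 0)) (nhds u) := by
  have hAm : Measurable A := (continuous_of_lipBound hA).measurable
  have hgi := integrable_indicator_graphSlope (a := a) (b := b) hA hL
  set R : ℝ → ℂ := (Ioo a b).indicator fun y => graphSlope A y * (φ y - φ x) with hR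
  have hRe : R = fun y => (Ioo a b).indicator (fun y => graphSlope A y * φ y) y +
      (-φ x) * (Ioo a b).indicator (graphSlope A) y := by
    ext y
    by_cases hy : y ∈ Ioo a b
    · simp only [hR, indicator_of_mem hy]; ring
    · simp only [hR, indicator_of_notMem hy]; ring
  have hRi : Integrable R := by rw [hRe]; exact hφi.add (hgi.const_mul _)
  have hdec : ∀ δ : ℝ, 0 < δ → truncCauchy A δ
      ((Ioo a b).indicator fun y => graphSlope A y * φ y) x =
      φ x * truncCauchy A δ ((Ioo a b).indicator (graphSlope A)) x + truncCauchy A δ R x := by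
    intro δ hδ
    rw [← truncCauchy_const_mul, ← truncCauchy_add
      (G := fun y => φ x * (Ioo a b).indicator (graphSlope A) y) hAm hδ (hgi.const_mul _) hRi]
    congr 1
    ext y
    rw [hRe]; ring
  have hlim : Tendsto (fun δ => truncCauchy A δ R x) (nhdsWithin 0 (Ioi 0))
      (nhds (∫ y, (if 0 < |y - x| then cauchyKernel A x y else 0) * R y)) := by
    unfold truncCauchy
    refine tendsto_integral_filter_of_dominated_convergence
      ((Ioo a b).indicator fun _ => (1 + L) * C) ?_ ?_ ?_ ?_
    · filter_upwards with δ
      exact (measurable_truncKernel_right hAm δ x).aestronglyMeasurable.mul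
        hRi.aestronglyMeasurable
    · filter_upwards [self_mem_nhdsWithin] with δ hδ
      refine ae_of_all _ fun y => ?_
      by_cases hy : y ∈ Ioo a b
      · simp only [hR, indicator_of_mem hy]
        by_cases h1 : δ < |y - x|
        · have h0 : 0 < |y - x| := lt_trans hδ h1
          rw [truncKernel, if_pos h1, norm_mul, norm_mul]
          have := hφ.dist_le_mul y x
          rw [dist_eq_norm, Real.dist_eq] at this
          calc ‖cauchyKernel A x y‖ * (‖graphSlope A y‖ * ‖φ y - φ x‖)
              ≤ |y - x|⁻¹ * ((1 + L) * (C * |y - x|)) := by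
                gcongr
                · exact norm_cauchyKernel_le x y
                · exact norm_graphSlope_le hA hL y
            _ = (1 + L) * C := by field_simp
        · rw [truncKernel, if_neg h1, zero_mul, norm_zero]; positivity
      · simp [hR, indicator_of_notMem hy]
    · rw [integrable_indicator_iff measurableSet_Ioo]
      exact integrableOn_const (by simp)
    · refine ae_of_all _ fun y => ?_
      refine tendsto_const_nhds.congr' ?_
      by_cases h0 : 0 < |y - x|
      · filter_upwards [Ioo_mem_nhdsGT h0] with δ hδ
        rw [truncKernel, if_pos h0, if_pos hδ.2]
      · filter_upwards [self_mem_nhdsWithin] with δ hδ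
        rw [truncKernel, if_neg h0, if_neg (fun h => h0 (lt_trans hδ h))]
  refine ⟨_, (((tendsto_truncCauchy_graphSlope hA hL hx h).const_mul (φ x)).add hlim).congr' ?_⟩
  filter_upwards [self_mem_nhdsWithin] with δ hδ
  exact (hdec δ hδ).symm

/-- Principal values of the Cauchy integral of an integrable function exist almost everywhere. -/
lemma ae_tendsto_truncCauchy (hA : ∀ x₁ x₂ : ℝ, |A x₁ - A x₂| ≤ L * |x₁ - x₂|)
    (hL : 0 < L) (hab : a < b) {F : ℝ → ℂ} (hFm : Measurable F) (hF : Integrable F)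
    (hs : ∀ x ∉ Ioo a b, F x = 0) :
    ∀ᵐ x, x ∈ Ioo a b → ∃ u, Tendsto (fun δ => truncCauchy A δ F x)
      (nhdsWithin 0 (Ioi 0)) (nhds u) := by
  refine ae_tendsto_truncCauchy_of_approx hA hL hab hFm hF hs fun θ hθ => ?_
  have hgm := measurable_graphSlope (A := A)
  set E : ℝ → ℂ := fun y => F y / graphSlope A y
  have hE : Integrable E := by
    refine hF.mono (hFm.div hgm).aestronglyMeasurable (ae_of_all _ fun y => ?_)
    rw [norm_div]
    exact div_le_self (norm_nonneg _) (one_le_norm_graphSlope y)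
  obtain ⟨φ, hφc, hφs, hφ⟩ := (memLp_one_iff_integrable.2 hE).exist_eLpNorm_sub_le (by simp) le_rfl
    (show 0 < θ / (1 + L) by positivity)
  obtain ⟨C, hC⟩ : ∃ C, LipschitzWith C φ :=
    hφs.lipschitzWith_of_hasCompactSupport hφc (by simp)
  have hφi : Integrable φ := hφs.continuous.integrable_of_hasCompactSupport hφc
  have hGm : Measurable ((Ioo a b).indicator fun y => graphSlope A y * φ y) :=
    (hgm.mul hφs.continuous.measurable).indicator measurableSet_Ioo
  have hGi : Integrable ((Ioo a b).indicator fun y => graphSlope A y * φ y) := by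
    refine (hφi.norm.const_mul (1 + L)).mono hGm.aestronglyMeasurable (ae_of_all _ fun y => ?_)
    refine (norm_indicator_le_norm_self _ _).trans ?_
    rw [norm_mul, Real.norm_of_nonneg (by positivity)]
    gcongr
    exact norm_graphSlope_le hA hL y
  refine ⟨_, hGm, hGi, fun x hx => indicator_of_notMem hx _, ?_, ?_⟩
  · have h1 : ∫ x, ‖E x - φ x‖ ≤ θ / (1 + L) := by
      rw [eLpNorm_one_eq_lintegral_enorm] at hφ
      rw [integral_norm_eq_lintegral_enorm (f := fun x => E x - φ x)
        (hE.sub hφi).aestronglyMeasurable]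
      exact ENNReal.toReal_le_of_le_ofReal (by positivity) hφ
    calc ∫ x, ‖F x - (Ioo a b).indicator (fun y => graphSlope A y * φ y) x‖
        ≤ ∫ x, (1 + L) * ‖E x - φ x‖ := by
          refine integral_mono (hF.sub hGi).norm ((hE.sub hφi).norm.const_mul _) fun y => ?_
          by_cases hy : y ∈ Ioo a b
          · have h0 : graphSlope A y ≠ 0 := norm_pos_iff.1 (one_pos.trans_le
              (one_le_norm_graphSlope y))
            have : F y - graphSlope A y * φ y = graphSlope A y * (E y - φ y) := by
              simp only [E]; field_simp
            simp only [indicator_of_mem hy]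
            rw [this, norm_mul]
            gcongr
            exact norm_graphSlope_le hA hL y
          · simp only [indicator_of_notMem hy, hs y hy, sub_zero, norm_zero]
            positivity
      _ = (1 + L) * ∫ x, ‖E x - φ x‖ := integral_const_mul _ _
      _ ≤ (1 + L) * (θ / (1 + L)) := by gcongr
      _ = θ := by field_simp
  · filter_upwards [(lipschitzWith_of_lipBound hA hL).ae_differentiableAt_real] with x hx hxI
    exact tendsto_truncCauchy_graphSlope_mul hA hL hC hGi hxI hx

/-- At a point away from the support of `F` the principal value is an absolutely convergent
integral. -/
lemma cauchyPV_of_eq_zero_of_abs_sub_lt {F : ℝ → ℂ} {x δ₀ : ℝ} (hδ₀ : 0 < δ₀)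
    (hs : ∀ y, |y - x| < δ₀ → F y = 0) : cauchyPV A F x (∫ y, cauchyKernel A x y * F y) := by
  refine tendsto_const_nhds.congr' ?_
  filter_upwards [Ioo_mem_nhdsGT hδ₀] with δ hδ
  rw [← integral_indicator (measurableSet_lt measurable_const (by fun_prop))]
  congr 1
  ext y
  by_cases hy : δ < |y - x|
  · rw [indicator_of_mem (s := {y : ℝ | δ < |y - x|}) hy]
  · rw [indicator_of_notMem (s := {y : ℝ | δ < |y - x|}) hy,
      hs y (lt_of_le_of_lt (not_lt.1 hy) hδ.2), mul_zero]

lemma cauchyPV_congr_ae {F G : ℝ → ℂ} (h : F =ᵐ[volume] G) {x : ℝ} {u : ℂ}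
    (hF : cauchyPV A F x u) : cauchyPV A G x u := by
  refine hF.congr fun δ => integral_congr_ae (ae_restrict_of_ae ?_)
  filter_upwards [h] with y hy
  rw [hy]

/-- The Cauchy integral of an integrable function supported in a bounded interval exists almost
everywhere. -/
lemma ae_exists_cauchyPV (hA : ∀ x₁ x₂ : ℝ, |A x₁ - A x₂| ≤ L * |x₁ - x₂|)
    (hL : 0 < L) (hab : a < b) {F : ℝ → ℂ} (hF : Integrable F)
    (hs : ∀ x ∉ Ioo a b, F x = 0) : ∀ᵐ x, ∃ u, cauchyPV A F x u := by
  obtain ⟨G₀, hG₀, hFG₀⟩ := hF.1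
  set G := (Ioo a b).indicator G₀
  have hFG : F =ᵐ[volume] G := by
    filter_upwards [hFG₀] with y hy
    by_cases hyI : y ∈ Ioo a b
    · simp only [G, indicator_of_mem hyI, hy]
    · simp only [G, indicator_of_notMem hyI, hs y hyI]
  have hGs : ∀ x ∉ Ioo a b, G x = 0 := fun x hx => indicator_of_notMem hx _
  have ha : ∀ᵐ y : ℝ, y ≠ a := by simp [ae_iff]
  have hb : ∀ᵐ y : ℝ, y ≠ b := by simp [ae_iff]
  filter_upwards [ae_tendsto_truncCauchy hA hL hab
    (hG₀.measurable.indicator measurableSet_Ioo) (hF.congr hFG) hGs, ha, hb] with x hx hxa hxb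
  by_cases hxI : x ∈ Ioo a b
  · obtain ⟨u, hu⟩ := hx hxI
    refine ⟨u, cauchyPV_congr_ae hFG.symm (hu.congr fun δ => ?_)⟩
    exact truncCauchy_eq ..
  · have hx' : x < a ∨ b < x := by
      by_contra! h
      exact hxI ⟨lt_of_le_of_ne h.1 hxa.symm, lt_of_le_of_ne h.2 hxb⟩
    rcases hx' with h | h
    · refine ⟨_, cauchyPV_of_eq_zero_of_abs_sub_lt (sub_pos.2 h) fun y hy => hs y fun hyI => ?_⟩
      linarith [le_abs_self (y - x), hyI.1]
    · refine ⟨_, cauchyPV_of_eq_zero_of_abs_sub_lt (sub_pos.2 h) fun y hy => hs y fun hyI => ?_⟩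
      linarith [neg_le_abs (y - x), hyI.2]

end PrincipalValue

section JohnNirenberg

variable {b : ℝ → ℝ} {N : ℝ}

/-- The average of `b` over `[a, c)`. -/
noncomputable def icoAvg (b : ℝ → ℝ) (a c : ℝ) : ℝ := (c - a)⁻¹ * ∫ y in Ico a c, b y

lemma intervalAvg_eq_icoAvg (x r : ℝ) : intervalAvg b x r = icoAvg b (x - r) (x + r) := by
  rw [intervalAvg, icoAvg, integral_Ico_eq_integral_Ioo]
  congr 2
  ring

lemma IsBMOWith.setIntegral_abs_sub_icoAvg_le (hb : IsBMOWith b N) {a c : ℝ} (hac : a < c) :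
    ∫ y in Ico a c, |b y - icoAvg b a c| ≤ N * (c - a) := by
  have h := hb.2 ((a + c) / 2) ((c - a) / 2) (by linarith)
  rw [meanOsc, intervalAvg_eq_icoAvg, ← integral_Ico_eq_integral_Ioo] at h
  have e1 : (a + c) / 2 - (c - a) / 2 = a := by ring
  have e2 : (a + c) / 2 + (c - a) / 2 = c := by ring
  have e3 : 2 * ((c - a) / 2) = c - a := by ring
  rw [e1, e2, e3, inv_mul_le_iff₀ (by linarith)] at h
  linarith

lemma IsBMOWith.integrableOn_sub_const (hb : IsBMOWith b N) (a c m : ℝ) :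
    IntegrableOn (fun y => b y - m) (Ico a c) :=
  ((hb.1.integrableOn_isCompact isCompact_Icc).mono_set Ico_subset_Icc_self).sub
    (integrableOn_const (by simp))

lemma IsBMOWith.abs_icoAvg_sub_le (hb : IsBMOWith b N) {a c m B : ℝ} (hac : a < c)
    (h : ∫ y in Ico a c, |b y - m| ≤ B * (c - a)) : |icoAvg b a c - m| ≤ B := by
  have hi : IntegrableOn b (Ico a c) := by simpa using hb.integrableOn_sub_const a c 0
  have hpos : 0 < c - a := by linarith
  have e : icoAvg b a c - m = (c - a)⁻¹ * ∫ y in Ico a c, (b y - m) := by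
    rw [integral_sub hi (integrableOn_const (by simp)), setIntegral_const, icoAvg, mul_sub]
    simp [Real.volume_real_Ico_of_le hac.le]
    field_simp
  rw [e, abs_mul, abs_of_pos (inv_pos.2 hpos), inv_mul_le_iff₀ hpos, mul_comm (c - a)]
  exact (abs_integral_le_integral_abs).trans h

/-- The John–Nirenberg inequality. -/
lemma IsBMOWith.volume_lt_abs_sub_icoAvg_le (hb : IsBMOWith b N) (hN : 0 < N) (n : ℕ) :
    ∀ a c : ℝ, a < c → volume {y | y ∈ Ico a c ∧ 4 * N * n < |b y - icoAvg b a c|} ≤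
      ENNReal.ofReal ((1 / 2) ^ n * (c - a)) := by
  induction n with
  | zero =>
    intro a c _
    refine (measure_mono (t := Ico a c) fun y hy => hy.1).trans ?_
    rw [Real.volume_Ico]; simp
  | succ n ih =>
    intro a c hac
    set m := icoAvg b a c
    set v : ℝ → ℝ := (Ico a c).indicator fun y => |b y - m| with hv
    have hvi : Integrable v :=
      (integrable_indicator_iff measurableSet_Ico).2 (hb.integrableOn_sub_const a c m).abs
    have hv0 : ∀ y, 0 ≤ v y := fun y => indicator_nonneg (fun _ _ => abs_nonneg _) y
    have hvI : ∫ y in Ico a c, v y ≤ N * (c - a) := by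
      rw [setIntegral_congr_fun (g := fun y => |b y - m|) measurableSet_Ico
        fun y hy => indicator_of_mem hy _]
      exact hb.setIntegral_abs_sub_icoAvg_le hac
    obtain ⟨S, hSc, hS, hSd, hSv⟩ := exists_calderonZygmund (β := 2 * N) hac hvi hv0
      (hvI.trans (by nlinarith))
    have hsub : ∀ q ∈ S, Ico q.1 q.2 ⊆ Ico a c := fun q hq =>
      Ico_subset_Ico (hS q hq).1 (hS q hq).2.2.1
    have havg : ∀ q ∈ S, |icoAvg b q.1 q.2 - m| ≤ 4 * N := by
      intro q hq
      refine hb.abs_icoAvg_sub_le (hS q hq).2.1 ?_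
      rw [← setIntegral_congr_fun (f := v) measurableSet_Ico
        fun y hy => indicator_of_mem (hsub q hq hy) _]
      linarith [(hS q hq).2.2.2.2]
    have hcov : {y | y ∈ Ico a c ∧ 4 * N * (n + 1 : ℕ) < |b y - m|} ≤ᵐ[volume]
        (⋃ q ∈ S, {y | y ∈ Ico q.1 q.2 ∧ 4 * N * n < |b y - icoAvg b q.1 q.2|} : Set ℝ) := by
      filter_upwards [hSv] with y hy hyI
      obtain ⟨hyI, hlt⟩ : y ∈ Ico a c ∧ 4 * N * (n + 1 : ℕ) < |b y - m| := hyI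
      push_cast at hlt
      by_cases hq : ∀ q ∈ S, y ∉ Ico q.1 q.2
      · have := hy hyI hq
        rw [hv, indicator_of_mem hyI] at this
        nlinarith
      · push Not at hq
        obtain ⟨q, hqS, hyq⟩ := hq
        refine mem_biUnion hqS ⟨hyq, ?_⟩
        have h1 := havg q hqS
        have h2 := abs_sub_le (b y) (icoAvg b q.1 q.2) m
        linarith
    have hsum : ∑' q : S, ENNReal.ofReal (q.1.2 - q.1.1) ≤ ENNReal.ofReal ((c - a) / 2) := by
      have : Countable S := hSc.to_subtype
      have h2 : ∑' q : S, ENNReal.ofReal (2 * N) * ENNReal.ofReal (q.1.2 - q.1.1) ≤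
          ENNReal.ofReal (N * (c - a)) := by
        calc ∑' q : S, ENNReal.ofReal (2 * N) * ENNReal.ofReal (q.1.2 - q.1.1)
            ≤ ∑' q : S, ∫⁻ y in Ico q.1.1 q.1.2, ENNReal.ofReal (v y) := by
              refine ENNReal.tsum_le_tsum fun q => ?_
              rw [← ENNReal.ofReal_mul (by positivity), ← ofReal_integral_eq_lintegral_ofReal
                hvi.integrableOn (ae_of_all _ hv0)]
              exact ENNReal.ofReal_le_ofReal (hS q.1 q.2).2.2.2.1.le
          _ = ∫⁻ y in ⋃ q : S, Ico q.1.1 q.1.2, ENNReal.ofReal (v y) := by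
              rw [lintegral_iUnion (fun q => measurableSet_Ico)]
              intro q q' hqq
              exact hSd q.2 q'.2 (fun h => hqq (Subtype.ext h))
          _ ≤ ∫⁻ y in Ico a c, ENNReal.ofReal (v y) :=
              lintegral_mono_set (iUnion_subset fun q => hsub q.1 q.2)
          _ ≤ ENNReal.ofReal (N * (c - a)) := by
              rw [← ofReal_integral_eq_lintegral_ofReal hvi.integrableOn (ae_of_all _ hv0)]
              exact ENNReal.ofReal_le_ofReal hvI
      rw [ENNReal.tsum_mul_left] at h2
      have e : N * (c - a) = 2 * N * ((c - a) / 2) := by ring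
      rw [e, ENNReal.ofReal_mul (p := 2 * N) (by positivity)] at h2
      exact (ENNReal.mul_le_mul_iff_right (by simpa using hN) ENNReal.ofReal_ne_top).1 h2
    calc volume {y | y ∈ Ico a c ∧ 4 * N * (n + 1 : ℕ) < |b y - m|}
        ≤ volume (⋃ q ∈ S, {y | y ∈ Ico q.1 q.2 ∧ 4 * N * n < |b y - icoAvg b q.1 q.2|}) :=
          measure_mono_ae hcov
      _ ≤ ∑' q : S, volume {y | y ∈ Ico q.1.1 q.1.2 ∧
            4 * N * n < |b y - icoAvg b q.1.1 q.1.2|} := measure_biUnion_le volume hSc _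
      _ ≤ ∑' q : S, ENNReal.ofReal ((1 / 2) ^ n) * ENNReal.ofReal (q.1.2 - q.1.1) := by
          refine ENNReal.tsum_le_tsum fun q => ?_
          rw [← ENNReal.ofReal_mul (by positivity)]
          exact ih _ _ (hS q.1 q.2).2.1
      _ ≤ ENNReal.ofReal ((1 / 2) ^ n) * ENNReal.ofReal ((c - a) / 2) := by
          rw [ENNReal.tsum_mul_left]; gcongr
      _ = ENNReal.ofReal ((1 / 2) ^ (n + 1) * (c - a)) := by
          rw [← ENNReal.ofReal_mul (by positivity)]
          congr 1; ring

lemma summable_rpow_mul_half_pow (N p : ℝ) (hN : 0 < N) :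
    Summable fun n : ℕ => (4 * N * (n + 1)) ^ p * (1 / 2 : ℝ) ^ n := by
  have h1 : Summable fun n : ℕ => (n : ℝ) ^ ⌈p⌉₊ * (1 / 2 : ℝ) ^ n :=
    summable_pow_mul_geometric_of_norm_lt_one _ (by norm_num)
  have h2 := ((summable_nat_add_iff 1).2 h1).mul_left ((4 * N) ^ p * 2)
  refine Summable.of_nonneg_of_le (fun n => by positivity) (fun n => ?_) h2
  rw [Real.mul_rpow (by positivity) (by positivity)]
  have h3 : ((n : ℝ) + 1) ^ p ≤ ((n : ℝ) + 1) ^ ⌈p⌉₊ := by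
    rw [← Real.rpow_natCast]
    exact Real.rpow_le_rpow_of_exponent_le (by linarith [(Nat.cast_nonneg n : (0:ℝ) ≤ n)])
      (Nat.le_ceil p)
  calc (4 * N) ^ p * ((n : ℝ) + 1) ^ p * (1 / 2) ^ n
      ≤ (4 * N) ^ p * ((n : ℝ) + 1) ^ ⌈p⌉₊ * (1 / 2) ^ n := by gcongr
    _ = (4 * N) ^ p * 2 * (((n + 1 : ℕ) : ℝ) ^ ⌈p⌉₊ * (1 / 2) ^ (n + 1)) := by
        push_cast; ring

lemma IsBMOWith.exists_lintegral_rpow_le (hb : IsBMOWith b N) (hN : 0 < N) {p : ℝ} (hp : 0 < p) :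
    ∃ C : ℝ, 0 ≤ C ∧ ∀ a c : ℝ, a < c →
      ∫⁻ y in Ico a c, ‖b y - icoAvg b a c‖ₑ ^ p ≤ ENNReal.ofReal (C * (c - a)) := by
  have hs := summable_rpow_mul_half_pow N p hN
  refine ⟨∑' n : ℕ, (4 * N * (n + 1)) ^ p * (1 / 2 : ℝ) ^ n,
    tsum_nonneg fun n => by positivity, fun a c hac => ?_⟩
  set m := icoAvg b a c
  set t : ℕ → Set ℝ := fun n => {y | y ∈ Ico a c ∧ 4 * N * n < |b y - m|}
  have hbm : AEMeasurable b := hb.1.aestronglyMeasurable.aemeasurable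
  have ht : ∀ n, NullMeasurableSet (t n) := fun n =>
    measurableSet_Ico.nullMeasurableSet.inter
      (nullMeasurableSet_lt aemeasurable_const (hbm.sub_const m).abs)
  have hpt : ∀ y, (Ico a c).indicator (fun y => ‖b y - m‖ₑ ^ p) y ≤
      ∑' n : ℕ, (t n).indicator (fun _ => ENNReal.ofReal ((4 * N * (n + 1)) ^ p)) y := by
    intro y
    by_cases hy : y ∈ Ico a c
    · rw [indicator_of_mem hy]
      rcases (abs_nonneg (b y - m)).eq_or_lt with h0 | h0
      · rw [← Real.enorm_abs, ← h0, enorm_zero, ENNReal.zero_rpow_of_pos hp]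
        exact zero_le
      · have hq : 0 < |b y - m| / (4 * N) := by positivity
        obtain ⟨n, hn⟩ : ∃ n, ⌈|b y - m| / (4 * N)⌉₊ = n + 1 :=
          Nat.exists_eq_succ_of_ne_zero (Nat.ceil_pos.2 hq).ne'
        have h1 : (n : ℝ) < |b y - m| / (4 * N) := Nat.lt_ceil.1 (by omega)
        have h2 : |b y - m| / (4 * N) ≤ n + 1 := by
          have := Nat.le_ceil (|b y - m| / (4 * N))
          rw [hn] at this
          exact_mod_cast this
        rw [lt_div_iff₀ (by positivity)] at h1
        rw [div_le_iff₀ (by positivity)] at h2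
        refine le_trans ?_ (ENNReal.le_tsum n)
        rw [indicator_of_mem (s := t n) ⟨hy, by linarith⟩, Real.enorm_eq_ofReal_abs,
          ENNReal.ofReal_rpow_of_nonneg (abs_nonneg _) hp.le]
        exact ENNReal.ofReal_le_ofReal (Real.rpow_le_rpow (abs_nonneg _) (by linarith) hp.le)
    · rw [indicator_of_notMem hy]; exact zero_le
  rw [← lintegral_indicator measurableSet_Ico]
  calc ∫⁻ y, (Ico a c).indicator (fun y => ‖b y - m‖ₑ ^ p) y
      ≤ ∫⁻ y, ∑' n : ℕ, (t n).indicator (fun _ => ENNReal.ofReal ((4 * N * (n + 1)) ^ p)) y :=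
        lintegral_mono hpt
    _ = ∑' n : ℕ, ENNReal.ofReal ((4 * N * (n + 1)) ^ p) * volume (t n) := by
        rw [lintegral_tsum fun n => aemeasurable_const.indicator₀ (ht n)]
        congr 1; ext n
        rw [lintegral_indicator_const₀ (ht n)]
    _ ≤ ∑' n : ℕ, ENNReal.ofReal ((4 * N * (n + 1)) ^ p * (1 / 2 : ℝ) ^ n) *
          ENNReal.ofReal (c - a) := by
        refine ENNReal.tsum_le_tsum fun n => ?_
        rw [ENNReal.ofReal_mul (p := (4 * N * (n + 1)) ^ p) (by positivity), mul_assoc (ENNReal.ofReal _),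
          ← ENNReal.ofReal_mul (p := (1 / 2 : ℝ) ^ n) (by positivity)]
        exact mul_le_mul_right (hb.volume_lt_abs_sub_icoAvg_le hN n a c hac) _
    _ = _ := by
        rw [ENNReal.tsum_mul_right, ← ENNReal.ofReal_tsum_of_nonneg (fun n => by positivity) hs,
          ← ENNReal.ofReal_mul (tsum_nonneg fun n => by positivity)]

lemma IsBMOWith.abs_intervalAvg_two_pow_sub_le (hb : IsBMOWith b N) {x r : ℝ} (hr : 0 < r)
    (k : ℕ) : |intervalAvg b x (2 ^ k * r) - intervalAvg b x r| ≤ 2 * N * k := by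
  induction k with
  | zero => simp
  | succ k ih =>
    have hk : 0 < 2 ^ k * r := by positivity
    have hle : 2 ^ k * r ≤ 2 ^ (k + 1) * r := by rw [pow_succ]; linarith
    set m := intervalAvg b x (2 ^ (k + 1) * r) with hm
    have h1 : |intervalAvg b x (2 ^ k * r) - m| ≤ 2 * N := by
      rw [intervalAvg_eq_icoAvg]
      refine hb.abs_icoAvg_sub_le (by linarith) ?_
      have h2 := hb.setIntegral_abs_sub_icoAvg_le
        (show x - 2 ^ (k + 1) * r < x + 2 ^ (k + 1) * r by linarith)
      rw [← intervalAvg_eq_icoAvg, ← hm] at h2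
      have h3 := setIntegral_mono_set (μ := volume) (hb.integrableOn_sub_const
        (x - 2 ^ (k + 1) * r) (x + 2 ^ (k + 1) * r) m).abs (ae_of_all _ fun y => abs_nonneg _)
        (Ico_subset_Ico (show x - 2 ^ (k + 1) * r ≤ x - 2 ^ k * r by linarith)
          (show x + 2 ^ k * r ≤ x + 2 ^ (k + 1) * r by linarith)).eventuallyLE
      refine h3.trans (h2.trans (le_of_eq ?_))
      ring
    have h4 := abs_sub_le m (intervalAvg b x (2 ^ k * r)) (intervalAvg b x r)
    rw [abs_sub_comm m (intervalAvg b x (2 ^ k * r))] at h4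
    push_cast
    linarith

lemma IsBMOWith.exists_lintegral_two_pow_rpow_le (hb : IsBMOWith b N) (hN : 0 < N) {p : ℝ}
    (hp : 1 ≤ p) : ∃ C : ℝ, 0 < C ∧ ∀ x r : ℝ, 0 < r → ∀ k : ℕ,
      ∫⁻ y in Ioo (x - 2 ^ k * r) (x + 2 ^ k * r), ‖b y - intervalAvg b x r‖ₑ ^ p ≤
        ENNReal.ofReal (C * (k + 1) ^ p * (2 ^ k * r)) := by
  obtain ⟨C, hC, hJN⟩ := hb.exists_lintegral_rpow_le hN (p := p) (by linarith)
  refine ⟨2 ^ (p - 1) * (C * 2 + (2 * N) ^ p * 2), by positivity, fun x r hr k => ?_⟩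
  have hk : 0 < 2 ^ k * r := by positivity
  have h1 := hJN (x - 2 ^ k * r) (x + 2 ^ k * r) (by linarith)
  rw [← intervalAvg_eq_icoAvg] at h1
  have h2 := hb.abs_intervalAvg_two_pow_sub_le (x := x) hr k
  set m := intervalAvg b x r
  set m' := intervalAvg b x (2 ^ k * r)
  rw [setLIntegral_congr (Ioo_ae_eq_Ico (μ := volume))]
  calc ∫⁻ y in Ico (x - 2 ^ k * r) (x + 2 ^ k * r), ‖b y - m‖ₑ ^ p
      ≤ ∫⁻ y in Ico (x - 2 ^ k * r) (x + 2 ^ k * r), 2 ^ (p - 1) * (‖b y - m'‖ₑ ^ p +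
          ENNReal.ofReal ((2 * N * k) ^ p)) := by
        refine lintegral_mono fun y => ?_
        refine le_trans ?_ (ENNReal.rpow_add_le_mul_rpow_add_rpow _ _ hp |>.trans
          (le_of_eq (by rw [← ENNReal.ofReal_rpow_of_nonneg (by positivity) (by linarith)])))
        refine ENNReal.rpow_le_rpow ?_ (by linarith)
        have e : b y - m = (b y - m') + (m' - m) := by ring
        rw [e]
        refine (enorm_add_le _ _).trans (add_le_add le_rfl ?_)
        rw [Real.enorm_eq_ofReal_abs]
        exact ENNReal.ofReal_le_ofReal h2
    _ = 2 ^ (p - 1) * ((∫⁻ y in Ico (x - 2 ^ k * r) (x + 2 ^ k * r), ‖b y - m'‖ₑ ^ p) +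
          ENNReal.ofReal ((2 * N * k) ^ p) * ENNReal.ofReal (2 * (2 ^ k * r))) := by
        rw [lintegral_const_mul' _ _ (by
          exact ENNReal.rpow_ne_top_of_nonneg (by linarith) (by simp)),
          lintegral_add_right _ measurable_const, setLIntegral_const, Real.volume_Ico]
        congr 4; ring
    _ ≤ ENNReal.ofReal (2 ^ (p - 1)) * (ENNReal.ofReal (C * (2 * (2 ^ k * r))) +
          ENNReal.ofReal ((2 * N * k) ^ p * (2 * (2 ^ k * r)))) := by
        rw [← ENNReal.ofReal_rpow_of_pos (x := 2) (by norm_num), ENNReal.ofReal_ofNat,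
          ← ENNReal.ofReal_mul (p := (2 * N * k) ^ p) (by positivity)]
        gcongr
        refine h1.trans (le_of_eq ?_)
        congr 2; ring
    _ ≤ _ := by
        rw [← ENNReal.ofReal_add (by positivity) (by positivity),
          ← ENNReal.ofReal_mul (by positivity)]
        refine ENNReal.ofReal_le_ofReal ?_
        have h3 : (1:ℝ) ≤ (k + 1) ^ p := Real.one_le_rpow (by linarith) (by linarith)
        have h4 : (2 * N * k) ^ p ≤ (2 * N) ^ p * (k + 1) ^ p := by
          rw [← Real.mul_rpow (by positivity) (by positivity)]
          exact Real.rpow_le_rpow (by positivity) (by nlinarith) (by linarith)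
        calc 2 ^ (p - 1) * (C * (2 * (2 ^ k * r)) + (2 * N * k) ^ p * (2 * (2 ^ k * r)))
            ≤ 2 ^ (p - 1) * (C * (k + 1) ^ p * (2 * (2 ^ k * r)) +
              (2 * N) ^ p * (k + 1) ^ p * (2 * (2 ^ k * r))) := by
              gcongr
              exact le_mul_of_one_le_right hC h3
          _ = _ := by ring

end JohnNirenberg

section TestFunction

variable {A b : ℝ → ℝ} {L N : ℝ}

/-- A bounded mean-zero function which detects the mean oscillation of `b` on an interval. -/
lemma IsBMOWith.exists_testFunction (hb : IsBMOWith b N) {x₀ r : ℝ} (hr : 0 < r) :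
    ∃ h : ℝ → ℝ, Integrable h ∧ (∀ y ∉ Ioo (x₀ - r) (x₀ + r), h y = 0) ∧ (∀ y, |h y| ≤ 2) ∧
      ∫ y, h y = 0 ∧ Integrable (fun y => (b y - intervalAvg b x₀ r) * h y) ∧
      ∫ y, (b y - intervalAvg b x₀ r) * h y = 2 * r * meanOsc b x₀ r ∧
      ∫ y, |(b y - intervalAvg b x₀ r) * h y| ≤ 4 * r * N := by
  set c := intervalAvg b x₀ r with hc
  set I := Ioo (x₀ - r) (x₀ + r)
  have hvol : volume.real I = 2 * r := by
    rw [Real.volume_real_Ioo_of_le (by linarith)]; ring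
  have hbm : AEMeasurable b := hb.1.aestronglyMeasurable.aemeasurable
  have hbi : IntegrableOn (fun y => b y - c) I :=
    (hb.integrableOn_sub_const _ _ c).mono_set Ioo_subset_Ico_self
  have hbc : ∫ y in I, (b y - c) = 0 := by
    have hbi0 : IntegrableOn b I := by
      simpa using (hb.integrableOn_sub_const (x₀ - r) (x₀ + r) 0).mono_set Ioo_subset_Ico_self
    rw [integral_sub hbi0 (integrableOn_const (by simp [I])), setIntegral_const, hvol, hc,
      intervalAvg, smul_eq_mul]
    field_simp
    ring
  have hosc : ∫ y in I, |b y - c| = 2 * r * meanOsc b x₀ r := by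
    rw [meanOsc]
    field_simp
    rfl
  set σ : ℝ → ℝ := fun y => if c ≤ b y then 1 else -1 with hσ
  have hσm : AEMeasurable σ := (Measurable.ite measurableSet_Ici measurable_const
    measurable_const : Measurable fun t : ℝ => if c ≤ t then (1:ℝ) else -1).comp_aemeasurable hbm
  have hσ1 : ∀ y, |σ y| ≤ 1 := fun y => by
    simp only [hσ]; split_ifs <;> simp
  have hσi : IntegrableOn σ I := Measure.integrableOn_of_bounded (M := 1) (by simp [I])
    hσm.aestronglyMeasurable (ae_of_all _ hσ1)
  set a := (2 * r)⁻¹ * ∫ y in I, σ y with ha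
  have ha1 : |a| ≤ 1 := by
    have := norm_setIntegral_le_of_norm_le_const (f := σ) (C := 1) (s := I) (μ := volume)
      (by simp [I]) fun y _ => hσ1 y
    rw [hvol, one_mul, Real.norm_eq_abs] at this
    rw [ha, abs_mul, abs_of_pos (by positivity : 0 < (2 * r)⁻¹), inv_mul_le_iff₀ (by positivity)]
    linarith
  have h2 : ∀ y, |σ y - a| ≤ 2 := fun y => (abs_sub _ _).trans (by linarith [hσ1 y])
  have hmul : ∀ y, (b y - c) * I.indicator (fun y => σ y - a) y =
      I.indicator (fun y => (b y - c) * (σ y - a)) y := fun y => by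
    by_cases hy : y ∈ I
    · simp only [indicator_of_mem hy]
    · simp only [indicator_of_notMem hy, mul_zero]
  have hσb : ∀ y, (b y - c) * (σ y - a) = |b y - c| - a * (b y - c) := fun y => by
    simp only [hσ]
    split_ifs with h
    · rw [abs_of_nonneg (by linarith)]; ring
    · rw [abs_of_neg (by linarith)]; ring
  have hmi : IntegrableOn (fun y => (b y - c) * (σ y - a)) I := by
    simp_rw [hσb]
    exact hbi.abs.sub (hbi.const_mul a)
  refine ⟨I.indicator fun y => σ y - a, ?_, fun y hy => indicator_of_notMem hy _, fun y => ?_,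
    ?_, ?_, ?_, ?_⟩
  · exact (integrable_indicator_iff measurableSet_Ioo).2
      (hσi.sub (integrableOn_const (by simp [I])))
  · by_cases hy : y ∈ I
    · rw [indicator_of_mem hy]; exact h2 y
    · rw [indicator_of_notMem hy]; simp
  · rw [integral_indicator measurableSet_Ioo, integral_sub hσi (integrableOn_const (by simp [I])),
      setIntegral_const, hvol, ha, smul_eq_mul]
    field_simp
    ring
  · simp_rw [hmul]
    exact (integrable_indicator_iff measurableSet_Ioo).2 hmi
  · simp_rw [hmul]
    rw [integral_indicator measurableSet_Ioo]
    simp_rw [hσb]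
    rw [integral_sub hbi.abs (hbi.const_mul a), integral_const_mul, hbc, hosc]
    ring
  · have e : ∀ y, |(b y - c) * I.indicator (fun y => σ y - a) y| =
        I.indicator (fun y => |(b y - c) * (σ y - a)|) y := fun y => by
      rw [hmul]
      by_cases hy : y ∈ I
      · simp only [indicator_of_mem hy]
      · simp only [indicator_of_notMem hy, abs_zero]
    simp_rw [e]
    rw [integral_indicator measurableSet_Ioo]
    calc ∫ y in I, |(b y - c) * (σ y - a)| ≤ ∫ y in I, |b y - c| * 2 := by
          refine integral_mono hmi.abs (hbi.abs.mul_const 2) fun y => ?_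
          simp only
          rw [abs_mul]
          gcongr
          exact h2 y
      _ = 4 * r * meanOsc b x₀ r := by rw [integral_mul_const, hosc]; ring
      _ ≤ 4 * r * N := by gcongr; exact hb.2 x₀ r hr

lemma norm_integral_cauchyKernel_sub_le (hA : ∀ x₁ x₂ : ℝ, |A x₁ - A x₂| ≤ L * |x₁ - x₂|)
    (hL : 0 < L) {F : ℝ → ℂ} (hF : Integrable F) {x₀ r x : ℝ} (hr : 0 < r)
    (hs : ∀ y ∉ Ioo (x₀ - r) (x₀ + r), F y = 0) (hx : 2 * r ≤ |x - x₀|) :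
    Integrable (fun y => cauchyKernel A x y * F y) ∧
    ‖(∫ y, cauchyKernel A x y * F y) - cauchyKernel A x x₀ * ∫ y, F y‖ ≤
      2 * (1 + L) * r / |x - x₀| ^ 2 * ∫ y, ‖F y‖ := by
  have hAm : Measurable A := (continuous_of_lipBound hA).measurable
  have hK : Measurable fun y => cauchyKernel A x y := by
    unfold cauchyKernel; fun_prop
  have hd : 0 < |x - x₀| := by linarith
  have hy' : ∀ y ∈ Ioo (x₀ - r) (x₀ + r), |y - x₀| ≤ r ∧ |x - x₀| / 2 ≤ |y - x| := by
    intro y hy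
    have h1 : |y - x₀| ≤ r := abs_le.2 ⟨by linarith [hy.1], by linarith [hy.2]⟩
    have h2 := abs_sub_le x y x₀
    rw [abs_sub_comm x y] at h2
    exact ⟨h1, by linarith⟩
  have hi : Integrable fun y => cauchyKernel A x y * F y := by
    refine (hF.norm.const_mul r⁻¹).mono (hK.aestronglyMeasurable.mul hF.1) (ae_of_all _ fun y => ?_)
    rw [norm_mul, Real.norm_of_nonneg (by positivity)]
    by_cases hy : y ∈ Ioo (x₀ - r) (x₀ + r)
    · gcongr
      refine (norm_cauchyKernel_le x y).trans (inv_anti₀ hr ?_)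
      linarith [(hy' y hy).2]
    · rw [hs y hy]; simp
  refine ⟨hi, ?_⟩
  rw [← integral_const_mul, ← integral_sub hi (hF.const_mul _), ← integral_const_mul]
  refine norm_integral_le_of_norm_le (hF.norm.const_mul _) (ae_of_all _ fun y => ?_)
  rw [← sub_mul, norm_mul]
  by_cases hy : y ∈ Ioo (x₀ - r) (x₀ + r)
  · obtain ⟨h1, h2⟩ := hy' y hy
    gcongr
    have hyx : 0 < |y - x| := by linarith
    refine (norm_cauchyKernel_sub_le hA hL (sub_ne_zero.1 (abs_pos.1 hyx))
      (sub_ne_zero.1 (abs_pos.1 (by rwa [abs_sub_comm])))).trans ?_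
    rw [abs_sub_comm x₀ x]
    calc (1 + L) * |y - x₀| / (|y - x| * |x - x₀|)
        ≤ (1 + L) * r / (|x - x₀| / 2 * |x - x₀|) := by gcongr
      _ = 2 * (1 + L) * r / |x - x₀| ^ 2 := by field_simp
  · rw [hs y hy]; simp

/-- The commutator acting on a mean-zero function, away from the support of the function. -/
lemma norm_commutator_add_le (hA : ∀ x₁ x₂ : ℝ, |A x₁ - A x₂| ≤ L * |x₁ - x₂|)
    (hL : 0 < L) {x₀ r c s M : ℝ} (hr : 0 < r) (hs : 0 ≤ s) {h : ℝ → ℝ} (hi : Integrable h)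
    (hsupp : ∀ y ∉ Ioo (x₀ - r) (x₀ + r), h y = 0) (h2 : ∀ y, |h y| ≤ 2) (h0 : ∫ y, h y = 0)
    (hbi : Integrable fun y => (b y - c) * h y) (hM : ∫ y, (b y - c) * h y = M)
    (hN : ∫ y, |(b y - c) * h y| ≤ 4 * r * N) {x : ℝ} (hx : 2 * r ≤ |x - x₀|) {u w : ℂ}
    (hu : cauchyPV A (fun y => ((s * h y : ℝ) : ℂ)) x u)
    (hw : cauchyPV A (fun y => (b y : ℂ) * ((s * h y : ℝ) : ℂ)) x w) :
    ‖((b x : ℂ) * u - w) + cauchyKernel A x x₀ * ((s * M : ℝ) : ℂ)‖ ≤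
      8 * (1 + L) * r ^ 2 * s / |x - x₀| ^ 2 * (N + |b x - c|) := by
  have hfar : ∀ y, |y - x| < r → h y = 0 := fun y hy => hsupp y fun hyI => by
    have h1 : |y - x₀| ≤ r := abs_le.2 ⟨by linarith [hyI.1], by linarith [hyI.2]⟩
    have h3 := abs_sub_le x y x₀
    rw [abs_sub_comm x y] at h3
    linarith
  set F : ℝ → ℂ := fun y => ((s * h y : ℝ) : ℂ) with hFdef
  set G : ℝ → ℂ := fun y => ((s * ((b y - c) * h y) : ℝ) : ℂ) with hGdef
  have hF : Integrable F := (hi.const_mul s).ofReal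
  have hG : Integrable G := (hbi.const_mul s).ofReal
  have hFs : ∀ y ∉ Ioo (x₀ - r) (x₀ + r), F y = 0 := fun y hy => by simp [F, hsupp y hy]
  have hGs : ∀ y ∉ Ioo (x₀ - r) (x₀ + r), G y = 0 := fun y hy => by simp [G, hsupp y hy]
  have hu' : u = ∫ y, cauchyKernel A x y * F y :=
    tendsto_nhds_unique hu (cauchyPV_of_eq_zero_of_abs_sub_lt hr fun y hy => by
      simp [F, hfar y hy])
  have hw' : w = ∫ y, cauchyKernel A x y * ((b y : ℂ) * F y) :=
    tendsto_nhds_unique hw (cauchyPV_of_eq_zero_of_abs_sub_lt hr fun y hy => by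
      simp [hfar y hy])
  obtain ⟨iF, bF⟩ := norm_integral_cauchyKernel_sub_le hA hL hF hr hFs hx
  obtain ⟨iG, bG⟩ := norm_integral_cauchyKernel_sub_le hA hL hG hr hGs hx
  have eF : ∫ y, F y = 0 := by
    simp only [hFdef]
    rw [integral_complex_ofReal, integral_const_mul, h0]; simp
  have eG : ∫ y, G y = ((s * M : ℝ) : ℂ) := by
    simp only [hGdef]
    rw [integral_complex_ofReal, integral_const_mul, hM]
  have nF : ∫ y, ‖F y‖ ≤ 4 * r * s := by
    have h1 : ∀ y, ‖F y‖ ≤ (Ioo (x₀ - r) (x₀ + r)).indicator (fun _ => 2 * s) y := fun y => by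
      by_cases hy : y ∈ Ioo (x₀ - r) (x₀ + r)
      · rw [indicator_of_mem hy, Complex.norm_real, norm_mul, Real.norm_of_nonneg hs,
          Real.norm_eq_abs, mul_comm]
        gcongr
        exact h2 y
      · rw [indicator_of_notMem hy, hFs y hy, norm_zero]
    refine (integral_mono hF.norm ((integrable_indicator_iff measurableSet_Ioo).2
      (integrableOn_const (by simp))) h1).trans (le_of_eq ?_)
    rw [integral_indicator measurableSet_Ioo, setIntegral_const,
      Real.volume_real_Ioo_of_le (by linarith), smul_eq_mul]
    ring
  have nG : ∫ y, ‖G y‖ ≤ 4 * r * N * s := by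
    have : ∀ y, ‖G y‖ = s * |(b y - c) * h y| := fun y => by
      rw [Complex.norm_real, norm_mul, Real.norm_of_nonneg hs, Real.norm_eq_abs]
    simp_rw [this]
    rw [integral_const_mul, mul_comm]
    gcongr
  have ew : w = (∫ y, cauchyKernel A x y * G y) + (c : ℂ) * u := by
    rw [hw', hu', ← integral_const_mul, ← integral_add iG (iF.const_mul _)]
    congr 1; ext y
    simp only [F, G]; push_cast; ring
  rw [eF, mul_zero, sub_zero, ← hu'] at bF
  rw [eG] at bG
  have e : ((b x : ℂ) * u - w) + cauchyKernel A x x₀ * ((s * M : ℝ) : ℂ) =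
      ((b x - c : ℝ) : ℂ) * u - ((∫ y, cauchyKernel A x y * G y) -
        cauchyKernel A x x₀ * ((s * M : ℝ) : ℂ)) := by
    rw [ew]; push_cast; ring
  rw [e]
  refine (norm_sub_le _ _).trans ?_
  rw [norm_mul, Complex.norm_real, Real.norm_eq_abs]
  calc |b x - c| * ‖u‖ + ‖(∫ y, cauchyKernel A x y * G y) -
        cauchyKernel A x x₀ * ((s * M : ℝ) : ℂ)‖
      ≤ |b x - c| * (2 * (1 + L) * r / |x - x₀| ^ 2 * (4 * r * s)) +
        2 * (1 + L) * r / |x - x₀| ^ 2 * (4 * r * N * s) := by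
        gcongr
        · exact bF.trans (by gcongr)
        · exact bG.trans (by gcongr)
    _ = _ := by ring

end TestFunction

section Bounds

variable {b : ℝ → ℝ} {g : ℝ → ℂ} {p C D N r s x₀ c δ : ℝ}

lemma inv_two_pow_rpow_mul (k : ℕ) : ((2 ^ k : ℝ)⁻¹) ^ p * 2 ^ k = ((2 ^ k : ℝ)⁻¹) ^ (p - 1) := by
  rw [Real.rpow_sub_one (by positivity)]
  field_simp

lemma le_lintegral_of_ae_le_norm (hbm : AEMeasurable b) (hp : 0 < p) (hD : 0 < D) (hr : 0 < r)
    (hs : 0 < s) (hsp : s ^ p = r⁻¹) (hδ : 0 < δ) (k : ℕ)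
    (hg : ∀ᵐ y, y ∈ Ioo (x₀ + 2 ^ k * r) (x₀ + 2 ^ (k + 1) * r) →
      s * (2 ^ k)⁻¹ * (δ - D * (2 ^ k)⁻¹ * (N + |b y - c|)) ≤ ‖g y‖)
    (hJN : ∫⁻ y in Ioo (x₀ - 2 ^ (k + 1) * r) (x₀ + 2 ^ (k + 1) * r), ‖b y - c‖ₑ ^ p ≤
      ENNReal.ofReal (C * (k + 2) ^ p * (2 ^ (k + 1) * r)))
    (hk1 : D * N * (2 ^ k)⁻¹ ≤ δ / 4)
    (hk2 : ((k + 2) * (2 ^ k)⁻¹) ^ p * (4 * C) ≤ (δ / (4 * D)) ^ p) :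
    ENNReal.ofReal ((δ / 2) ^ p / 2 * ((2 ^ k)⁻¹) ^ (p - 1)) ≤
      ∫⁻ y in Ioo (x₀ + 2 ^ k * r) (x₀ + 2 ^ (k + 1) * r), ‖g y‖ₑ ^ p := by
  set J := Ioo (x₀ + 2 ^ k * r) (x₀ + 2 ^ (k + 1) * r) with hJ
  set η := δ / (4 * D) with hη
  have h2k : (0:ℝ) < 2 ^ k := by positivity
  have hT : 0 < (η * 2 ^ k) ^ p := by positivity
  set B : Set ℝ := {y | η * 2 ^ k ≤ |b y - c|} with hB
  have hBm : NullMeasurableSet B := nullMeasurableSet_le aemeasurable_const (hbm.sub_const c).abs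
  have hvJ : volume J = ENNReal.ofReal (2 ^ k * r) := by
    rw [hJ, Real.volume_Ioo]; congr 1; ring
  have hvB : volume (B ∩ J) ≤ ENNReal.ofReal (2 ^ k * r / 2) := by
    have h1 : ENNReal.ofReal ((η * 2 ^ k) ^ p) * volume.restrict J B ≤
        ∫⁻ y in J, ‖b y - c‖ₑ ^ p := by
      refine le_trans ?_ (mul_meas_ge_le_lintegral₀ (μ := volume.restrict J)
        ((hbm.sub_const c).enorm.pow_const p).restrict (ENNReal.ofReal ((η * 2 ^ k) ^ p)))
      refine mul_le_mul_right (measure_mono fun y hy => ?_) _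
      show ENNReal.ofReal ((η * 2 ^ k) ^ p) ≤ ‖b y - c‖ₑ ^ p
      rw [Real.enorm_eq_ofReal_abs, ENNReal.ofReal_rpow_of_nonneg (abs_nonneg _) hp.le]
      exact ENNReal.ofReal_le_ofReal (Real.rpow_le_rpow (by positivity) hy hp.le)
    rw [Measure.restrict_apply₀' measurableSet_Ioo.nullMeasurableSet] at h1
    have h2 : ∫⁻ y in J, ‖b y - c‖ₑ ^ p ≤
        ENNReal.ofReal ((η * 2 ^ k) ^ p) * ENNReal.ofReal (2 ^ k * r / 2) := by
      refine (lintegral_mono_set (Ioo_subset_Ioo_left ?_)).trans (hJN.trans ?_)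
      · have : 0 < 2 ^ k * r := by positivity
        have : 0 < 2 ^ (k + 1) * r := by positivity
        linarith
      · rw [← ENNReal.ofReal_mul (by positivity)]
        refine ENNReal.ofReal_le_ofReal ?_
        rw [Real.mul_rpow (by positivity) (by positivity)] at hk2 ⊢
        rw [Real.inv_rpow h2k.le] at hk2
        have h3 : ((k:ℝ) + 2) ^ p * (4 * C) ≤ η ^ p * (2 ^ k) ^ p := by
          have : (0:ℝ) < (2 ^ k) ^ p := by positivity
          calc ((k:ℝ) + 2) ^ p * (4 * C)
              = (((k:ℝ) + 2) ^ p * ((2 ^ k) ^ p)⁻¹ * (4 * C)) * (2 ^ k) ^ p := by field_simp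
            _ ≤ _ := by gcongr
        calc C * ((k:ℝ) + 2) ^ p * (2 ^ (k + 1) * r)
            = ((k:ℝ) + 2) ^ p * (4 * C) * (2 ^ k * r / 2) := by ring
          _ ≤ _ := by gcongr
    exact (ENNReal.mul_le_mul_iff_right (by simpa using hT) ENNReal.ofReal_ne_top).1 (h1.trans h2)
  have hvd : ENNReal.ofReal (2 ^ k * r / 2) ≤ volume (J \ (B ∩ J)) := by
    refine le_trans ?_ le_measure_sdiff
    rw [hvJ]
    refine le_trans ?_ (tsub_le_tsub_left hvB _)
    rw [← ENNReal.ofReal_sub _ (by positivity)]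
    exact ENNReal.ofReal_le_ofReal (by linarith)
  have hm : NullMeasurableSet (J \ (B ∩ J)) :=
    measurableSet_Ioo.nullMeasurableSet.diff (hBm.inter measurableSet_Ioo.nullMeasurableSet)
  calc ENNReal.ofReal ((δ / 2) ^ p / 2 * ((2 ^ k)⁻¹) ^ (p - 1))
      = ENNReal.ofReal ((s * (2 ^ k)⁻¹ * (δ / 2)) ^ p) * ENNReal.ofReal (2 ^ k * r / 2) := by
        rw [← ENNReal.ofReal_mul (by positivity), Real.mul_rpow (by positivity) (by positivity),
          Real.mul_rpow (by positivity) (by positivity), hsp, ← inv_two_pow_rpow_mul]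
        congr 1
        field_simp
    _ ≤ ENNReal.ofReal ((s * (2 ^ k)⁻¹ * (δ / 2)) ^ p) * volume (J \ (B ∩ J)) := by gcongr
    _ = ∫⁻ y in J \ (B ∩ J), ENNReal.ofReal ((s * (2 ^ k)⁻¹ * (δ / 2)) ^ p) := by
        rw [setLIntegral_const]
    _ ≤ ∫⁻ y in J \ (B ∩ J), ‖g y‖ₑ ^ p := by
        refine lintegral_mono_ae ((ae_restrict_iff'₀ hm).2 ?_)
        filter_upwards [hg] with y hy hyJ
        have hyB : |b y - c| < η * 2 ^ k := not_le.1 fun h => hyJ.2 ⟨h, hyJ.1⟩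
        rw [← ofReal_norm, ENNReal.ofReal_rpow_of_nonneg (norm_nonneg _) hp.le]
        refine ENNReal.ofReal_le_ofReal (Real.rpow_le_rpow (by positivity) ?_ hp.le)
        refine le_trans ?_ (hy hyJ.1)
        gcongr
        have h3 : D * (2 ^ k)⁻¹ * |b y - c| ≤ D * (2 ^ k)⁻¹ * (η * 2 ^ k) := by gcongr
        have h4 : D * (2 ^ k)⁻¹ * (η * 2 ^ k) = δ / 4 := by rw [hη]; field_simp
        nlinarith
    _ ≤ ∫⁻ y in J, ‖g y‖ₑ ^ p := lintegral_mono_set sdiff_subset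

lemma Real.add_rpow_le_two_rpow_mul {t u : ℝ} (ht : 0 ≤ t) (hu : 0 ≤ u) (hp : 1 ≤ p) :
    (t + u) ^ p ≤ 2 ^ (p - 1) * (t ^ p + u ^ p) := by
  exact_mod_cast NNReal.rpow_add_le_mul_rpow_add_rpow ⟨t, ht⟩ ⟨u, hu⟩ hp

lemma natCast_add_two_mul_inv_le (k : ℕ) : ((k:ℝ) + 2) * (2 ^ k)⁻¹ ≤ 2 := by
  rw [← div_eq_mul_inv, div_le_iff₀ (by positivity)]
  have := one_add_mul_le_pow (a := (1:ℝ)) (by norm_num) k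
  norm_num at this
  linarith [(Nat.cast_nonneg k : (0:ℝ) ≤ k)]

lemma lintegral_le_of_ae_norm_le (hp : 1 ≤ p) (hD : 0 < D) (hN : 0 < N) (hC : 0 < C) (hr : 0 < r)
    (hs : 0 < s) (hsp : s ^ p = r⁻¹) (k : ℕ) {S : Set ℝ} (hS : MeasurableSet S)
    (hSI : S ⊆ Ioo (x₀ - 2 ^ (k + 1) * r) (x₀ + 2 ^ (k + 1) * r))
    (hg : ∀ᵐ y, y ∈ S → ‖g y‖ ≤ s * (2 ^ k)⁻¹ * (2 * N + D * (2 ^ k)⁻¹ * (N + |b y - c|)))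
    (hJN : ∫⁻ y in Ioo (x₀ - 2 ^ (k + 1) * r) (x₀ + 2 ^ (k + 1) * r), ‖b y - c‖ₑ ^ p ≤
      ENNReal.ofReal (C * (k + 2) ^ p * (2 ^ (k + 1) * r))) :
    ∫⁻ y in S, ‖g y‖ₑ ^ p ≤
      ENNReal.ofReal (2 ^ (p - 1) * ((2 * N + D * N) ^ p * 4 + D ^ p * (C * 2 ^ p * 2)) *
        ((2 ^ k)⁻¹) ^ (p - 1)) := by
  have hp0 : 0 < p := by linarith
  set E := 2 * N + D * N with hE
  set q : ℝ := (2 ^ k)⁻¹ with hq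
  have hq0 : 0 < q := by positivity
  have hq1 : q ≤ 1 := inv_le_one_of_one_le₀ (one_le_pow₀ (by norm_num))
  set I := Ioo (x₀ - 2 ^ (k + 1) * r) (x₀ + 2 ^ (k + 1) * r) with hI
  calc ∫⁻ y in S, ‖g y‖ₑ ^ p
      ≤ ∫⁻ y in S, ENNReal.ofReal ((s * q) ^ p * 2 ^ (p - 1)) *
          (ENNReal.ofReal ((D * q) ^ p) * ‖b y - c‖ₑ ^ p + ENNReal.ofReal (E ^ p)) := by
        refine lintegral_mono_ae ((ae_restrict_iff' hS).2 ?_)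
        filter_upwards [hg] with y hy hyS
        have h1 : ‖g y‖ ≤ s * q * (D * q * |b y - c| + E) := by
          refine (hy hyS).trans ?_
          have : D * q * N ≤ D * N := by
            rw [mul_right_comm]; exact mul_le_of_le_one_right (by positivity) hq1
          refine mul_le_mul_of_nonneg_left ?_ (by positivity)
          linarith
        rw [← ofReal_norm, ENNReal.ofReal_rpow_of_nonneg (norm_nonneg _) hp0.le,
          Real.enorm_eq_ofReal_abs, ENNReal.ofReal_rpow_of_nonneg (abs_nonneg _) hp0.le,
          ← ENNReal.ofReal_mul (by positivity), ← ENNReal.ofReal_add (by positivity)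
          (by positivity), ← ENNReal.ofReal_mul (by positivity)]
        refine ENNReal.ofReal_le_ofReal ((Real.rpow_le_rpow (norm_nonneg _) h1 hp0.le).trans ?_)
        rw [Real.mul_rpow (by positivity) (by positivity),
          mul_assoc ((s * q) ^ p), ← Real.mul_rpow (x := D * q) (by positivity) (by positivity)]
        exact mul_le_mul_of_nonneg_left
          (Real.add_rpow_le_two_rpow_mul (by positivity) (by positivity) hp) (by positivity)
    _ ≤ ∫⁻ y in I, ENNReal.ofReal ((s * q) ^ p * 2 ^ (p - 1)) *
          (ENNReal.ofReal ((D * q) ^ p) * ‖b y - c‖ₑ ^ p + ENNReal.ofReal (E ^ p)) :=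
        lintegral_mono_set hSI
    _ = ENNReal.ofReal ((s * q) ^ p * 2 ^ (p - 1)) * (ENNReal.ofReal ((D * q) ^ p) *
          (∫⁻ y in I, ‖b y - c‖ₑ ^ p) + ENNReal.ofReal (E ^ p) *
          ENNReal.ofReal (4 * (2 ^ k * r))) := by
        rw [lintegral_const_mul' _ _ ENNReal.ofReal_ne_top, lintegral_add_right _ measurable_const,
          lintegral_const_mul' _ _ ENNReal.ofReal_ne_top, setLIntegral_const, Real.volume_Ioo]
        congr 4; ring
    _ ≤ ENNReal.ofReal ((s * q) ^ p * 2 ^ (p - 1)) * (ENNReal.ofReal ((D * q) ^ p) *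
          ENNReal.ofReal (C * (k + 2) ^ p * (2 ^ (k + 1) * r)) + ENNReal.ofReal (E ^ p) *
          ENNReal.ofReal (4 * (2 ^ k * r))) := by gcongr
    _ ≤ _ := by
        rw [← ENNReal.ofReal_mul (by positivity), ← ENNReal.ofReal_mul (by positivity),
          ← ENNReal.ofReal_add (by positivity) (by positivity),
          ← ENNReal.ofReal_mul (by positivity)]
        refine ENNReal.ofReal_le_ofReal ?_
        have h5 : (((k:ℝ) + 2) * q) ^ p ≤ 2 ^ p :=
          Real.rpow_le_rpow (by positivity) (natCast_add_two_mul_inv_le k) hp0.le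
        rw [Real.mul_rpow (by positivity) hq0.le] at h5
        rw [Real.mul_rpow hs.le hq0.le, Real.mul_rpow hD.le hq0.le, hsp,
          ← inv_two_pow_rpow_mul, ← hq]
        calc r⁻¹ * q ^ p * 2 ^ (p - 1) * (D ^ p * q ^ p * (C * ((k:ℝ) + 2) ^ p *
              (2 ^ (k + 1) * r)) + E ^ p * (4 * (2 ^ k * r)))
            = 2 ^ (p - 1) * (E ^ p * 4 + D ^ p * (C * (((k:ℝ) + 2) ^ p * q ^ p) * 2)) *
              (q ^ p * 2 ^ k) := by field_simp; ring
          _ ≤ _ := by gcongr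

end Bounds

section Assembly

variable {A b : ℝ → ℝ} {L N : ℝ}

/-- For each interval on which `b` oscillates there is a normalised function whose commutator
satisfies pointwise upper and lower bounds away from the interval. -/
lemma IsBMOWith.exists_commutatorFn (hA : ∀ x₁ x₂ : ℝ, |A x₁ - A x₂| ≤ L * |x₁ - x₂|)
    (hL : 0 < L) (hb : IsBMOWith b N) {p : ℝ} (hp : 1 < p) {x₀ r : ℝ} (hr : 0 < r) :
    ∃ (f g : ℝ → ℂ), IsCommutatorFn A b f g ∧
      eLpNorm f (ENNReal.ofReal p) volume ≤ ENNReal.ofReal 4 ∧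
      ∀ᵐ y, 2 * r ≤ |y - x₀| →
        ‖g y + cauchyKernel A y x₀ * ((r ^ (-p⁻¹) * (2 * r * meanOsc b x₀ r) : ℝ) : ℂ)‖ ≤
        8 * (1 + L) * r ^ 2 * r ^ (-p⁻¹) / |y - x₀| ^ 2 * (N + |b y - intervalAvg b x₀ r|) := by
  have hp0 : 0 < p := by linarith
  set s := r ^ (-p⁻¹) with hs
  have hs0 : 0 < s := by positivity
  set c := intervalAvg b x₀ r
  obtain ⟨h, hi, hsupp, h2, h0, hbi, hM, hN⟩ := hb.exists_testFunction (x₀ := x₀) hr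
  set f : ℝ → ℂ := fun y => ((s * h y : ℝ) : ℂ) with hf
  have hlt : x₀ - r < x₀ + r := by linarith
  have hu := ae_exists_cauchyPV hA hL hlt (F := f) (hi.const_mul s).ofReal
    fun y hy => by simp [f, hsupp y hy]
  have hbf : Integrable fun y => (b y : ℂ) * f y := by
    have := ((hbi.const_mul s).add (hi.const_mul (c * s))).ofReal (𝕜 := ℂ)
    refine this.congr (ae_of_all _ fun y => ?_)
    simp only [f, Pi.add_apply]
    simp only [Complex.coe_algebraMap]
    push_cast
    ring
  have hw := ae_exists_cauchyPV hA hL hlt (F := fun y => (b y : ℂ) * f y) hbf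
    fun y hy => by simp [f, hsupp y hy]
  have hex : ∀ y, ∃ z : ℂ, (∃ u, cauchyPV A f y u) → (∃ w, cauchyPV A (fun y => (b y : ℂ) * f y) y w)
      → ∃ u w : ℂ, cauchyPV A f y u ∧ cauchyPV A (fun y => (b y : ℂ) * f y) y w ∧
        z = (b y : ℂ) * u - w := by
    intro y
    by_cases h1 : ∃ u, cauchyPV A f y u
    · by_cases h2 : ∃ w, cauchyPV A (fun y => (b y : ℂ) * f y) y w
      · obtain ⟨u, hu⟩ := h1
        obtain ⟨w, hw⟩ := h2
        exact ⟨_, fun _ _ => ⟨u, w, hu, hw, rfl⟩⟩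
      · exact ⟨0, fun _ h => absurd h h2⟩
    · exact ⟨0, fun h => absurd h h1⟩
  choose g hg using hex
  have hcomm : IsCommutatorFn A b f g := by
    filter_upwards [hu, hw] with y h1 h2
    exact hg y h1 h2
  refine ⟨f, g, hcomm, ?_, ?_⟩
  · have hle : ∀ y, ‖f y‖ ≤ ‖(Ioo (x₀ - r) (x₀ + r)).indicator (fun _ => 2 * s) y‖ := fun y => by
      by_cases hy : y ∈ Ioo (x₀ - r) (x₀ + r)
      · rw [indicator_of_mem hy, Complex.norm_real, norm_mul, Real.norm_of_nonneg hs0.le,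
          Real.norm_of_nonneg (show 0 ≤ 2 * s by positivity), Real.norm_eq_abs]
        nlinarith [h2 y]
      · simp [f, hsupp y hy]
    refine (eLpNorm_mono hle).trans ?_
    rw [eLpNorm_indicator_const measurableSet_Ioo (by simpa using hp0) ENNReal.ofReal_ne_top,
      ENNReal.toReal_ofReal hp0.le, Real.volume_Ioo, Real.enorm_of_nonneg (by positivity),
      ENNReal.ofReal_rpow_of_nonneg (by linarith) (by positivity),
      ← ENNReal.ofReal_mul (by positivity)]
    refine ENNReal.ofReal_le_ofReal ?_
    have e : x₀ + r - (x₀ - r) = 2 * r := by ring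
    have e2 : s * r ^ (1 / p) = 1 := by
      rw [hs, ← Real.rpow_add hr]; simp
    have e3 : (2:ℝ) ^ (1 / p) ≤ 2 := by
      calc (2:ℝ) ^ (1 / p) ≤ 2 ^ (1:ℝ) := Real.rpow_le_rpow_of_exponent_le (by norm_num)
            (by rw [div_le_one hp0]; exact hp.le)
        _ = 2 := Real.rpow_one 2
    rw [e, Real.mul_rpow (by norm_num) hr.le]
    calc 2 * s * (2 ^ (1 / p) * r ^ (1 / p)) = 2 * 2 ^ (1 / p) * (s * r ^ (1 / p)) := by ring
      _ ≤ 4 := by rw [e2]; linarith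
  · filter_upwards [hcomm] with y ⟨u, w, hu, hw, hgy⟩ hy
    rw [hgy]
    exact norm_commutator_add_le hA hL hr hs0.le hi hsupp h2 h0 hbi hM hN hy hu hw

lemma norm_bounds_of_norm_add_le (hA : ∀ x₁ x₂ : ℝ, |A x₁ - A x₂| ≤ L * |x₁ - x₂|)
    (hL : 0 < L) (hN : 0 < N) {x₀ r s M ε t y : ℝ} {z : ℂ} (hr : 0 < r) (hs : 0 < s)
    (ht : 0 ≤ t) (hε : 0 < ε) (hM : ε ≤ M) (hMN : M ≤ N) {k : ℕ}
    (hy1 : 2 ^ k * r ≤ |y - x₀|) (hy2 : |y - x₀| ≤ 2 ^ (k + 1) * r)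
    (h : ‖z + cauchyKernel A y x₀ * ((s * (2 * r * M) : ℝ) : ℂ)‖ ≤
      8 * (1 + L) * r ^ 2 * s / |y - x₀| ^ 2 * (N + t)) :
    s * (2 ^ k)⁻¹ * (ε / (1 + L) - 8 * (1 + L) * (2 ^ k)⁻¹ * (N + t)) ≤ ‖z‖ ∧
    ‖z‖ ≤ s * (2 ^ k)⁻¹ * (2 * N + 8 * (1 + L) * (2 ^ k)⁻¹ * (N + t)) := by
  have hd : 0 < |y - x₀| := lt_of_lt_of_le (by positivity) hy1
  have hM0 : 0 < M := hε.trans_le hM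
  have hn : ‖((s * (2 * r * M) : ℝ) : ℂ)‖ = s * (2 * r * M) := by
    rw [Complex.norm_real, Real.norm_of_nonneg (by positivity)]
  have h1 : 8 * (1 + L) * r ^ 2 * s / |y - x₀| ^ 2 * (N + t) ≤
      s * (2 ^ k)⁻¹ * (8 * (1 + L) * (2 ^ k)⁻¹ * (N + t)) := by
    calc 8 * (1 + L) * r ^ 2 * s / |y - x₀| ^ 2 * (N + t)
        ≤ 8 * (1 + L) * r ^ 2 * s / (2 ^ k * r) ^ 2 * (N + t) := by gcongr
      _ = _ := by field_simp
  have hlo : s * (2 ^ k)⁻¹ * (ε / (1 + L)) ≤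
      ‖cauchyKernel A y x₀ * ((s * (2 * r * M) : ℝ) : ℂ)‖ := by
    rw [norm_mul, hn]
    have := le_norm_cauchyKernel hA y x₀
    rw [abs_sub_comm] at this
    calc s * (2 ^ k)⁻¹ * (ε / (1 + L))
        = ((1 + L) * (2 ^ (k + 1) * r))⁻¹ * (s * (2 * r * ε)) := by
          rw [pow_succ]; field_simp
      _ ≤ ((1 + L) * |y - x₀|)⁻¹ * (s * (2 * r * M)) := by gcongr
      _ ≤ _ := by gcongr
  have hhi : ‖cauchyKernel A y x₀ * ((s * (2 * r * M) : ℝ) : ℂ)‖ ≤ s * (2 ^ k)⁻¹ * (2 * N) := by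
    rw [norm_mul, hn]
    have := norm_cauchyKernel_le (A := A) y x₀
    rw [abs_sub_comm] at this
    calc ‖cauchyKernel A y x₀‖ * (s * (2 * r * M)) ≤ |y - x₀|⁻¹ * (s * (2 * r * M)) := by gcongr
      _ ≤ (2 ^ k * r)⁻¹ * (s * (2 * r * N)) := by gcongr
      _ = _ := by field_simp
  have h3 := h.trans h1
  set w := cauchyKernel A y x₀ * ((s * (2 * r * M) : ℝ) : ℂ)
  have h4 : ‖w‖ ≤ ‖z + w‖ + ‖z‖ := by simpa using norm_sub_le (z + w) z
  have h5 : ‖z‖ ≤ ‖z + w‖ + ‖w‖ := by simpa using norm_sub_le (z + w) w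
  rw [mul_sub, mul_add]
  constructor <;> linarith

/-- All dyadic scales beyond some threshold are large enough for the lower bound. -/
lemma exists_threshold {p B B' θ θ' : ℝ} (hp : 0 < p) (hθ : 0 < θ) (hθ' : 0 < θ') :
    ∃ k₀ : ℕ, 3 ≤ k₀ ∧ ∀ k : ℕ, k₀ ≤ k → B * (2 ^ k)⁻¹ ≤ θ ∧
      (((k:ℝ) + 2) * (2 ^ k)⁻¹) ^ p * B' ≤ θ' := by
  have t0 : Tendsto (fun k : ℕ => ((2:ℝ) ^ k)⁻¹) atTop (nhds 0) := by
    simpa [inv_pow] using tendsto_pow_atTop_nhds_zero_of_lt_one (r := (2:ℝ)⁻¹) (by norm_num)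
      (by norm_num)
  have t1 : Tendsto (fun k : ℕ => (k:ℝ) * ((2:ℝ) ^ k)⁻¹) atTop (nhds 0) := by
    simpa [inv_pow] using tendsto_pow_const_mul_const_pow_of_abs_lt_one 1 (r := (2:ℝ)⁻¹)
      (by rw [abs_of_pos] <;> norm_num)
  have t2 : Tendsto (fun k : ℕ => ((k:ℝ) + 2) * ((2:ℝ) ^ k)⁻¹) atTop (nhds 0) := by
    simpa [add_mul] using t1.add (t0.const_mul 2)
  have t3 := (t2.rpow_const (p := p) (Or.inr hp.le)).mul_const B'
  rw [Real.zero_rpow hp.ne', zero_mul] at t3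
  have t4 := t0.const_mul B
  rw [mul_zero] at t4
  obtain ⟨k₀, hk₀⟩ := eventually_atTop.1 ((t4.eventually_lt_const hθ).and
    (t3.eventually_lt_const hθ'))
  exact ⟨max 3 k₀, le_max_left _ _, fun k hk =>
    ⟨(hk₀ k ((le_max_right _ _).trans hk)).1.le, (hk₀ k ((le_max_right _ _).trans hk)).2.le⟩⟩

end Assembly

/-- Key lemma: if `b ∈ BMO(ℝ)` with `‖b‖_BMO = 1` and `M(b, I_j) > ε` for a sequence of
intervals `I_j = (x_j - r_j, x_j + r_j)`, then there are functions `f_j` with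
`‖f_j‖_{L^p} ≤ C̃₀` such that for every `k ≥ ⌊log₂ A₁⌋` the commutator `[b, C_Γ] f_j`
satisfies the lower bound on `I_j^k = (x_j + 2^k r_j, x_j + 2^{k+1} r_j)` and the upper
bound on `2^{k+1} I_j ∖ 2^k I_j`. -/
theorem commutator_lower_upper_bounds
    (A : ℝ → ℝ) (L : ℝ) (hL : 0 < L)
    (hA : ∀ x₁ x₂ : ℝ, |A x₁ - A x₂| ≤ L * |x₁ - x₂|)
    (p : ℝ) (hp : 1 < p)
    (b : ℝ → ℝ) (hb : IsBMO b) (hbnorm : bmoNorm b = 1)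
    (ε : ℝ) (hε : 0 < ε)
    (x r : ℕ → ℝ) (hr : ∀ j, 0 < r j)
    (hosc : ∀ j, ε < meanOsc b (x j) (r j)) :
    ∃ (f g : ℕ → ℝ → ℂ) (A₁ C₀ C₁ C₂ : ℝ),
      4 < A₁ ∧ 0 < C₀ ∧ 0 < C₁ ∧ 0 < C₂ ∧
      ∀ j : ℕ,
        IsCommutatorFn A b (f j) (g j) ∧
        eLpNorm (f j) (ENNReal.ofReal p) volume ≤ ENNReal.ofReal C₀ ∧
        ∀ k : ℤ, ⌊Real.logb 2 A₁⌋ ≤ k →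
          (ENNReal.ofReal
              (C₁ * ε ^ p * ((2 * r j) / (2 ^ (k + 1) * r j)) ^ (p - 1)) ≤
            ∫⁻ y in Set.Ioo (x j + 2 ^ k * r j) (x j + 2 ^ (k + 1) * r j),
              (‖g j y‖₊ : ℝ≥0∞) ^ p) ∧
          (∫⁻ y in Set.Ioo (x j - 2 ^ (k + 1) * r j) (x j + 2 ^ (k + 1) * r j) \
                Set.Ioo (x j - 2 ^ k * r j) (x j + 2 ^ k * r j),
              (‖g j y‖₊ : ℝ≥0∞) ^ p ≤
            ENNReal.ofReal (C₂ * ((2 * r j) / (2 ^ (k + 1) * r j)) ^ (p - 1))) := by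
  obtain ⟨N, hb⟩ := hb
  have hN : 0 < N := hε.trans ((hosc 0).trans_le (hb.2 _ _ (hr 0)))
  have hp0 : 0 < p := by linarith
  obtain ⟨C, hC, hJN⟩ := hb.exists_lintegral_two_pow_rpow_le hN hp.le
  set D := 8 * (1 + L) with hD
  have hD0 : 0 < D := by positivity
  set δ := ε / (1 + L) with hδ
  have hδ0 : 0 < δ := by positivity
  obtain ⟨k₀, hk₀3, hk₀⟩ := exists_threshold (p := p) (B := D * N) (B' := 4 * C) (θ := δ / 4)
    (θ' := (δ / (4 * D)) ^ p) hp0 (by positivity) (by positivity)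
  choose f g hfg hf hg using fun j => hb.exists_commutatorFn hA hL hp (x₀ := x j) (hr j)
  refine ⟨f, g, 2 ^ k₀, 4, (2 * (1 + L))⁻¹ ^ p / 2,
    2 ^ (p - 1) * ((2 * N + D * N) ^ p * 4 + D ^ p * (C * 2 ^ p * 2)), ?_, by norm_num,
    by positivity, by positivity, fun j => ⟨hfg j, hf j, fun k hk => ?_⟩⟩
  · calc (4:ℝ) < 2 ^ 3 := by norm_num
      _ ≤ 2 ^ k₀ := pow_le_pow_right₀ (by norm_num) hk₀3
  rw [Real.logb_pow, Real.logb_self_eq_one (by norm_num), mul_one, Int.floor_natCast] at hk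
  lift k to ℕ using (Int.natCast_nonneg k₀).trans hk
  have hk : k₀ ≤ k := by exact_mod_cast hk
  have hrj := hr j
  have ez : (2:ℝ) ^ ((k:ℤ) + 1) = 2 ^ (k + 1) := by exact_mod_cast zpow_natCast (2:ℝ) (k + 1)
  have er : 2 * r j / (2 ^ (k + 1) * r j) = ((2:ℝ) ^ k)⁻¹ := by
    rw [pow_succ]; field_simp
  simp only [ez, zpow_natCast, er, ← enorm_eq_nnnorm]
  set s := r j ^ (-p⁻¹) with hs
  have hs0 : 0 < s := by positivity
  have hsp : s ^ p = (r j)⁻¹ := by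
    rw [hs, ← Real.rpow_mul hrj.le, neg_mul, inv_mul_cancel₀ hp0.ne', Real.rpow_neg_one]
  have h2k : 2 * r j ≤ 2 ^ k * r j := by
    gcongr
    exact le_self_pow₀ (by norm_num) (by omega)
  have hpt : ∀ᵐ y, 2 ^ k * r j ≤ |y - x j| → |y - x j| ≤ 2 ^ (k + 1) * r j →
      s * (2 ^ k)⁻¹ * (δ - D * (2 ^ k)⁻¹ * (N + |b y - intervalAvg b (x j) (r j)|)) ≤ ‖g j y‖ ∧
      ‖g j y‖ ≤ s * (2 ^ k)⁻¹ * (2 * N +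
        D * (2 ^ k)⁻¹ * (N + |b y - intervalAvg b (x j) (r j)|)) := by
    filter_upwards [hg j] with y hy h1 h2
    exact norm_bounds_of_norm_add_le hA hL hN hrj hs0 (abs_nonneg _) hε (hosc j).le
      (hb.2 _ _ hrj) h1 h2 (hy (h2k.trans h1))
  have hJN' := hJN (x j) (r j) hrj (k + 1)
  have e2 : ((k + 1 : ℕ) : ℝ) + 1 = k + 2 := by push_cast; ring
  rw [e2] at hJN'
  constructor
  · have hbm : AEMeasurable b := hb.1.aestronglyMeasurable.aemeasurable
    have := le_lintegral_of_ae_le_norm hbm hp0 hD0 hrj hs0 hsp hδ0 k (g := g j) (N := N) (by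
      filter_upwards [hpt] with y hy hyJ
      have e : |y - x j| = y - x j := abs_of_pos (by linarith [hyJ.1])
      exact (hy (by rw [e]; linarith [hyJ.1]) (by rw [e]; linarith [hyJ.2])).1) hJN'
      (hk₀ k hk).1 (hk₀ k hk).2
    refine le_trans (le_of_eq ?_) this
    congr 2
    rw [hδ, div_div, div_eq_mul_inv ε, Real.mul_rpow hε.le (by positivity), mul_comm (1 + L) 2]
    ring
  · refine lintegral_le_of_ae_norm_le hp.le hD0 hN hC hrj hs0 hsp k
      (measurableSet_Ioo.diff measurableSet_Ioo) sdiff_subset ?_ hJN'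
    filter_upwards [hpt] with y hy hyS
    refine (hy ?_ ?_).2
    · by_contra! h
      obtain ⟨h1, h2⟩ := abs_lt.1 h
      exact hyS.2 ⟨by linarith, by linarith⟩
    · exact abs_le.2 ⟨by linarith [hyS.1.1], by linarith [hyS.1.2]⟩
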